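/- Let G_0 = G_0(n) be any sequence of graphs on the vertex set {1,…,n}, let G_rand ∼ G(n,p) for any sequence p = p_n ∈ [0,1/2], and set G = G_0 △ G_rand. Then with high probability G has the property that u and v receive distinct colours in the stable colouring R*_G σ for every pair of distinct vertices u, v such that u ∈ V_3(G_rand). -/

import Mathlib

open MeasureTheory Filter

/-- Product of (independent) Bernoulli distributions on `ι → Bool`, with
success probability `q i` in coordinate `i`. -/
noncomputable def bernoulliProduct (ι : Type*) [Fintype ι] [DecidableEq ι] (q : ι → ℝ) :
    Measure (ι → Bool) :=
  ∑ f : ι → Bool,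
    (∏ i : ι, if f i then ENNReal.ofReal (q i) else ENNReal.ofReal (1 - q i)) •
      Measure.dirac f

/-- The Erdős–Rényi measure: each (potential) edge of the complete graph on `Fin n`
is present independently with probability `p`; encoded as a random `Sym2 (Fin n) → Bool`. -/
noncomputable def erdosRenyiMeasure (n : ℕ) (p : ℝ) : Measure (Sym2 (Fin n) → Bool) :=
  bernoulliProduct (Sym2 (Fin n)) fun _ => p

/-- The graph on `Fin n` determined by an edge-indicator function. -/
def graphOfFlip {n : ℕ} (f : Sym2 (Fin n) → Bool) : SimpleGraph (Fin n) :=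
  SimpleGraph.fromRel fun u v => f s(u, v) = true

/-- Symmetric difference of two graphs on the same vertex set. -/
def symmDiffG {V : Type*} (G₁ G₂ : SimpleGraph V) : SimpleGraph V :=
  SimpleGraph.fromRel fun u v => Xor' (G₁.Adj u v) (G₂.Adj u v)

/-- `crEquiv G c t u v` : vertices `u` and `v` get the same colour after `t` rounds of
colour refinement on `G`, starting from the colouring `c`. -/
def crEquiv {V : Type*} {Ω : Type*} (G : SimpleGraph V) (c : V → Ω) : ℕ → V → V → Prop
  | 0, u, v => c u = c v
  | (t + 1), u, v => crEquiv G c t u v ∧ ∀ w : V,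
      Nat.card {x : V // G.Adj u x ∧ crEquiv G c t x w} =
      Nat.card {x : V // G.Adj v x ∧ crEquiv G c t x w}

/-- `u` and `v` get the same colour in the stable colouring `R* c`. -/
def crStable {V : Type*} {Ω : Type*} (G : SimpleGraph V) (c : V → Ω) (u v : V) : Prop :=
  ∀ t, crEquiv G c t u v

/-- `u` and `v` get the same colour in the stable colouring `R* σ`
(colour refinement started from the trivial colouring). -/
def crStableTrivial {V : Type*} (G : SimpleGraph V) (u v : V) : Prop :=
  crStable G (fun _ => (0 : ℕ)) u v

/-- Equality of the initial pair-colourings `φ_{G,c}` on two ordered pairs of vertices. -/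
def wl2Init {V : Type*} {Ω : Type*} (G : SimpleGraph V) (c : V → Ω) (p q : V × V) : Prop :=
  (G.Adj p.1 p.2 ↔ G.Adj q.1 q.2) ∧ (p.1 = p.2 ↔ q.1 = q.2) ∧
    (p.1 = p.2 → q.1 = q.2 → c p.2 = c q.2)

/-- `wl2Equiv G c t p q` : the ordered pairs `p` and `q` get the same colour after `t` rounds of
the 2-dimensional Weisfeiler–Leman refinement on `G`, started from `φ_{G,c}`. -/
def wl2Equiv {V : Type*} {Ω : Type*} (G : SimpleGraph V) (c : V → Ω) :
    ℕ → V × V → V × V → Prop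
  | 0, p, q => wl2Init G c p q
  | (t + 1), p, q => wl2Equiv G c t p q ∧ ∀ r s : V × V,
      Nat.card {w : V // wl2Equiv G c t (p.1, w) r ∧ wl2Equiv G c t (w, p.2) s} =
      Nat.card {w : V // wl2Equiv G c t (q.1, w) r ∧ wl2Equiv G c t (w, q.2) s}

/-- `u` and `v` get the same colour in the vertex colouring `V* c` obtained from the stable
pair colouring of the 2-dimensional Weisfeiler–Leman algorithm started from `φ_{G,c}`. -/
def wl2VertexEquiv {V : Type*} {Ω : Type*} (G : SimpleGraph V) (c : V → Ω) (u v : V) : Prop :=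
  ∀ t, wl2Equiv G c t (u, u) (v, v)

/-- Given a colouring of `V(H)` encoded as the equivalence relation `r` ("has the same colour"),
`majority H r u v` says that at least half of the possible edges between the colour class of `u`
and the colour class of `v` are present in `H` (counting ordered pairs). -/
def majority {V : Type*} (H : SimpleGraph V) (r : V → V → Prop) (u v : V) : Prop :=
  Nat.card {p : V × V // p.1 ≠ p.2 ∧ r p.1 u ∧ r p.2 v} ≤
    2 * Nat.card {p : V × V // p.1 ≠ p.2 ∧ r p.1 u ∧ r p.2 v ∧ H.Adj p.1 p.2}

/-- The disparity graph `D(H,c)`, for the colouring encoded by the relation `r`. -/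
def disparity {V : Type*} (H : SimpleGraph V) (r : V → V → Prop) : SimpleGraph V :=
  SimpleGraph.fromRel fun u v => Xor' (H.Adj u v) (majority H r u v)

/-- The generalised disparity graph `D_L(H,c)` for a 0-1 matrix `L` on colours. -/
def gDisparity {V : Type*} {Ω : Type*} (H : SimpleGraph V) (c : V → Ω) (L : Ω → Ω → Bool) :
    SimpleGraph V :=
  SimpleGraph.fromRel fun u v => Xor' (H.Adj u v) (L (c u) (c v) = true)

/-- The vertex set of the connected component of `v` in `G`. -/
def compSet {V : Type*} (G : SimpleGraph V) (v : V) : Set V := {u | G.Reachable v u}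

/-- A colouring is equitable if any two vertices with the same colour have the same number of
neighbours in every colour class. -/
def IsEquitable {V : Type*} {Ω : Type*} (H : SimpleGraph V) (c : V → Ω) : Prop :=
  ∀ u v, c u = c v → ∀ a : Ω,
    Nat.card {x : V // H.Adj u x ∧ c x = a} = Nat.card {x : V // H.Adj v x ∧ c x = a}

/-- Vertex set of the `k`-core of `G`: the union of all vertex sets inducing minimum
degree at least `k`. -/
def kCore {V : Type*} (G : SimpleGraph V) (k : ℕ) : Set V :=
  ⋃₀ {S : Set V | ∀ v ∈ S, k ≤ Nat.card {u : V // u ∈ S ∧ G.Adj v u}}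

/-- `V_{2,3}(G)`: vertices of the 2-core of `G` having degree at least 3 in the 2-core. -/
def V23 {V : Type*} (G : SimpleGraph V) : Set V :=
  {v | v ∈ kCore G 2 ∧ 3 ≤ Nat.card {u : V // u ∈ kCore G 2 ∧ G.Adj v u}}

/-- The graph obtained from `G` by deleting all edges meeting `T`
(so that reachability in `avoidG G T` from `v ∉ T` is reachability in `G - T`). -/
def avoidG {V : Type*} (G : SimpleGraph V) (T : Set V) : SimpleGraph V :=
  SimpleGraph.fromRel fun u v => G.Adj u v ∧ u ∉ T ∧ v ∉ T

/-- `V_{2,3}^{safe}(G)`: vertices `v ∈ V_{2,3}(G)` such that after deleting any set of at most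
two other vertices, the component of `v` still contains at least 3 vertices of `V_{2,3}(G)`. -/
def V23safe {V : Type*} (G : SimpleGraph V) : Set V :=
  {v | v ∈ V23 G ∧ ∀ T : Finset V, T.card ≤ 2 → v ∉ T →
    3 ≤ Nat.card {w : V // w ∈ V23 G ∧ (avoidG G (T : Set V)).Reachable v w}}

open Classical in
/-- `Lmul G i u v w` is the multiplicity of the vertex `w` in the multiset `L^i_G(u,v)`. -/
noncomputable def Lmul {V : Type*} [Fintype V] (G : SimpleGraph V) : ℕ → V → V → V → ℕ
  | 0, u, _, w => if w = u then 1 else 0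
  | (i + 1), u, v, w =>
      (∑ x : V, if G.Adj w x then Lmul G i u v x else 0) -
        (∑ x : V, if G.Adj w x then Lmul G i v u x else 0)

/-- Union over `j < i` of the supports of `L^j_G(u,v)` and `L^j_G(v,u)`. -/
noncomputable def Sbelow {V : Type*} [Fintype V] (G : SimpleGraph V) (u v : V) (i : ℕ) :
    Set V :=
  {w | ∃ j < i, 0 < Lmul G j u v w ∨ 0 < Lmul G j v u w}

/-- `S^{≤ i}_G({u,v})`. -/
noncomputable def Sle {V : Type*} [Fintype V] (G : SimpleGraph V) (u v : V) (i : ℕ) : Set V :=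
  Sbelow G u v (i + 1)

/-- `S^{i}_G({u,v}) = S^{≤ i}_G({u,v}) \ S^{≤ i-1}_G({u,v})`. -/
noncomputable def Sat {V : Type*} [Fintype V] (G : SimpleGraph V) (u v : V) (i : ℕ) : Set V :=
  Sbelow G u v (i + 1) \ Sbelow G u v i

/-- Degree of a vertex (as `Nat.card` of the neighbour set, avoiding decidability issues). -/
noncomputable def ncDegree {V : Type*} (G : SimpleGraph V) (v : V) : ℕ :=
  Nat.card {u : V // G.Adj v u}

/-- The random refinement of a colouring `c`: each vertex `v` with `f v = true` receives
a brand-new colour unique to itself. -/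
def refineColor {V : Type*} {Ω : Type*} (c : V → Ω) (f : V → Bool) : V → Ω ⊕ V :=
  fun v => if f v then Sum.inr v else Sum.inl (c v)

/-- `D(H,c)` (for the colouring encoded by the relation `r`) is `s`-bounded: every
intersection of a colour class with a connected component of `D(H,c)` has at most
`s` elements. -/
def sBounded {V : Type*} (H : SimpleGraph V) (r : V → V → Prop) (s : ℕ) : Prop :=
  ∀ u v : V, Nat.card {w : V // r w u ∧ w ∈ compSet (disparity H r) v} ≤ s

/-- The type of canonical colours after `t` rounds of colour refinement. -/
def CCol : ℕ → Type
  | 0 => Unit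
  | (t + 1) => CCol t × Multiset (CCol t)

open Classical in
/-- The canonical colour of a vertex after `t` rounds of colour refinement. -/
noncomputable def canonColor {V : Type*} [Fintype V] (G : SimpleGraph V) :
    (t : ℕ) → V → CCol t
  | 0, _ => ()
  | (t + 1), v =>
      (canonColor G t v, (Finset.univ.filter fun w => G.Adj v w).val.map (canonColor G t))

/-- The modal probability `M(m,p)` of a `Binomial(m,p)` random variable. -/
noncomputable def modalProb (m : ℕ) (p : ℝ) : ℝ :=
  (m.choose ⌊(m + 1 : ℝ) * p⌋₊ : ℝ) * p ^ ⌊(m + 1 : ℝ) * p⌋₊ *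
    (1 - p) ^ (m - ⌊(m + 1 : ℝ) * p⌋₊)

section Splice

variable {ι : Type*}

open Classical in
/-- Replace the coordinates of `f` in `B` by those of `g`. -/
noncomputable def splice (B : Set ι) (g f : ι → Bool) : ι → Bool :=
  fun i => if i ∈ B then g i else f i

/-- `F` does not depend on the coordinates in `B`. -/
def Ignores {α : Sort*} (B : Set ι) (F : (ι → Bool) → α) : Prop :=
  ∀ f f', (∀ i, i ∉ B → f i = f' i) → F f = F f'

lemma splice_mem {B : Set ι} {i : ι} (h : i ∈ B) (g f : ι → Bool) : splice B g f i = g i := by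
  simp [splice, h]

lemma splice_notMem {B : Set ι} {i : ι} (h : i ∉ B) (g f : ι → Bool) :
    splice B g f i = f i := by
  simp [splice, h]

lemma Ignores.splice {α : Sort*} {B : Set ι} {F : (ι → Bool) → α} (h : Ignores B F)
    (g f : ι → Bool) : F (splice B g f) = F f :=
  h _ _ fun _ hi => splice_notMem hi g f

lemma Ignores.mono {α : Sort*} {B C : Set ι} {F : (ι → Bool) → α} (h : Ignores B F)
    (hCB : C ⊆ B) : Ignores C F :=
  fun f f' hff => h f f' fun i hi => hff i fun hc => hi (hCB hc)

lemma splice_splice (B : Set ι) (f g : ι → Bool) :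
    splice B (splice B f g) (splice B g f) = f := by
  funext i
  by_cases h : i ∈ B <;> simp [splice, h]

end Splice

section BernoulliCalculus

variable {ι : Type*} [Fintype ι]

/-- Weight of a configuration under the product of Bernoulli(`p`) distributions. -/
noncomputable def bernWeight (p : ℝ) (f : ι → Bool) : ℝ := ∏ i, if f i then p else 1 - p

/-- Expectation with respect to the product of Bernoulli(`p`) distributions. -/
noncomputable def bernExp (p : ℝ) (F : (ι → Bool) → ℝ) : ℝ := by
  classical exact ∑ f, bernWeight p f * F f

open Classical in
/-- Probability with respect to the product of Bernoulli(`p`) distributions. -/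
noncomputable def bernProb (p : ℝ) (P : (ι → Bool) → Prop) : ℝ :=
  bernExp p fun f => if P f then 1 else 0

lemma bernWeight_nonneg {p : ℝ} (h0 : 0 ≤ p) (h1 : p ≤ 1) (f : ι → Bool) :
    0 ≤ bernWeight p f :=
  Finset.prod_nonneg fun i _ => by split_ifs <;> linarith

lemma bernExp_def [DecidableEq ι] (p : ℝ) (F : (ι → Bool) → ℝ) :
    bernExp p F = ∑ f, bernWeight p f * F f := by
  unfold bernExp
  congr!

open Classical in
lemma bernExp_prod (p : ℝ) (h : ι → Bool → ℝ) :
    bernExp p (fun f => ∏ i, h i (f i)) = ∏ i, (p * h i true + (1 - p) * h i false) := by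
  rw [bernExp_def]
  simp only [bernWeight, ← Finset.prod_mul_distrib]
  rw [← Fintype.prod_sum fun (i : ι) (b : Bool) => (if b then p else 1 - p) * h i b]
  simp

lemma bernExp_one (p : ℝ) : bernExp p (fun _ : ι → Bool => 1) = 1 := by
  simpa using bernExp_prod p (fun (_ : ι) (_ : Bool) => (1 : ℝ))

lemma bernExp_mono {p : ℝ} (h0 : 0 ≤ p) (h1 : p ≤ 1) {F F' : (ι → Bool) → ℝ}
    (h : ∀ f, F f ≤ F' f) : bernExp p F ≤ bernExp p F' := by
  classical
  simp only [bernExp_def]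
  exact Finset.sum_le_sum fun f _ => mul_le_mul_of_nonneg_left (h f) (bernWeight_nonneg h0 h1 f)

lemma bernExp_const_mul (p c : ℝ) (F : (ι → Bool) → ℝ) :
    bernExp p (fun f => c * F f) = c * bernExp p F := by
  classical
  simp only [bernExp_def, Finset.mul_sum]
  exact Finset.sum_congr rfl fun f _ => by ring

lemma bernExp_sum {κ : Type*} (s : Finset κ) (p : ℝ) (F : κ → (ι → Bool) → ℝ) :
    bernExp p (fun f => ∑ k ∈ s, F k f) = ∑ k ∈ s, bernExp p (F k) := by
  classical
  simp only [bernExp_def, Finset.mul_sum]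
  exact Finset.sum_comm

lemma bernExp_nonneg {p : ℝ} (h0 : 0 ≤ p) (h1 : p ≤ 1) {F : (ι → Bool) → ℝ}
    (h : ∀ f, 0 ≤ F f) : 0 ≤ bernExp p F := by
  classical
  rw [bernExp_def]
  exact Finset.sum_nonneg fun f _ => mul_nonneg (bernWeight_nonneg h0 h1 f) (h f)

lemma bernProb_nonneg {p : ℝ} (h0 : 0 ≤ p) (h1 : p ≤ 1) (P : (ι → Bool) → Prop) :
    0 ≤ bernProb p P :=
  bernExp_nonneg h0 h1 fun f => by split_ifs <;> norm_num

lemma bernProb_mono {p : ℝ} (h0 : 0 ≤ p) (h1 : p ≤ 1) {P Q : (ι → Bool) → Prop}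
    (h : ∀ f, P f → Q f) : bernProb p P ≤ bernProb p Q :=
  bernExp_mono h0 h1 fun f => by
    by_cases hP : P f
    · simp [hP, h f hP]
    · rw [if_neg hP]
      split_ifs <;> norm_num

lemma bernProb_true (p : ℝ) : bernProb p (fun _ : ι → Bool => True) = 1 := by
  simpa [bernProb] using bernExp_one (ι := ι) p

lemma bernProb_compl (p : ℝ) (P : (ι → Bool) → Prop) :
    bernProb p (fun f => ¬ P f) = 1 - bernProb p P := by
  classical
  rw [eq_sub_iff_add_eq, ← bernExp_one (ι := ι) p]
  simp only [bernProb, bernExp_def, ← Finset.sum_add_distrib]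
  refine Finset.sum_congr rfl fun f _ => ?_
  by_cases h : P f <;> simp [h]

lemma bernProb_false (p : ℝ) : bernProb p (fun _ : ι → Bool => False) = 0 := by
  classical
  simp [bernProb, bernExp_def]

lemma bernProb_union_le {p : ℝ} (h0 : 0 ≤ p) (h1 : p ≤ 1) {κ : Type*} (s : Finset κ)
    {P : (ι → Bool) → Prop} (Q : κ → (ι → Bool) → Prop)
    (h : ∀ f, P f → ∃ k ∈ s, Q k f) :
    bernProb p P ≤ ∑ k ∈ s, bernProb p (Q k) := by
  classical
  simp only [bernProb]
  rw [← bernExp_sum]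
  refine bernExp_mono h0 h1 fun f => ?_
  have hnn : ∀ k ∈ s, (0 : ℝ) ≤ if Q k f then 1 else 0 := fun k _ => by
    split_ifs <;> norm_num
  by_cases hP : P f
  · obtain ⟨k, hk, hQ⟩ := h f hP
    rw [if_pos hP]
    calc (1 : ℝ) = if Q k f then 1 else 0 := by rw [if_pos hQ]
      _ ≤ _ := Finset.single_le_sum hnn hk
  · rw [if_neg hP]
    exact Finset.sum_nonneg hnn

lemma bernProb_or_le {p : ℝ} (h0 : 0 ≤ p) (h1 : p ≤ 1) {P Q R : (ι → Bool) → Prop}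
    (h : ∀ f, P f → Q f ∨ R f) : bernProb p P ≤ bernProb p Q + bernProb p R := by
  refine (bernProb_union_le h0 h1 (Finset.univ : Finset Bool)
    (fun b => if b then Q else R) fun f hf => ?_).trans_eq (by simp)
  rcases h f hf with h | h
  · exact ⟨true, by simp, by simpa using h⟩
  · exact ⟨false, by simp, by simpa using h⟩

/-- Partitioning an event according to the value of a random variable. -/
lemma bernProb_eq_sum_fiber (p : ℝ) {κ : Type*} [Fintype κ] (Y : (ι → Bool) → κ)
    (P : (ι → Bool) → Prop) :
    bernProb p P = ∑ k, bernProb p (fun f => Y f = k ∧ P f) := by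
  classical
  simp only [bernProb]
  rw [← bernExp_sum]
  congr 1
  funext f
  rw [Finset.sum_eq_single (Y f)]
  · simp
  · intro b _ hb
    rw [if_neg fun h => hb h.1.symm]
  · simp

lemma bernProb_cylinder (p : ℝ) (D A : Finset ι) (hA : A ⊆ D) :
    bernProb p (fun f : ι → Bool => ∀ i ∈ D, (f i = true ↔ i ∈ A)) =
      p ^ A.card * (1 - p) ^ (D.card - A.card) := by
  classical
  have h1 : bernProb p (fun f : ι → Bool => ∀ i ∈ D, (f i = true ↔ i ∈ A)) =
      bernExp p (fun f => ∏ i, if i ∈ D → (f i = true ↔ i ∈ A) then (1 : ℝ) else 0) := by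
    unfold bernProb
    congr 1
    funext f
    rw [Finset.prod_ite_zero]
    simp
  rw [h1, bernExp_prod p fun i b => if i ∈ D → (b = true ↔ i ∈ A) then (1 : ℝ) else 0]
  have h2 : ∀ i, (p * (if i ∈ D → (true = true ↔ i ∈ A) then (1 : ℝ) else 0) +
      (1 - p) * (if i ∈ D → (false = true ↔ i ∈ A) then (1 : ℝ) else 0)) =
      (if i ∈ A then p else 1) * (if i ∈ D \ A then (1 - p) else 1) := by
    intro i
    by_cases hi : i ∈ A
    · simp [hi, hA hi]
    · by_cases hD : i ∈ D <;> simp [hi, hD]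
  rw [Finset.prod_congr rfl fun i _ => h2 i, Finset.prod_mul_distrib]
  rw [Finset.prod_ite_mem, Finset.prod_ite_mem]
  simp [Finset.card_sdiff_of_subset hA]

lemma bernProb_forall_true (p : ℝ) (D : Finset ι) :
    bernProb p (fun f : ι → Bool => ∀ i ∈ D, f i = true) = p ^ D.card := by
  have := bernProb_cylinder p D D subset_rfl
  simp only [le_refl, tsub_eq_zero_of_le, pow_zero, mul_one] at this
  rw [← this]
  congr 1
  funext f
  simp +contextual

lemma bernProb_card_eq (p : ℝ) (D : Finset ι) (k : ℕ) :
    bernProb p (fun f : ι → Bool => (D.filter fun i => f i = true).card = k) =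
      D.card.choose k * p ^ k * (1 - p) ^ (D.card - k) := by
  classical
  have h : bernProb p (fun f : ι → Bool => (D.filter fun i => f i = true).card = k) =
      ∑ A ∈ D.powersetCard k,
        bernProb p (fun f : ι → Bool => ∀ i ∈ D, (f i = true ↔ i ∈ A)) := by
    simp only [bernProb]
    rw [← bernExp_sum]
    congr 1
    funext f
    have key : ∀ A ∈ D.powersetCard k, ((∀ i ∈ D, (f i = true ↔ i ∈ A)) ↔
        A = D.filter fun i => f i = true) := by
      intro A hA
      have hAD := (Finset.mem_powersetCard.1 hA).1
      constructor
      · intro h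
        ext i
        rw [Finset.mem_filter]
        exact ⟨fun hi => ⟨hAD hi, (h i (hAD hi)).2 hi⟩, fun hi => (h i hi.1).1 hi.2⟩
      · rintro rfl i hi
        simp [hi]
    trans ∑ A ∈ D.powersetCard k, if A = (D.filter fun i => f i = true) then (1 : ℝ) else 0
    · rw [Finset.sum_ite_eq']
      simp [Finset.mem_powersetCard]
    · exact Finset.sum_congr rfl fun A hA => by simp only [key A hA]
  rw [h, Finset.sum_congr rfl fun A hA => bernProb_cylinder p D A (Finset.mem_powersetCard.1 hA).1]
  rw [Finset.sum_congr rfl fun A hA => by rw [(Finset.mem_powersetCard.1 hA).2]]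
  simp [Finset.card_powersetCard, mul_assoc]

lemma bernWeight_splice (p : ℝ) (B : Set ι) (f g : ι → Bool) :
    bernWeight p (splice B g f) * bernWeight p (splice B f g) =
      bernWeight p f * bernWeight p g := by
  simp only [bernWeight, ← Finset.prod_mul_distrib]
  refine Finset.prod_congr rfl fun i _ => ?_
  by_cases h : i ∈ B
  · rw [splice_mem h, splice_mem h, mul_comm]
  · rw [splice_notMem h, splice_notMem h]

lemma bernExp_resample (p : ℝ) (B : Set ι) (F : (ι → Bool) → ℝ) :
    bernExp p F = bernExp p fun f => bernExp p fun g => F (splice B g f) := by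
  classical
  have h1 : bernExp p F = ∑ x : (ι → Bool) × (ι → Bool),
      bernWeight p x.1 * bernWeight p x.2 * F x.1 := by
    rw [Fintype.sum_prod_type, bernExp_def]
    refine Finset.sum_congr rfl fun f _ => ?_
    have := bernExp_one (ι := ι) p
    rw [bernExp_def] at this
    simp only [mul_one] at this
    simp only [← Finset.sum_mul, ← Finset.mul_sum, this, mul_one]
  have h2 : (bernExp p fun f => bernExp p fun g => F (splice B g f)) =
      ∑ x : (ι → Bool) × (ι → Bool),
        bernWeight p x.1 * bernWeight p x.2 * F (splice B x.2 x.1) := by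
    rw [Fintype.sum_prod_type, bernExp_def]
    refine Finset.sum_congr rfl fun f _ => ?_
    rw [bernExp_def, Finset.mul_sum]
    exact Finset.sum_congr rfl fun g _ => by ring
  rw [h1, h2]
  have hinv : Function.Involutive fun x : (ι → Bool) × (ι → Bool) =>
      (splice B x.2 x.1, splice B x.1 x.2) := fun x => by
    simp only [splice_splice]
  refine (Fintype.sum_equiv hinv.toPerm _ _ fun x => ?_).symm
  simp only [Function.Involutive.coe_toPerm, bernWeight_splice]

lemma bernExp_mul_le {p : ℝ} (h0 : 0 ≤ p) (h1 : p ≤ 1) {B : Set ι} {H Φ : (ι → Bool) → ℝ}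
    {c : ℝ} (hH : ∀ f, 0 ≤ H f) (hHB : Ignores B H)
    (hΦ : ∀ f, bernExp p (fun g => Φ (splice B g f)) ≤ c) :
    bernExp p (fun f => H f * Φ f) ≤ c * bernExp p H := by
  rw [bernExp_resample p B, ← bernExp_const_mul]
  refine bernExp_mono h0 h1 fun f => ?_
  simp only [hHB.splice]
  rw [bernExp_const_mul, mul_comm]
  exact mul_le_mul_of_nonneg_right (hΦ f) (hH f)

lemma le_bernExp_mul {p : ℝ} (h0 : 0 ≤ p) (h1 : p ≤ 1) {B : Set ι} {H Φ : (ι → Bool) → ℝ}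
    {c : ℝ} (hH : ∀ f, 0 ≤ H f) (hHB : Ignores B H)
    (hΦ : ∀ f, c ≤ bernExp p (fun g => Φ (splice B g f))) :
    c * bernExp p H ≤ bernExp p (fun f => H f * Φ f) := by
  rw [bernExp_resample p B fun f => H f * Φ f, ← bernExp_const_mul]
  refine bernExp_mono h0 h1 fun f => ?_
  simp only [hHB.splice]
  rw [bernExp_const_mul, mul_comm c]
  exact mul_le_mul_of_nonneg_left (hΦ f) (hH f)

lemma bernProb_and_eq (p : ℝ) (P Q : (ι → Bool) → Prop) [DecidablePred P] [DecidablePred Q] :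
    bernProb p (fun f => P f ∧ Q f) =
      bernExp p fun f => (if P f then 1 else 0) * (if Q f then 1 else 0) := by
  unfold bernProb
  congr 1
  funext f
  by_cases h : P f <;> by_cases h' : Q f <;> simp [h, h']

lemma bernProb_eq (p : ℝ) (P : (ι → Bool) → Prop) [DecidablePred P] :
    bernProb p P = bernExp p fun f => if P f then 1 else 0 := by
  unfold bernProb
  congr!

lemma bernProb_and_le {p : ℝ} (h0 : 0 ≤ p) (h1 : p ≤ 1) {B : Set ι} {P Q : (ι → Bool) → Prop}
    {c : ℝ} (hPB : Ignores B P) (hQ : ∀ f, bernProb p (fun g => Q (splice B g f)) ≤ c) :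
    bernProb p (fun f => P f ∧ Q f) ≤ c * bernProb p P := by
  classical
  rw [bernProb_and_eq, bernProb_eq p P]
  refine bernExp_mul_le (B := B) h0 h1 (fun f => by split_ifs <;> norm_num) ?_ ?_
  · intro f f' h
    simp only [hPB f f' h]
  · intro f
    have := hQ f
    rwa [bernProb_eq] at this

lemma le_bernProb_and {p : ℝ} (h0 : 0 ≤ p) (h1 : p ≤ 1) {B : Set ι} {P Q : (ι → Bool) → Prop}
    {c : ℝ} (hPB : Ignores B P) (hQ : ∀ f, c ≤ bernProb p (fun g => Q (splice B g f))) :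
    c * bernProb p P ≤ bernProb p (fun f => P f ∧ Q f) := by
  classical
  rw [bernProb_and_eq, bernProb_eq p P]
  refine le_bernExp_mul (B := B) h0 h1 (fun f => by split_ifs <;> norm_num) ?_ ?_
  · intro f f' h
    simp only [hPB f f' h]
  · intro f
    have := hQ f
    rwa [bernProb_eq] at this

lemma bernProb_coord (p : ℝ) (e : ι) : bernProb p (fun f : ι → Bool => f e = true) = p := by
  simpa using bernProb_forall_true p {e}

lemma bernProb_and_coord_le {p : ℝ} (h0 : 0 ≤ p) (h1 : p ≤ 1) {P : (ι → Bool) → Prop} {e : ι}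
    (hP : Ignores {e} P) : bernProb p (fun f => P f ∧ f e = true) ≤ p * bernProb p P := by
  refine bernProb_and_le (Q := fun f => f e = true) h0 h1 hP fun f => ?_
  simp only [splice_mem (Set.mem_singleton e)]
  exact (bernProb_coord p e).le

/-- A product of functions, each with small conditional mean on its own block. -/
lemma bernExp_mul_prod_le {p : ℝ} (h0 : 0 ≤ p) (h1 : p ≤ 1) {κ : Type*} (s : Finset κ)
    {B : κ → Set ι} {H : (ι → Bool) → ℝ} {φ : κ → (ι → Bool) → ℝ} {c : ℝ} (hc : 0 ≤ c)
    (hH : ∀ f, 0 ≤ H f) (hHB : ∀ j ∈ s, Ignores (B j) H) (hφ0 : ∀ j f, 0 ≤ φ j f)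
    (hφB : ∀ j ∈ s, ∀ j' ∈ s, j ≠ j' → Ignores (B j) (φ j'))
    (hφ : ∀ j ∈ s, ∀ f, bernExp p (fun g => φ j (splice (B j) g f)) ≤ c) :
    bernExp p (fun f => H f * ∏ j ∈ s, φ j f) ≤ c ^ s.card * bernExp p H := by
  classical
  induction s using Finset.induction_on with
  | empty => simp
  | insert a s ha ih =>
    have ih' := ih (fun j hj => hHB j (by simp [hj]))
      (fun j hj j' hj' => hφB j (by simp [hj]) j' (by simp [hj']))
      (fun j hj => hφ j (by simp [hj]))
    have h2 := bernExp_mul_le (B := B a) (H := fun f => H f * ∏ j ∈ s, φ j f) (Φ := φ a) h0 h1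
      (fun f => mul_nonneg (hH f) (Finset.prod_nonneg fun j _ => hφ0 j f)) (by
        intro f f' hff
        simp only [hHB a (by simp) f f' hff]
        congr 1
        refine Finset.prod_congr rfl fun j hj => ?_
        exact hφB a (by simp) j (by simp [hj]) (fun h => ha (h ▸ hj)) f f' hff)
      (hφ a (by simp))
    calc _ = bernExp p (fun f => H f * (∏ j ∈ s, φ j f) * φ a f) := by
          congr 1
          funext f
          rw [Finset.prod_insert ha]
          ring
      _ ≤ _ := h2
      _ ≤ c * (c ^ s.card * bernExp p H) := mul_le_mul_of_nonneg_left ih' hc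
      _ = _ := by rw [Finset.card_insert_of_notMem ha]; ring

lemma bernExp_comp_perm (p : ℝ) (τ : Equiv.Perm ι) (F : (ι → Bool) → ℝ) :
    bernExp p (fun f => F (f ∘ τ)) = bernExp p F := by
  classical
  simp only [bernExp_def]
  refine Fintype.sum_equiv (τ.symm.arrowCongr (Equiv.refl Bool)) _ _ fun f => ?_
  have h1 : (τ.symm.arrowCongr (Equiv.refl Bool)) f = f ∘ τ := by
    funext i
    simp [Equiv.arrowCongr]
  rw [h1]
  congr 1
  unfold bernWeight
  exact (Fintype.prod_equiv τ _ _ fun i => rfl).symm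

lemma bernProb_comp_perm (p : ℝ) (τ : Equiv.Perm ι) (P : (ι → Bool) → Prop) :
    bernProb p (fun f => P (f ∘ τ)) = bernProb p P := by
  classical
  simp only [bernProb_eq]
  exact bernExp_comp_perm p τ fun f => if P f then 1 else 0

end BernoulliCalculus

lemma erdosRenyiMeasure_eq_bernProb {n : ℕ} {p : ℝ} (h0 : 0 ≤ p) (h1 : p ≤ 1)
    (S : Set (Sym2 (Fin n) → Bool)) :
    erdosRenyiMeasure n p S = ENNReal.ofReal (bernProb p fun f => f ∈ S) := by
  classical
  have hw : ∀ f : Sym2 (Fin n) → Bool,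
      (∏ i, if f i then ENNReal.ofReal p else ENNReal.ofReal (1 - p)) =
        ENNReal.ofReal (bernWeight p f) := fun f => by
    rw [bernWeight, ENNReal.ofReal_prod_of_nonneg fun i _ => by split_ifs <;> linarith]
    exact Finset.prod_congr rfl fun i _ => by split_ifs <;> rfl
  unfold erdosRenyiMeasure bernoulliProduct
  rw [bernProb_eq, bernExp_def, ENNReal.ofReal_sum_of_nonneg fun f _ =>
    mul_nonneg (bernWeight_nonneg h0 h1 f) (by split_ifs <;> norm_num)]
  rw [Measure.finsetSum_apply]
  refine Finset.sum_congr rfl fun f _ => ?_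
  rw [Measure.smul_apply, hw, Measure.dirac_apply' _ (Set.toFinite S).measurableSet, smul_eq_mul]
  by_cases h : f ∈ S <;> simp [h]

section StableColouring

lemma crEquiv_refl {V Ω : Type*} (G : SimpleGraph V) (c : V → Ω) (t : ℕ) (u : V) :
    crEquiv G c t u u := by
  induction t with
  | zero => rfl
  | succ t ih => exact ⟨ih, fun _ => rfl⟩

lemma crEquiv_symm {V Ω : Type*} {G : SimpleGraph V} {c : V → Ω} {t : ℕ} {u v : V}
    (h : crEquiv G c t u v) : crEquiv G c t v u := by
  induction t generalizing u v with
  | zero => exact Eq.symm h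
  | succ t ih => exact ⟨ih h.1, fun w => (h.2 w).symm⟩

lemma crEquiv_trans {V Ω : Type*} {G : SimpleGraph V} {c : V → Ω} {t : ℕ} {u v w : V}
    (h : crEquiv G c t u v) (h' : crEquiv G c t v w) : crEquiv G c t u w := by
  induction t generalizing u v w with
  | zero => exact Eq.trans h h'
  | succ t ih => exact ⟨ih h.1 h'.1, fun x => (h.2 x).trans (h'.2 x)⟩

lemma crEquiv_antitone {V Ω : Type*} {G : SimpleGraph V} {c : V → Ω} {s t : ℕ} (hst : s ≤ t)
    {u v : V} (h : crEquiv G c t u v) : crEquiv G c s u v := by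
  induction t, hst using Nat.le_induction with
  | base => exact h
  | succ t _ ih => exact ih h.1

lemma exists_crEquiv_imp_crStable {V Ω : Type*} [Finite V] (G : SimpleGraph V) (c : V → Ω) :
    ∃ T, ∀ u v, crEquiv G c T u v → crStable G c u v := by
  classical
  have := Fintype.ofFinite V
  have h : ∀ x : V × V, ∃ t, crEquiv G c t x.1 x.2 → crStable G c x.1 x.2 := by
    intro x
    by_cases hx : crStable G c x.1 x.2
    · exact ⟨0, fun _ => hx⟩
    · obtain ⟨t, ht⟩ := not_forall.1 hx
      exact ⟨t, fun h => absurd h ht⟩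
  choose t ht using h
  exact ⟨Finset.univ.sup t, fun u v huv =>
    ht (u, v) (crEquiv_antitone (Finset.le_sup (Finset.mem_univ (u, v))) huv)⟩

/-- The stable colouring as an equivalence relation. -/
def crSetoid {V Ω : Type*} (G : SimpleGraph V) (c : V → Ω) : Setoid V where
  r := crStable G c
  iseqv := ⟨fun u t => crEquiv_refl G c t u, fun h t => crEquiv_symm (h t),
    fun h h' t => crEquiv_trans (h t) (h' t)⟩

lemma crStable_card {V Ω : Type*} [Finite V] {G : SimpleGraph V} {c : V → Ω} {u v : V}
    (h : crStable G c u v) (w : V) :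
    Nat.card {x : V // G.Adj u x ∧ crStable G c x w} =
      Nat.card {x : V // G.Adj v x ∧ crStable G c x w} := by
  obtain ⟨T, hT⟩ := exists_crEquiv_imp_crStable G c
  have key : ∀ x, crEquiv G c T x w ↔ crStable G c x w := fun x => ⟨hT x w, fun h => h T⟩
  simpa only [key] using (h (T + 1)).2 w

open Classical in
lemma crStable_sum {V Ω : Type*} [Fintype V] {G : SimpleGraph V} {c : V → Ω} {u v : V}
    (h : crStable G c u v) (φ : V → ℤ) (hφ : ∀ a b, crStable G c a b → φ a = φ b) :
    ∑ w, (if G.Adj u w then φ w else 0) = ∑ w, (if G.Adj v w then φ w else 0) := by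
  have key : ∀ s, ∑ w, (if G.Adj s w then φ w else 0) =
      ∑ q : Quotient (crSetoid G c), φ q.out *
        (Nat.card {x : V // G.Adj s x ∧ crStable G c x q.out} : ℤ) := by
    intro s
    rw [← Finset.sum_fiberwise Finset.univ (fun w => (⟦w⟧ : Quotient (crSetoid G c)))]
    refine Finset.sum_congr rfl fun q _ => ?_
    have h1 : ∀ w ∈ Finset.univ.filter (fun w => (⟦w⟧ : Quotient (crSetoid G c)) = q),
        (if G.Adj s w then φ w else 0) = if G.Adj s w then φ q.out else 0 := by
      intro w hw
      have : crStable G c w q.out := by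
        refine Quotient.exact (s := crSetoid G c) ?_
        rw [Quotient.out_eq]
        exact (Finset.mem_filter.1 hw).2
      rw [hφ _ _ this]
    rw [Finset.sum_congr rfl h1, ← Finset.sum_filter, Finset.sum_const, Finset.filter_filter,
      nsmul_eq_mul, mul_comm]
    congr 2
    rw [Nat.card_eq_fintype_card, Fintype.card_subtype]
    congr 1
    ext w
    simp only [Finset.mem_filter, Finset.mem_univ, true_and]
    have : (⟦w⟧ : Quotient (crSetoid G c)) = q ↔ crStable G c w q.out := by
      conv_lhs => rw [← Quotient.out_eq q]
      exact Quotient.eq (r := crSetoid G c)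
    rw [this, and_comm]
  rw [key u, key v]
  refine Finset.sum_congr rfl fun q _ => ?_
  rw [crStable_card h]

open Classical in
/-- The vectors `A^i (e_u - e_v)`, where `A` is the adjacency matrix of `G`. -/
noncomputable def diffVec {V : Type*} [Fintype V] (G : SimpleGraph V) (u v : V) : ℕ → V → ℤ
  | 0, w => (if w = u then 1 else 0) - (if w = v then 1 else 0)
  | i + 1, w => ∑ s, if G.Adj w s then diffVec G u v i s else 0

lemma sum_mul_diffVec_eq_zero {V Ω : Type*} [Fintype V] {G : SimpleGraph V} {c : V → Ω}
    {u v : V} (h : crStable G c u v) (i : ℕ) (φ : V → ℤ)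
    (hφ : ∀ a b, crStable G c a b → φ a = φ b) :
    ∑ w, φ w * diffVec G u v i w = 0 := by
  classical
  induction i generalizing φ with
  | zero => simp [diffVec, mul_sub, Finset.sum_sub_distrib, hφ u v h]
  | succ i ih =>
    have := ih (fun s => ∑ w, if G.Adj s w then φ w else 0)
      fun a b hab => crStable_sum hab φ hφ
    rw [← this]
    simp only [diffVec, Finset.mul_sum, Finset.sum_mul]
    rw [Finset.sum_comm]
    refine Finset.sum_congr rfl fun s _ => Finset.sum_congr rfl fun w _ => ?_
    simp [G.adj_comm s w]

lemma crStableTrivial_ncDegree {V : Type*} [Finite V] {G : SimpleGraph V} {a b : V}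
    (h : crStableTrivial G a b) : ncDegree G a = ncDegree G b := by
  have := (h 1).2 a
  simpa [crEquiv, ncDegree] using this

open Classical in
lemma sum_diffVec_ncDegree {V : Type*} [Fintype V] {G : SimpleGraph V} {u v : V}
    (h : crStableTrivial G u v) (i M r : ℕ) :
    ∑ w, (if ncDegree G w % M = r then diffVec G u v i w else 0) = 0 := by
  have := sum_mul_diffVec_eq_zero h i (fun w => if ncDegree G w % M = r then 1 else 0)
    fun a b hab => by rw [crStableTrivial_ncDegree hab]
  simpa using this

end StableColouring

section AntiConcentration

lemma two_mul_add_one_mul_centralBinom_sq_le (n : ℕ) :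
    (2 * n + 1) * n.centralBinom ^ 2 ≤ 4 ^ (2 * n) := by
  induction n with
  | zero => simp
  | succ n ih =>
    have h := Nat.succ_mul_centralBinom_succ n
    have h2 : (n + 1) ^ 2 * ((2 * (n + 1) + 1) * (n + 1).centralBinom ^ 2) ≤
        (n + 1) ^ 2 * 4 ^ (2 * (n + 1)) := by
      calc _ = (2 * n + 3) * ((n + 1) * (n + 1).centralBinom) ^ 2 := by ring
        _ = 4 * ((2 * n + 3) * (2 * n + 1)) * ((2 * n + 1) * n.centralBinom ^ 2) := by
          rw [h]; ring
        _ ≤ 4 * (4 * (n + 1) ^ 2) * 4 ^ (2 * n) :=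
          Nat.mul_le_mul (Nat.mul_le_mul_left _ (by nlinarith)) ih
        _ = _ := by ring
    exact Nat.le_of_mul_le_mul_left h2 (by positivity)

lemma succ_mul_choose_half_sq_le (m : ℕ) : (m + 1) * (m.choose (m / 2)) ^ 2 ≤ 4 ^ m := by
  rcases Nat.even_or_odd' m with ⟨n, rfl | rfl⟩
  · simpa [Nat.centralBinom] using two_mul_add_one_mul_centralBinom_sq_le n
  · have h := two_mul_add_one_mul_centralBinom_sq_le (n + 1)
    have h1 : (n + 1).centralBinom = 2 * (2 * n + 1).choose n := by
      rw [Nat.centralBinom, show 2 * (n + 1) = (2 * n + 1) + 1 by ring, Nat.choose_succ_succ,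
        ← Nat.choose_symm_half]
      ring
    have h2 : (2 * n + 1) / 2 = n := by omega
    rw [h1] at h
    rw [h2]
    have : 4 * ((2 * n + 1 + 1) * (2 * n + 1).choose n ^ 2) ≤ 4 * 4 ^ (2 * n + 1) := by
      calc _ ≤ (2 * (n + 1) + 1) * (2 * (2 * n + 1).choose n) ^ 2 := by nlinarith
        _ ≤ _ := h
        _ = _ := by ring
    exact Nat.le_of_mul_le_mul_left this (by norm_num)

lemma choose_half_div_le (m : ℕ) :
    (m.choose (m / 2) : ℝ) / 2 ^ m ≤ 1 / Real.sqrt (m + 1) := by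
  have h : ((m : ℝ) + 1) * (m.choose (m / 2) : ℝ) ^ 2 ≤ 4 ^ m := by
    exact_mod_cast succ_mul_choose_half_sq_le m
  have hs : 0 < Real.sqrt ((m : ℝ) + 1) := Real.sqrt_pos.2 (by positivity)
  rw [div_le_div_iff₀ (by positivity) hs, one_mul]
  refine le_of_sq_le_sq ?_ (by positivity)
  rw [mul_pow, Real.sq_sqrt (by positivity), ← pow_mul, mul_comm m 2, pow_mul]
  norm_num
  linarith

/-- Littlewood–Offord: the subset sums of nonzero integers are spread out. -/
lemma card_subset_sum_eq_le {κ : Type*} [DecidableEq κ] (J : Finset κ) (a : κ → ℤ)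
    (ha : ∀ j ∈ J, a j ≠ 0) (c : ℤ) :
    (J.powerset.filter fun ε => ∑ j ∈ ε, a j = c).card ≤ J.card.choose (J.card / 2) := by
  classical
  let enc : Finset κ → Finset J := fun ε =>
    Finset.univ.filter fun j => (j.1 ∈ ε) ↔ 0 < a j.1
  have hinj : Set.InjOn enc (J.powerset.filter fun ε => ∑ j ∈ ε, a j = c : Finset _) := by
    intro ε hε ε' hε' h
    have h1 := Finset.mem_powerset.1 (Finset.mem_filter.1 hε).1
    have h2 := Finset.mem_powerset.1 (Finset.mem_filter.1 hε').1
    ext j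
    by_cases hj : j ∈ J
    · have h3 := Finset.ext_iff.1 h ⟨j, hj⟩
      simp only [enc, Finset.mem_filter, Finset.mem_univ, true_and] at h3
      tauto
    · exact ⟨fun h' => absurd (h1 h') hj, fun h' => absurd (h2 h') hj⟩
  rw [← Finset.card_image_of_injOn hinj, ← Fintype.card_coe J]
  refine IsAntichain.sperner ?_
  have hsum : ∀ ε ⊆ J, ∑ j ∈ enc ε, |a j.1| =
      ∑ j ∈ ε, a j + ∑ j : J, (if a j.1 < 0 then |a j.1| else 0) := by
    intro ε hε
    have h1 : ∑ j ∈ ε, a j = ∑ j : J, if j.1 ∈ ε then a j.1 else 0 := by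
      rw [Finset.sum_coe_sort J fun j => if j ∈ ε then a j else 0, Finset.sum_ite_mem,
        Finset.inter_eq_right.2 hε]
    rw [h1, ← Finset.sum_add_distrib, Finset.sum_filter]
    refine Finset.sum_congr rfl fun j _ => ?_
    rcases lt_or_gt_of_ne (ha j.1 j.2) with hj | hj
    · by_cases hm : j.1 ∈ ε
      · simp [hm, hj, not_lt.2 hj.le, abs_of_neg hj]
      · simp [hm, hj, not_lt.2 hj.le]
    · by_cases hm : j.1 ∈ ε
      · simp [hm, hj, not_lt.2 hj.le, abs_of_pos hj]
      · simp [hm, hj, not_lt.2 hj.le]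
  intro A hA A' hA' hne hsub
  obtain ⟨ε, hε, rfl⟩ := Finset.mem_image.1 hA
  obtain ⟨ε', hε', rfl⟩ := Finset.mem_image.1 hA'
  rw [Finset.mem_filter, Finset.mem_powerset] at hε hε'
  have hss : enc ε ⊂ enc ε' := lt_of_le_of_ne hsub hne
  obtain ⟨j, hj, hj'⟩ := Finset.exists_of_ssubset hss
  have : ∑ j ∈ enc ε, |a j.1| < ∑ j ∈ enc ε', |a j.1| :=
    Finset.sum_lt_sum_of_subset hsub hj hj' (abs_pos.2 (ha j.1 j.2)) fun _ _ _ => abs_nonneg _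
  rw [hsum ε hε.1, hsum ε' hε'.1, hε.2, hε'.2] at this
  exact lt_irrefl _ this

/-- If measure-preserving permutations indexed by the subsets of `J` preserve `X`, and on `X`
only few of them lead to `E`, then `E` is unlikely given `X`. -/
lemma bernProb_and_le_of_flips {ι κ : Type*} [Fintype ι] [DecidableEq κ] {p : ℝ} (h0 : 0 ≤ p)
    (h1 : p ≤ 1) (τ : Finset κ → Equiv.Perm ι) (J : Finset κ) {X E : (ι → Bool) → Prop}
    (hX : ∀ ε ⊆ J, ∀ f, X (f ∘ τ ε) ↔ X f) {s : ℕ}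
    (hE : ∀ f, X f → ∀ [DecidablePred fun ε => E (f ∘ τ ε)],
      (J.powerset.filter fun ε => E (f ∘ τ ε)).card ≤ s) :
    bernProb p (fun f => X f ∧ E f) ≤ s / 2 ^ J.card * bernProb p X := by
  classical
  have h2 : (2 : ℝ) ^ J.card * bernProb p (fun f => X f ∧ E f) =
      ∑ ε ∈ J.powerset, bernExp p (fun f => if X f ∧ E (f ∘ τ ε) then 1 else 0) := by
    have : ∀ ε ∈ J.powerset, bernExp p (fun f => if X f ∧ E (f ∘ τ ε) then (1 : ℝ) else 0) =
        bernProb p (fun f => X f ∧ E f) := by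
      intro ε hε
      rw [← bernProb_comp_perm p (τ ε), bernProb_eq]
      simp only [hX ε (Finset.mem_powerset.1 hε)]
    rw [Finset.sum_congr rfl this]
    simp
  rw [← bernExp_sum] at h2
  have h3 : bernExp p (fun f => ∑ ε ∈ J.powerset, if X f ∧ E (f ∘ τ ε) then (1 : ℝ) else 0) ≤
      bernExp p (fun f => (s : ℝ) * if X f then 1 else 0) := by
    refine bernExp_mono h0 h1 fun f => ?_
    by_cases hf : X f
    · simp only [hf, true_and, if_true, mul_one, Finset.sum_boole]
      exact_mod_cast hE f hf
    · simp [hf]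
  rw [bernExp_const_mul, ← bernProb_eq, ← h2] at h3
  rw [div_mul_eq_mul_div, le_div_iff₀ (by positivity)]
  linarith

end AntiConcentration

section BinomialLowerBound

lemma exp_neg_two_mul_le_one_sub {p : ℝ} (h0 : 0 ≤ p) (h1 : p ≤ 1 / 2) :
    Real.exp (-(2 * p)) ≤ 1 - p := by
  rw [Real.exp_neg]
  refine inv_le_of_inv_le₀ (by linarith) ?_
  rw [inv_le_iff_one_le_mul₀ (by linarith)]
  have := Real.add_one_le_exp (2 * p)
  nlinarith

lemma exists_binomial_lower_bound (M : ℕ) {c C : ℝ} (hc : 0 < c) :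
    ∃ η : ℝ, 0 < η ∧ η ≤ 1 ∧ ∀ ℓ : ℕ, 2 * M ≤ ℓ → ∀ p : ℝ, 0 ≤ p → p ≤ 1 / 2 → c ≤ ℓ * p →
      ℓ * p ≤ C → ∀ i ≤ M, η ≤ ℓ.choose i * p ^ i * (1 - p) ^ (ℓ - i) := by
  set d : ℝ := min (c / 2) 1 with hd
  have hd0 : 0 < d := lt_min (by linarith) one_pos
  have hd1 : d ≤ 1 := min_le_right _ _
  have hdc : d ≤ c / 2 := min_le_left _ _
  refine ⟨min (d ^ M / M.factorial * Real.exp (-(2 * C))) 1, lt_min (by positivity) one_pos,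
    min_le_right _ _, fun ℓ hℓ p h0 h1 hcp hCp i hi => (min_le_left _ _).trans ?_⟩
  have e1 : Real.exp (-(2 * C)) ≤ (1 - p) ^ (ℓ - i) := by
    calc Real.exp (-(2 * C)) ≤ Real.exp (ℓ * (-(2 * p))) := Real.exp_le_exp.2 (by linarith)
      _ = Real.exp (-(2 * p)) ^ ℓ := by rw [← Real.exp_nat_mul]
      _ ≤ (1 - p) ^ ℓ := pow_le_pow_left₀ (Real.exp_pos _).le (exp_neg_two_mul_le_one_sub h0 h1) _
      _ ≤ (1 - p) ^ (ℓ - i) := pow_le_pow_of_le_one (by linarith) (by linarith) (by omega)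
  have e2 : (ℓ / 2 : ℝ) ^ i ≤ i.factorial * ℓ.choose i := by
    have := Nat.pow_sub_le_descFactorial ℓ i
    rw [Nat.descFactorial_eq_factorial_mul_choose] at this
    have h3 : ((ℓ : ℝ) / 2) ≤ ((ℓ + 1 - i : ℕ) : ℝ) := by
      rw [div_le_iff₀ (by norm_num)]
      have : ℓ ≤ (ℓ + 1 - i) * 2 := by omega
      exact_mod_cast this
    calc (ℓ / 2 : ℝ) ^ i ≤ ((ℓ + 1 - i : ℕ) : ℝ) ^ i := pow_le_pow_left₀ (by positivity) h3 _
      _ ≤ _ := by exact_mod_cast this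
  have e3 : d ^ M / M.factorial ≤ ℓ.choose i * p ^ i := by
    have hf : (i.factorial : ℝ) ≤ M.factorial := by exact_mod_cast Nat.factorial_le hi
    have hf0 : (0 : ℝ) < i.factorial := by positivity
    calc d ^ M / M.factorial ≤ d ^ i / i.factorial := by
          apply div_le_div₀ (by positivity) (pow_le_pow_of_le_one hd0.le hd1 hi) hf0 hf
      _ ≤ (ℓ / 2 * p) ^ i / i.factorial := by
          gcongr
          linarith
      _ ≤ ℓ.choose i * p ^ i := by
          rw [div_le_iff₀ hf0, mul_pow]
          have := mul_le_mul_of_nonneg_right e2 (pow_nonneg h0 i)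
          linarith
  exact mul_le_mul e3 e1 (Real.exp_pos _).le (by positivity)

end BinomialLowerBound

section FlipGraph

variable {n : ℕ}

/-- The graph obtained from `G₀` by toggling the pairs marked by `f`. -/
def flipGraph (G₀ : SimpleGraph (Fin n)) (f : Sym2 (Fin n) → Bool) : SimpleGraph (Fin n) :=
  symmDiffG G₀ (graphOfFlip f)

lemma graphOfFlip_adj (f : Sym2 (Fin n) → Bool) (a b : Fin n) :
    (graphOfFlip f).Adj a b ↔ a ≠ b ∧ f s(a, b) = true := by
  simp [graphOfFlip, Sym2.eq_swap (a := b) (b := a)]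

lemma flipGraph_adj (G₀ : SimpleGraph (Fin n)) (f : Sym2 (Fin n) → Bool) (a b : Fin n) :
    (flipGraph G₀ f).Adj a b ↔ a ≠ b ∧ ¬ (G₀.Adj a b ↔ f s(a, b) = true) := by
  simp only [flipGraph, symmDiffG, SimpleGraph.fromRel_adj, graphOfFlip_adj,
    G₀.adj_comm b a, Sym2.eq_swap (a := b) (b := a)]
  by_cases h : a = b
  · simp [h]
  · have h' : b ≠ a := fun e => h e.symm
    simp only [ne_eq, h, h', not_false_eq_true, true_and]
    rw [or_self]
    exact xor_iff_not_iff _ _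

open Classical in
/-- Number of neighbours of `a` in `S`. -/
noncomputable def degOn (G₀ : SimpleGraph (Fin n)) (f : Sym2 (Fin n) → Bool) (a : Fin n)
    (S : Finset (Fin n)) : ℕ :=
  (S.filter fun t => (flipGraph G₀ f).Adj a t).card

/-- Number of marked pairs between `a` and `S`. -/
def markCount (f : Sym2 (Fin n) → Bool) (a : Fin n) (S : Finset (Fin n)) : ℕ :=
  (S.filter fun t => f s(a, t) = true).card

lemma markCount_le (f : Sym2 (Fin n) → Bool) (a : Fin n) (S : Finset (Fin n)) :
    markCount f a S ≤ S.card :=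
  Finset.card_filter_le _ _

lemma degOn_congr {G₀ : SimpleGraph (Fin n)} {f f' : Sym2 (Fin n) → Bool} {a : Fin n}
    {S : Finset (Fin n)} (h : ∀ t ∈ S, f s(a, t) = f' s(a, t)) :
    degOn G₀ f a S = degOn G₀ f' a S := by
  classical
  unfold degOn
  congr 1
  refine Finset.filter_congr fun t ht => ?_
  rw [flipGraph_adj, flipGraph_adj, h t ht]

lemma markCount_congr {f f' : Sym2 (Fin n) → Bool} {a : Fin n}
    {S : Finset (Fin n)} (h : ∀ t ∈ S, f s(a, t) = f' s(a, t)) :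
    markCount f a S = markCount f' a S := by
  unfold markCount
  congr 1
  exact Finset.filter_congr fun t ht => by rw [h t ht]

lemma degOn_of_sign {G₀ : SimpleGraph (Fin n)} (f : Sym2 (Fin n) → Bool) {a : Fin n}
    {S : Finset (Fin n)} (ha : a ∉ S) {s : Bool} (hs : ∀ t ∈ S, (G₀.Adj a t ↔ s = true)) :
    degOn G₀ f a S = if s then S.card - markCount f a S else markCount f a S := by
  classical
  have key : ∀ t ∈ S, ((flipGraph G₀ f).Adj a t ↔ ¬ (s = true ↔ f s(a, t) = true)) := by
    intro t ht
    have : a ≠ t := fun h => ha (h ▸ ht)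
    rw [flipGraph_adj, hs t ht]
    simp [this]
  unfold degOn markCount
  rw [Finset.filter_congr key]
  cases s
  · simp
  · simp only [true_iff, if_true]
    have := Finset.card_filter_add_card_filter_not (s := S) (fun t => f s(a, t) = true)
    omega

lemma degOn_sdiff_add {G₀ : SimpleGraph (Fin n)} (f : Sym2 (Fin n) → Bool) (a : Fin n)
    {S T : Finset (Fin n)} (hT : T ⊆ S) :
    degOn G₀ f a S = degOn G₀ f a (S \ T) + degOn G₀ f a T := by
  classical
  unfold degOn
  rw [← Finset.card_union_of_disjoint, ← Finset.filter_union, Finset.sdiff_union_of_subset hT]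
  exact Finset.disjoint_filter_filter Finset.sdiff_disjoint

lemma ncDegree_flipGraph (G₀ : SimpleGraph (Fin n)) (f : Sym2 (Fin n) → Bool) (a : Fin n) :
    ncDegree (flipGraph G₀ f) a = degOn G₀ f a Finset.univ := by
  classical
  rw [ncDegree, degOn, Nat.card_eq_fintype_card, Fintype.card_subtype]

lemma bernProb_markCount (p : ℝ) (a : Fin n) (S : Finset (Fin n)) (k : ℕ) :
    bernProb p (fun f => markCount f a S = k) =
      S.card.choose k * p ^ k * (1 - p) ^ (S.card - k) := by
  classical
  have hinj : Set.InjOn (fun t => s(a, t)) (S : Set (Fin n)) := fun t _ t' _ h =>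
    Sym2.congr_right.1 h
  rw [← Finset.card_image_of_injOn hinj, ← bernProb_card_eq]
  congr 1
  funext f
  rw [markCount, Finset.filter_image, Finset.card_image_of_injOn]
  exact hinj.mono (Finset.coe_subset.2 (Finset.filter_subset _ _))

end FlipGraph

/-- A family of pairs of vertices `q j false, q j true` outside `B`, each with three disjoint
test sets on which both vertices have constant adjacency `sgn j`. -/
structure Gadgets {n : ℕ} (G₀ : SimpleGraph (Fin n)) (κ : Type) (B : Finset (Fin n))
    (ℓ : ℕ) where
  q : κ → Bool → Fin n
  T : κ → Fin 3 → Finset (Fin n)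
  sgn : κ → Bool
  q_inj : ∀ j b j' b', q j b = q j' b' → j = j' ∧ b = b'
  q_notMem_base : ∀ j b, q j b ∉ B
  notMem_base : ∀ j i, ∀ t ∈ T j i, t ∉ B
  q_notMem : ∀ j b j' i, q j b ∉ T j' i
  disj : ∀ j i i', i ≠ i' → Disjoint (T j i) (T j i')
  card_T : ∀ j i, (T j i).card = ℓ
  adj_T : ∀ j b i, ∀ t ∈ T j i, (G₀.Adj (q j b) t ↔ sgn j = true)

namespace Gadgets

variable {n : ℕ} {G₀ : SimpleGraph (Fin n)} {κ : Type} {B : Finset (Fin n)} {ℓ : ℕ}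
  (Γ : Gadgets G₀ κ B ℓ)

/-- Exactly one of the pairs between `q j _` and the first test set is marked. -/
def Coin (j : κ) (f : Sym2 (Fin n) → Bool) : Prop :=
  markCount f (Γ.q j false) (Γ.T j 0) + markCount f (Γ.q j true) (Γ.T j 0) = 1

/-- The smaller of the two degrees that `q j b` may have according to the outcome of the coin. -/
noncomputable def baseDeg (j : κ) (b : Bool) (f : Sym2 (Fin n) → Bool) : ℕ :=
  degOn G₀ f (Γ.q j b) (Finset.univ \ Γ.T j 0) + if Γ.sgn j then ℓ - 1 else 0

/-- The pair `j` has a coin, by which the degrees modulo `M` of its two vertices are in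
`{r, r + 1}` and `{0, 1}`, respectively. -/
def HasType (M r : ℕ) (j : κ) (f : Sym2 (Fin n) → Bool) : Prop :=
  Γ.Coin j f ∧ Γ.baseDeg j false f % M = r ∧ Γ.baseDeg j true f % M = 0

lemma ncDegree_eq {j : κ} {f : Sym2 (Fin n) → Bool} (h : Γ.Coin j f) (b : Bool) :
    ncDegree (flipGraph G₀ f) (Γ.q j b) = Γ.baseDeg j b f +
      if (markCount f (Γ.q j b) (Γ.T j 0) = 1 ↔ Γ.sgn j = true) then 0 else 1 := by
  rw [ncDegree_flipGraph, degOn_sdiff_add f _ (Finset.subset_univ (Γ.T j 0)), baseDeg,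
    degOn_of_sign f (Γ.q_notMem j b j 0) (Γ.adj_T j b 0), Γ.card_T]
  have h1 : markCount f (Γ.q j b) (Γ.T j 0) ≤ 1 := by
    unfold Coin at h
    cases b <;> omega
  have h2 : 1 ≤ ℓ := by
    unfold Coin at h
    have h3 := markCount_le f (Γ.q j false) (Γ.T j 0)
    have h4 := markCount_le f (Γ.q j true) (Γ.T j 0)
    rw [Γ.card_T] at h3 h4
    omega
  generalize markCount f (Γ.q j b) (Γ.T j 0) = m at h1
  cases Γ.sgn j
  · interval_cases m <;> simp
  · interval_cases m
    · simp
      omega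
    · simp

/-- The pairs between `q j _` and the first test sets. -/
def coinPairs : {x : κ × Bool × Fin n // x.2.2 ∈ Γ.T x.1 0} ↪ Sym2 (Fin n) where
  toFun x := s(Γ.q x.1.1 x.1.2.1, x.1.2.2)
  inj' := by
    rintro ⟨⟨j, b, t⟩, h⟩ ⟨⟨j', b', t'⟩, h'⟩ hxy
    simp only at h h'
    rcases Sym2.eq_iff.1 hxy with ⟨h1, h2⟩ | ⟨h1, h2⟩
    · obtain ⟨rfl, rfl⟩ := Γ.q_inj _ _ _ _ h1
      simp only at h2
      subst h2
      rfl
    · simp only at h1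
      exact absurd h' (h1 ▸ Γ.q_notMem j b j' 0)

variable [Fintype κ] [DecidableEq κ]

/-- Interchange the roles of `q j false` and `q j true` towards the first test set, for all
`j ∈ ε`. -/
def swapPairs (ε : Finset κ) : Equiv.Perm (Sym2 (Fin n)) :=
  Equiv.Perm.viaFintypeEmbedding (Function.Involutive.toPerm
    (fun x : {x : κ × Bool × Fin n // x.2.2 ∈ Γ.T x.1 0} =>
      (⟨(x.1.1, xor x.1.2.1 (decide (x.1.1 ∈ ε)), x.1.2.2), x.2⟩ :
        {x : κ × Bool × Fin n // x.2.2 ∈ Γ.T x.1 0}))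
    (fun x => by ext <;> simp)) Γ.coinPairs

lemma swapPairs_coin (ε : Finset κ) {j : κ} (b : Bool) {t : Fin n} (ht : t ∈ Γ.T j 0) :
    Γ.swapPairs ε s(Γ.q j b, t) = s(Γ.q j (xor b (decide (j ∈ ε))), t) :=
  Equiv.Perm.viaFintypeEmbedding_apply_image _ Γ.coinPairs ⟨(j, b, t), ht⟩

lemma swapPairs_of_ne (ε : Finset κ) {e : Sym2 (Fin n)}
    (h : ∀ j b, ∀ t ∈ Γ.T j 0, e ≠ s(Γ.q j b, t)) : Γ.swapPairs ε e = e := by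
  refine Equiv.Perm.viaFintypeEmbedding_apply_notMem_range _ _ ?_
  rintro ⟨⟨⟨j, b, t⟩, ht⟩, rfl⟩
  exact h j b t ht rfl

lemma markCount_swap (ε : Finset κ) (j : κ) (b : Bool) (f : Sym2 (Fin n) → Bool) :
    markCount (f ∘ Γ.swapPairs ε) (Γ.q j b) (Γ.T j 0) =
      markCount f (Γ.q j (xor b (decide (j ∈ ε)))) (Γ.T j 0) := by
  unfold markCount
  congr 1
  refine Finset.filter_congr fun t ht => ?_
  rw [Function.comp_apply, Γ.swapPairs_coin ε b ht]

lemma coin_swap (ε : Finset κ) (j : κ) (f : Sym2 (Fin n) → Bool) :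
    Γ.Coin j (f ∘ Γ.swapPairs ε) ↔ Γ.Coin j f := by
  unfold Coin
  rw [markCount_swap, markCount_swap]
  by_cases h : j ∈ ε
  · simp [h, add_comm]
  · simp [h]

lemma baseDeg_swap (ε : Finset κ) (j : κ) (b : Bool) (f : Sym2 (Fin n) → Bool) :
    Γ.baseDeg j b (f ∘ Γ.swapPairs ε) = Γ.baseDeg j b f := by
  unfold baseDeg
  congr 1
  refine degOn_congr fun t ht => ?_
  rw [Function.comp_apply, Γ.swapPairs_of_ne]
  intro j' b' t' ht' h
  rcases Sym2.eq_iff.1 h with ⟨h1, rfl⟩ | ⟨h1, -⟩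
  · obtain ⟨rfl, -⟩ := Γ.q_inj _ _ _ _ h1
    exact (Finset.mem_sdiff.1 ht).2 ht'
  · exact Γ.q_notMem j b j' 0 (h1 ▸ ht')

lemma hasType_swap (ε : Finset κ) (M r : ℕ) (j : κ) (f : Sym2 (Fin n) → Bool) :
    Γ.HasType M r j (f ∘ Γ.swapPairs ε) ↔ Γ.HasType M r j f := by
  simp only [HasType, coin_swap, baseDeg_swap]

lemma ncDegree_swap_of_notMem {ε : Finset κ} {j : κ} (hj : j ∉ ε) (b : Bool)
    (f : Sym2 (Fin n) → Bool) :
    ncDegree (flipGraph G₀ (f ∘ Γ.swapPairs ε)) (Γ.q j b) =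
      ncDegree (flipGraph G₀ f) (Γ.q j b) := by
  rw [ncDegree_flipGraph, ncDegree_flipGraph]
  refine degOn_congr fun t _ => ?_
  rw [Function.comp_apply]
  by_cases ht : t ∈ Γ.T j 0
  · rw [Γ.swapPairs_coin ε b ht]
    simp [hj]
  · rw [Γ.swapPairs_of_ne]
    intro j' b' t' ht' h
    rcases Sym2.eq_iff.1 h with ⟨h1, rfl⟩ | ⟨h1, -⟩
    · obtain ⟨rfl, -⟩ := Γ.q_inj _ _ _ _ h1
      exact ht ht'
    · exact Γ.q_notMem j b j' 0 (h1 ▸ ht')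

lemma ncDegree_swap_of_ne (ε : Finset κ) {w : Fin n} (hw : ∀ j b, w ≠ Γ.q j b)
    (f : Sym2 (Fin n) → Bool) :
    ncDegree (flipGraph G₀ (f ∘ Γ.swapPairs ε)) w = ncDegree (flipGraph G₀ f) w := by
  classical
  let emb : κ × Bool ↪ Fin n := ⟨fun x => Γ.q x.1 x.2, fun x y h => by
    obtain ⟨h1, h2⟩ := Γ.q_inj _ _ _ _ h
    exact Prod.ext h1 h2⟩
  let σ : Equiv.Perm (Fin n) := Equiv.Perm.viaFintypeEmbedding (Function.Involutive.toPerm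
    (fun x : κ × Bool => (x.1, xor x.2 (decide (x.1 ∈ ε ∧ w ∈ Γ.T x.1 0))))
    (fun x => by ext <;> simp)) emb
  have hσq : ∀ j b, σ (Γ.q j b) = Γ.q j (xor b (decide (j ∈ ε ∧ w ∈ Γ.T j 0))) := fun j b =>
    Equiv.Perm.viaFintypeEmbedding_apply_image _ emb (j, b)
  have hσ : ∀ t, (∀ j b, t ≠ Γ.q j b) → σ t = t := fun t ht =>
    Equiv.Perm.viaFintypeEmbedding_apply_notMem_range _ _ fun ⟨x, hx⟩ => ht x.1 x.2 hx.symm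
  unfold ncDegree
  refine Nat.card_congr (σ.subtypeEquiv fun t => ?_)
  rw [flipGraph_adj, flipGraph_adj, Function.comp_apply]
  by_cases ht : ∃ j b, t = Γ.q j b
  · obtain ⟨j, b, rfl⟩ := ht
    rw [hσq]
    by_cases hwT : w ∈ Γ.T j 0
    · rw [Sym2.eq_swap, Γ.swapPairs_coin ε b hwT, Sym2.eq_swap, G₀.adj_comm, Γ.adj_T j b 0 w hwT,
        G₀.adj_comm, Γ.adj_T j _ 0 w hwT]
      simp [hw, hwT]
    · rw [Γ.swapPairs_of_ne]
      · simp [hwT]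
      · intro j' b' t' ht' h
        rcases Sym2.eq_iff.1 h with ⟨h1, -⟩ | ⟨h1, h2⟩
        · exact hw _ _ h1
        · obtain ⟨rfl, rfl⟩ := Γ.q_inj _ _ _ _ h2
          exact hwT (h1 ▸ ht')
  · push Not at ht
    rw [hσ t ht, Γ.swapPairs_of_ne]
    intro j' b' t' ht' h
    rcases Sym2.eq_iff.1 h with ⟨h1, -⟩ | ⟨-, h2⟩
    · exact hw _ _ h1
    · exact ht _ _ h2

end Gadgets

lemma exists_mod_eq_of_sign {M r ℓ : ℕ} (hr : r < M) (hM : M ≤ ℓ) (s : Bool) (c : ℕ) :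
    ∃ i < M, (c + if s then ℓ - i else i) % M = r := by
  have hM0 : 0 < M := by omega
  cases s
  · have hc : c ≤ M * c := Nat.le_mul_of_pos_left c hM0
    refine ⟨(r + M * c - c) % M, Nat.mod_lt _ hM0, ?_⟩
    simp only [Bool.false_eq_true, if_false, Nat.add_mod_mod]
    rw [show c + (r + M * c - c) = r + M * c by omega, Nat.add_mul_mod_self_left,
      Nat.mod_eq_of_lt hr]
  · have hc : r ≤ M * r := Nat.le_mul_of_pos_left r hM0
    have hi := Nat.mod_lt (c + ℓ + (M * r - r)) hM0
    refine ⟨(c + ℓ + (M * r - r)) % M, hi, ?_⟩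
    simp only [if_true]
    set i := (c + ℓ + (M * r - r)) % M with hidef
    have h1 : (c + (ℓ - i)) + i ≡ r + i [MOD M] := by
      rw [show (c + (ℓ - i)) + i = c + ℓ by omega]
      have h2 : r + i ≡ r + (c + ℓ + (M * r - r)) [MOD M] :=
        (Nat.mod_modEq _ _).add_left r
      rw [show r + (c + ℓ + (M * r - r)) = (c + ℓ) + M * r by omega] at h2
      exact (h2.trans (by simp [Nat.ModEq])).symm
    have h3 := Nat.ModEq.add_right_cancel' i h1
    exact (show _ % M = r % M from h3).trans (Nat.mod_eq_of_lt hr)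

open Classical in
/-- The entries of `x` at the vertices of degree `r` modulo `M` sum to zero. -/
def DegreeBalanced {n : ℕ} (G : SimpleGraph (Fin n)) (M r : ℕ) (x : Fin n → ℤ) : Prop :=
  ∑ w, (if ncDegree G w % M = r then x w else 0) = 0

namespace Gadgets

variable {n : ℕ} {G₀ : SimpleGraph (Fin n)} {κ : Type} {B : Finset (Fin n)} {ℓ : ℕ}
  (Γ : Gadgets G₀ κ B ℓ)

/-- The pairs between `q j b` and the `i`-th test set. -/
def star (j : κ) (b : Bool) (i : Fin 3) : Set (Sym2 (Fin n)) := {e | ∃ t ∈ Γ.T j i, e = s(Γ.q j b, t)}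

/-- The pairs between the vertices of the `j`-th gadget and its test sets. -/
def block (j : κ) : Set (Sym2 (Fin n)) := {e | ∃ b i, e ∈ Γ.star j b i}

lemma mem_star_iff {j j' : κ} {b b' : Bool} {i : Fin 3} {t : Fin n} :
    s(Γ.q j b, t) ∈ Γ.star j' b' i ↔ (j = j' ∧ b = b') ∧ t ∈ Γ.T j' i := by
  constructor
  · rintro ⟨t', ht', h⟩
    rcases Sym2.eq_iff.1 h with ⟨h1, rfl⟩ | ⟨h1, -⟩
    · exact ⟨Γ.q_inj _ _ _ _ h1, ht'⟩
    · exact absurd ht' (h1 ▸ Γ.q_notMem j b j' i)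
  · rintro ⟨⟨rfl, rfl⟩, ht⟩
    exact ⟨t, ht, rfl⟩

lemma notMem_block {j j' : κ} (h : j ≠ j') (b : Bool) (t : Fin n) :
    s(Γ.q j b, t) ∉ Γ.block j' := by
  rintro ⟨b', i, hbi⟩
  exact h (Γ.mem_star_iff.1 hbi).1.1

lemma baseDeg_congr {j : κ} {b : Bool} {f f' : Sym2 (Fin n) → Bool}
    (h : ∀ t, t ∉ Γ.T j 0 → f s(Γ.q j b, t) = f' s(Γ.q j b, t)) :
    Γ.baseDeg j b f = Γ.baseDeg j b f' := by
  unfold baseDeg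
  congr 1
  exact degOn_congr fun t ht => h t (Finset.mem_sdiff.1 ht).2

lemma ignores_hasType {j j' : κ} (h : j' ≠ j) (M r : ℕ) :
    Ignores (Γ.block j) (Γ.HasType M r j') := by
  intro f f' hff
  have h1 : ∀ b t, f s(Γ.q j' b, t) = f' s(Γ.q j' b, t) := fun b t =>
    hff _ (Γ.notMem_block h b t)
  unfold HasType Coin
  rw [Γ.baseDeg_congr fun t _ => h1 false t, Γ.baseDeg_congr fun t _ => h1 true t,
    markCount_congr fun t _ => h1 false t, markCount_congr fun t _ => h1 true t]

lemma exists_markCount_baseDeg {M r : ℕ} (hr : r < M) (hM : M ≤ ℓ) (j : κ) (b : Bool)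
    {i₀ : Fin 3} (hi₀ : i₀ ≠ 0) (h₀ : Sym2 (Fin n) → Bool) :
    ∃ i < M, ∀ h : Sym2 (Fin n) → Bool, (∀ e ∉ Γ.star j b i₀, h e = h₀ e) →
      markCount h (Γ.q j b) (Γ.T j i₀) = i → Γ.baseDeg j b h % M = r := by
  have hsub : Γ.T j i₀ ⊆ Finset.univ \ Γ.T j 0 := fun t ht =>
    Finset.mem_sdiff.2 ⟨Finset.mem_univ _, fun h => Finset.disjoint_left.1 (Γ.disj j _ _ hi₀) ht h⟩
  obtain ⟨i, hi, hir⟩ := exists_mod_eq_of_sign hr hM (Γ.sgn j)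
    (degOn G₀ h₀ (Γ.q j b) ((Finset.univ \ Γ.T j 0) \ Γ.T j i₀) + if Γ.sgn j then ℓ - 1 else 0)
  refine ⟨i, hi, fun h hh hhi => ?_⟩
  rw [baseDeg, degOn_sdiff_add h _ hsub, degOn_of_sign h (Γ.q_notMem j b j i₀) (Γ.adj_T j b i₀),
    hhi, Γ.card_T, ← hir]
  have : degOn G₀ h (Γ.q j b) ((Finset.univ \ Γ.T j 0) \ Γ.T j i₀) =
      degOn G₀ h₀ (Γ.q j b) ((Finset.univ \ Γ.T j 0) \ Γ.T j i₀) :=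
    degOn_congr fun t ht => hh _ fun hmem =>
      (Finset.mem_sdiff.1 ht).2 (Γ.mem_star_iff.1 hmem).2
  rw [this]
  congr 1
  ring

lemma le_bernProb_baseDeg {p η : ℝ} (h0 : 0 ≤ p) (h1 : p ≤ 1) {M r : ℕ} (hr : r < M)
    (hM : M ≤ ℓ) (hη : ∀ i ≤ M, η ≤ ℓ.choose i * p ^ i * (1 - p) ^ (ℓ - i)) (j : κ) (b : Bool)
    {i₀ : Fin 3} (hi₀ : i₀ ≠ 0) (f g₀ : Sym2 (Fin n) → Bool) :
    η ≤ bernProb p fun g =>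
      Γ.baseDeg j b (splice (Γ.block j) (splice (Γ.star j b i₀) g g₀) f) % M = r := by
  obtain ⟨i, hi, hbase⟩ := Γ.exists_markCount_baseDeg hr hM j b hi₀ (splice (Γ.block j) g₀ f)
  have h2 := bernProb_markCount p (Γ.q j b) (Γ.T j i₀) i
  rw [Γ.card_T] at h2
  refine (hη i hi.le).trans (h2.symm.le.trans (bernProb_mono h0 h1 fun g hg => ?_))
  refine hbase _ (fun e he => ?_) ?_
  · by_cases heb : e ∈ Γ.block j
    · rw [splice_mem heb, splice_notMem he, splice_mem heb]
    · rw [splice_notMem heb, splice_notMem heb]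
  · rw [← hg]
    refine markCount_congr fun t ht => ?_
    have hs : s(Γ.q j b, t) ∈ Γ.star j b i₀ := ⟨t, ht, rfl⟩
    have hb : s(Γ.q j b, t) ∈ Γ.block j := ⟨b, i₀, hs⟩
    rw [splice_mem hb, splice_mem hs]

lemma le_bernProb_hasType {p η : ℝ} (h0 : 0 ≤ p) (h1 : p ≤ 1) (hη0 : 0 ≤ η) {M r : ℕ}
    (hr : r < M) (hM : M ≤ ℓ) (hη : ∀ i ≤ M, η ≤ ℓ.choose i * p ^ i * (1 - p) ^ (ℓ - i)) (j : κ)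
    (f : Sym2 (Fin n) → Bool) :
    η ^ 4 ≤ bernProb p fun g => Γ.HasType M r j (splice (Γ.block j) g f) := by
  have hmark : ∀ b, ∀ k ≤ M, η ≤ bernProb p fun g => markCount g (Γ.q j b) (Γ.T j 0) = k := by
    intro b k hk
    rw [bernProb_markCount, Γ.card_T]
    exact hη k hk
  have e1 := hmark false 1 (by omega)
  have e2 : η * bernProb p (fun g => markCount g (Γ.q j false) (Γ.T j 0) = 1) ≤
      bernProb p fun g => markCount g (Γ.q j false) (Γ.T j 0) = 1 ∧
        markCount g (Γ.q j true) (Γ.T j 0) = 0 := by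
    refine le_bernProb_and (B := Γ.star j true 0) h0 h1 ?_ fun f => ?_
    · intro g g' hg
      have : markCount g (Γ.q j false) (Γ.T j 0) = markCount g' (Γ.q j false) (Γ.T j 0) :=
        markCount_congr fun t _ => hg _ fun h => Bool.false_ne_true (Γ.mem_star_iff.1 h).1.2
      beta_reduce
      rw [this]
    · refine (hmark true 0 (by omega)).trans_eq ?_
      congr 1
      funext g
      rw [markCount_congr (f := splice _ g f) fun t ht => splice_mem (Γ.mem_star_iff.2
        ⟨⟨rfl, rfl⟩, ht⟩) g f]
  have e3 : η * bernProb p (fun g => markCount g (Γ.q j false) (Γ.T j 0) = 1 ∧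
        markCount g (Γ.q j true) (Γ.T j 0) = 0) ≤
      bernProb p fun g => (markCount g (Γ.q j false) (Γ.T j 0) = 1 ∧
        markCount g (Γ.q j true) (Γ.T j 0) = 0) ∧
        Γ.baseDeg j false (splice (Γ.block j) g f) % M = r := by
    refine le_bernProb_and (B := Γ.star j false 1) h0 h1 ?_
      fun g₀ => Γ.le_bernProb_baseDeg h0 h1 hr hM hη j false (by decide) f g₀
    intro g g' hg
    have : ∀ b, ∀ t ∈ Γ.T j 0, g s(Γ.q j b, t) = g' s(Γ.q j b, t) := fun b t ht =>
      hg _ fun h => Finset.disjoint_left.1 (Γ.disj j 0 1 (by decide)) ht (Γ.mem_star_iff.1 h).2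
    beta_reduce
    rw [markCount_congr (this false), markCount_congr (this true)]
  have e4 : η * bernProb p (fun g => (markCount g (Γ.q j false) (Γ.T j 0) = 1 ∧
        markCount g (Γ.q j true) (Γ.T j 0) = 0) ∧
        Γ.baseDeg j false (splice (Γ.block j) g f) % M = r) ≤
      bernProb p fun g => ((markCount g (Γ.q j false) (Γ.T j 0) = 1 ∧
        markCount g (Γ.q j true) (Γ.T j 0) = 0) ∧
        Γ.baseDeg j false (splice (Γ.block j) g f) % M = r) ∧
        Γ.baseDeg j true (splice (Γ.block j) g f) % M = 0 := by
    refine le_bernProb_and (B := Γ.star j true 2) h0 h1 ?_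
      fun g₀ => Γ.le_bernProb_baseDeg h0 h1 (by omega) hM hη j true (by decide) f g₀
    intro g g' hg
    have h1 : ∀ b, ∀ t ∈ Γ.T j 0, g s(Γ.q j b, t) = g' s(Γ.q j b, t) := fun b t ht =>
      hg _ fun h => Finset.disjoint_left.1 (Γ.disj j 0 2 (by decide)) ht (Γ.mem_star_iff.1 h).2
    have h2 : Γ.baseDeg j false (splice (Γ.block j) g f) =
        Γ.baseDeg j false (splice (Γ.block j) g' f) := Γ.baseDeg_congr fun t _ => by
      have := hg s(Γ.q j false, t) fun h =>
        Bool.false_ne_true (Γ.mem_star_iff.1 h).1.2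
      unfold splice
      rw [this]
    beta_reduce
    rw [markCount_congr (h1 false), markCount_congr (h1 true), h2]
  have e5 : bernProb p (fun g => ((markCount g (Γ.q j false) (Γ.T j 0) = 1 ∧
        markCount g (Γ.q j true) (Γ.T j 0) = 0) ∧
        Γ.baseDeg j false (splice (Γ.block j) g f) % M = r) ∧
        Γ.baseDeg j true (splice (Γ.block j) g f) % M = 0) ≤
      bernProb p fun g => Γ.HasType M r j (splice (Γ.block j) g f) := by
    refine bernProb_mono h0 h1 fun g hg => ⟨?_, hg.1.2, hg.2⟩
    have : ∀ b, markCount (splice (Γ.block j) g f) (Γ.q j b) (Γ.T j 0) =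
        markCount g (Γ.q j b) (Γ.T j 0) := fun b =>
      markCount_congr fun t ht => splice_mem (B := Γ.block j) (i := s(Γ.q j b, t))
        ⟨b, 0, t, ht, rfl⟩ g f
    unfold Coin
    rw [this, this, hg.1.1.1, hg.1.1.2]
  calc η ^ 4 = η * (η * (η * η)) := by ring
    _ ≤ _ := (mul_le_mul_of_nonneg_left ((mul_le_mul_of_nonneg_left
      ((mul_le_mul_of_nonneg_left e1 hη0).trans e2) hη0).trans e3) hη0).trans (e4.trans e5)

lemma ncDegree_mod {K k : ℕ} (hkK : k ≤ K) {j : κ} {f : Sym2 (Fin n) → Bool}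
    (h : Γ.HasType (2 * K + 2) (2 * k) j f) (b : Bool) :
    ncDegree (flipGraph G₀ f) (Γ.q j b) % (2 * K + 2) = (if b then 0 else 2 * k) +
      if (markCount f (Γ.q j b) (Γ.T j 0) = 1 ↔ Γ.sgn j = true) then 0 else 1 := by
  rw [Γ.ncDegree_eq h.1 b, Nat.add_mod]
  have h1 : 1 % (2 * K + 2) = 1 := Nat.mod_eq_of_lt (by omega)
  cases b
  · rw [h.2.1]
    simp only [Bool.false_eq_true, if_false]
    split_ifs
    · rw [Nat.zero_mod, Nat.mod_eq_of_lt (by omega)]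
    · rw [h1, Nat.mod_eq_of_lt (by omega)]
  · rw [h.2.2]
    simp only [if_true]
    split_ifs
    · rw [Nat.zero_mod, Nat.mod_eq_of_lt (by omega)]
    · rw [h1, Nat.mod_eq_of_lt (by omega)]

variable [Fintype κ]

open Classical in
/-- The set of gadgets of a given type. -/
noncomputable def typed (M r : ℕ) (f : Sym2 (Fin n) → Bool) : Finset κ :=
  Finset.univ.filter fun j => Γ.HasType M r j f

lemma bernProb_few_typed_le {p η : ℝ} (h0 : 0 ≤ p) (h1 : p ≤ 1) (hη1 : η ≤ 1) {M r : ℕ}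
    (hη : ∀ j f, η ≤ bernProb p fun g => Γ.HasType M r j (splice (Γ.block j) g f))
    {H : (Sym2 (Fin n) → Bool) → Prop} (hH : ∀ j, Ignores (Γ.block j) H) (m : ℕ) :
    bernProb p (fun f => H f ∧ ¬ m ≤ (Γ.typed M r f).card) ≤
      2 ^ m * (1 - η / 2) ^ Fintype.card κ * bernProb p H := by
  classical
  have h2 := bernExp_mul_prod_le h0 h1 (Finset.univ : Finset κ) (B := Γ.block)
    (H := fun f => if H f then 1 else 0)
    (φ := fun j f => 1 - (if Γ.HasType M r j f then 1 else 0) / 2) (c := 1 - η / 2)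
    (by linarith) (fun f => by split_ifs <;> norm_num)
    (fun j _ f f' hf => by simp only [hH j f f' hf])
    (fun j f => by split_ifs <;> norm_num)
    (fun j _ j' _ hjj f f' hf => by simp only [Γ.ignores_hasType hjj.symm M r f f' hf])
    (fun j _ f => by
      have h3 := hη j f
      rw [bernProb_eq] at h3
      have h4 : bernExp p (fun g => 1 - (if Γ.HasType M r j (splice (Γ.block j) g f)
          then (1 : ℝ) else 0) / 2) = bernExp p (fun _ : Sym2 (Fin n) → Bool => (1 : ℝ)) - 1 / 2 *
          bernExp p (fun g => if Γ.HasType M r j (splice (Γ.block j) g f) then (1 : ℝ) else 0) := by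
        rw [← bernExp_const_mul]
        simp only [bernExp_def, ← Finset.sum_sub_distrib]
        exact Finset.sum_congr rfl fun g _ => by ring
      rw [h4, bernExp_one]
      linarith)
  rw [Finset.card_univ] at h2
  rw [mul_assoc, bernProb_eq p H]
  refine le_trans ?_ (mul_le_mul_of_nonneg_left h2 (by positivity))
  rw [← bernExp_const_mul]
  refine bernExp_mono h0 h1 fun f => ?_
  have hprod : ∏ j : κ, (1 - (if Γ.HasType M r j f then (1 : ℝ) else 0) / 2) =
      (1 / 2) ^ (Γ.typed M r f).card := by
    rw [typed, ← Finset.prod_const, Finset.prod_filter]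
    exact Finset.prod_congr rfl fun j _ => by split_ifs <;> norm_num
  rw [hprod]
  split_ifs with hc hf hf
  · rw [one_mul, one_div, inv_pow, ← div_eq_mul_inv, le_div_iff₀ (by positivity), one_mul]
    exact pow_le_pow_right₀ (by norm_num) (not_le.1 hc.2).le
  · exact absurd hc.1 hf
  · positivity
  · simp

variable [DecidableEq κ]

lemma balanced_swap_iff {K k k' : ℕ} (hkK : k ≤ K) (hk : 1 ≤ k') (hkk : k' ≠ k)
    {f : Sym2 (Fin n) → Bool} {ε : Finset κ} (hε : ε ⊆ Γ.typed (2 * K + 2) (2 * k) f)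
    (x : Fin n → ℤ) :
    DegreeBalanced (flipGraph G₀ (f ∘ Γ.swapPairs ε)) (2 * K + 2) (2 * k') x ↔
      DegreeBalanced (flipGraph G₀ f) (2 * K + 2) (2 * k') x := by
  classical
  unfold DegreeBalanced
  have : ∀ w, (ncDegree (flipGraph G₀ (f ∘ Γ.swapPairs ε)) w % (2 * K + 2) = 2 * k' ↔
      ncDegree (flipGraph G₀ f) w % (2 * K + 2) = 2 * k') := by
    intro w
    by_cases hw : ∃ j b, w = Γ.q j b
    · obtain ⟨j, b, rfl⟩ := hw
      by_cases hj : j ∈ ε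
      · have h1 := (Finset.mem_filter.1 (hε hj)).2
        have h2 := (Γ.hasType_swap ε _ _ j f).2 h1
        have hne : ∀ f', Γ.HasType (2 * K + 2) (2 * k) j f' →
            ncDegree (flipGraph G₀ f') (Γ.q j b) % (2 * K + 2) ≠ 2 * k' := by
          intro f' hf'
          rw [Γ.ncDegree_mod hkK hf']
          split_ifs <;> omega
        exact iff_of_false (hne _ h2) (hne _ h1)
      · rw [Γ.ncDegree_swap_of_notMem hj]
    · push Not at hw
      rw [Γ.ncDegree_swap_of_ne ε hw]
  simp only [this]

lemma ncDegree_mod_swap_iff {K k : ℕ} (hkK : k ≤ K) (hk : 1 ≤ k) {f : Sym2 (Fin n) → Bool}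
    {ε : Finset κ} {j : κ} (hj : j ∈ ε) (h : Γ.HasType (2 * K + 2) (2 * k) j f) (b : Bool) :
    (ncDegree (flipGraph G₀ (f ∘ Γ.swapPairs ε)) (Γ.q j b) % (2 * K + 2) = 2 * k ↔
      b = false ∧ ¬ ncDegree (flipGraph G₀ f) (Γ.q j b) % (2 * K + 2) = 2 * k) := by
  rw [Γ.ncDegree_mod hkK h, Γ.ncDegree_mod hkK ((Γ.hasType_swap ε _ _ j f).2 h), markCount_swap]
  have hc := h.1
  unfold Coin at hc
  cases b
  · simp only [hj, decide_true, Bool.false_xor]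
    have : markCount f (Γ.q j true) (Γ.T j 0) = 1 ↔ ¬ markCount f (Γ.q j false) (Γ.T j 0) = 1 := by
      omega
    simp only [this]
    cases Γ.sgn j
    · simp
    · simp
  · simp only [if_true, reduceCtorEq, false_and, iff_false]
    split_ifs <;> omega

lemma card_balanced_swap_le {K k : ℕ} (hkK : k ≤ K) (hk : 1 ≤ k) (x : Fin n → ℤ)
    (hx : ∀ j, x (Γ.q j false) ≠ 0) (f : Sym2 (Fin n) → Bool)
    [DecidablePred fun ε => DegreeBalanced (flipGraph G₀ (f ∘ Γ.swapPairs ε)) (2 * K + 2) (2 * k) x] :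
    ((Γ.typed (2 * K + 2) (2 * k) f).powerset.filter fun ε =>
      DegreeBalanced (flipGraph G₀ (f ∘ Γ.swapPairs ε)) (2 * K + 2) (2 * k) x).card ≤
      (Γ.typed (2 * K + 2) (2 * k) f).card.choose ((Γ.typed (2 * K + 2) (2 * k) f).card / 2) := by
  classical
  set J := Γ.typed (2 * K + 2) (2 * k) f with hJ
  let M := 2 * K + 2
  let d : Fin n → ℤ := fun w => if ncDegree (flipGraph G₀ f) w % M = 2 * k then x w else 0
  let a : κ → ℤ := fun j => x (Γ.q j false) - 2 * d (Γ.q j false)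
  have ha : ∀ j ∈ J, a j ≠ 0 := by
    intro j _
    have := hx j
    simp only [a, d]
    split_ifs <;> omega
  refine (Finset.card_le_card ?_).trans (card_subset_sum_eq_le J a ha (-∑ w, d w))
  intro ε hε
  rw [Finset.mem_filter] at hε ⊢
  refine ⟨hε.1, ?_⟩
  have hεJ := Finset.mem_powerset.1 hε.1
  have hbal := hε.2
  unfold DegreeBalanced at hbal
  have hq : Function.Injective fun j => Γ.q j false := fun j j' h => (Γ.q_inj _ _ _ _ h).1
  have hkey : ∀ w, (if ncDegree (flipGraph G₀ (f ∘ Γ.swapPairs ε)) w % M = 2 * k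
      then x w else 0) = d w + ∑ j ∈ ε, if w = Γ.q j false then a j else 0 := by
    intro w
    by_cases hw : ∃ j ∈ ε, ∃ b, w = Γ.q j b
    · obtain ⟨j, hj, b, rfl⟩ := hw
      have hjT := (Finset.mem_filter.1 (hεJ hj)).2
      have h1 := Γ.ncDegree_mod_swap_iff hkK hk hj hjT b
      cases b
      · rw [Finset.sum_eq_single j]
        · simp only [true_and] at h1
          simp only [M, h1, a, d, if_true]
          split_ifs <;> ring
        · intro j' _ hj'
          rw [if_neg fun h => hj' (Γ.q_inj _ _ _ _ h).1.symm]
        · exact fun h => absurd hj h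
      · have h2 : ¬ ncDegree (flipGraph G₀ f) (Γ.q j true) % M = 2 * k := by
          simp only [M]
          rw [Γ.ncDegree_mod hkK hjT, if_pos rfl]
          split_ifs <;> omega
        simp only [reduceCtorEq, false_and, iff_false] at h1
        rw [Finset.sum_eq_zero, if_neg h1]
        · simp [d, h2]
        · intro j' _
          rw [if_neg fun h => by simpa using (Γ.q_inj _ _ _ _ h).2]
    · have h1 : ncDegree (flipGraph G₀ (f ∘ Γ.swapPairs ε)) w = ncDegree (flipGraph G₀ f) w := by
        by_cases hw' : ∃ j b, w = Γ.q j b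
        · obtain ⟨j, b, rfl⟩ := hw'
          exact Γ.ncDegree_swap_of_notMem (fun hj => hw ⟨j, hj, b, rfl⟩) b f
        · push Not at hw'
          exact Γ.ncDegree_swap_of_ne ε hw' f
      rw [h1, Finset.sum_eq_zero, add_zero]
      intro j hj
      rw [if_neg fun h => hw ⟨j, hj, false, h⟩]
  rw [Finset.sum_congr rfl fun w _ => hkey w, Finset.sum_add_distrib, Finset.sum_comm] at hbal
  simp only [Finset.sum_ite_eq', Finset.mem_univ, if_true] at hbal
  linarith

lemma bernProb_balanced_le {p : ℝ} (h0 : 0 ≤ p) (h1 : p ≤ 1) {K m : ℕ} (x : Fin n → ℤ)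
    (hx : ∀ j, x (Γ.q j false) ≠ 0) {H : (Sym2 (Fin n) → Bool) → Prop}
    (hH : ∀ ε f, H (f ∘ Γ.swapPairs ε) ↔ H f)
    (hm : ∀ f, H f → ∀ k ∈ Finset.Icc 1 K, m ≤ (Γ.typed (2 * K + 2) (2 * k) f).card)
    (k₀ : ℕ) (hk₀ : k₀ ≤ K) :
    bernProb p (fun f => H f ∧ ∀ k ∈ Finset.Icc 1 k₀,
      DegreeBalanced (flipGraph G₀ f) (2 * K + 2) (2 * k) x) ≤
      (1 / Real.sqrt (m + 1)) ^ k₀ * bernProb p H := by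
  classical
  induction k₀ with
  | zero => simp
  | succ k₀ ih =>
    have ih' := ih (by omega)
    set c : ℝ := 1 / Real.sqrt (m + 1) with hc
    have hc0 : 0 ≤ c := by positivity
    let P : (Sym2 (Fin n) → Bool) → Prop := fun f => H f ∧ ∀ k ∈ Finset.Icc 1 k₀,
      DegreeBalanced (flipGraph G₀ f) (2 * K + 2) (2 * k) x
    let E : (Sym2 (Fin n) → Bool) → Prop := fun f =>
      DegreeBalanced (flipGraph G₀ f) (2 * K + 2) (2 * (k₀ + 1)) x
    let Y : (Sym2 (Fin n) → Bool) → Finset κ := Γ.typed (2 * K + 2) (2 * (k₀ + 1))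
    have hY : ∀ ε f, Y (f ∘ Γ.swapPairs ε) = Y f := fun ε f => by
      simp only [Y, typed, hasType_swap]
    have hstep : bernProb p (fun f => P f ∧ E f) ≤ c * bernProb p P := by
      rw [bernProb_eq_sum_fiber p Y, bernProb_eq_sum_fiber p Y P, Finset.mul_sum]
      refine Finset.sum_le_sum fun J _ => ?_
      by_cases hJm : m ≤ J.card
      · have h3 := bernProb_and_le_of_flips h0 h1 Γ.swapPairs J (X := fun f => Y f = J ∧ P f)
          (E := E) (s := J.card.choose (J.card / 2)) (by
            intro ε hε f
            rw [hY]
            refine and_congr_right fun hYJ => and_congr (hH ε f) ?_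
            refine forall₂_congr fun k hk => ?_
            rw [Finset.mem_Icc] at hk
            exact Γ.balanced_swap_iff hk₀ hk.1 (by omega) (by rw [← hYJ] at hε; exact hε) x)
          (by
            intro f hf _
            rw [← hf.1]
            exact Γ.card_balanced_swap_le hk₀ (by omega) x hx f)
        have h4 : ((J.card.choose (J.card / 2) : ℕ) : ℝ) / 2 ^ J.card ≤ c :=
          (choose_half_div_le J.card).trans (by
            rw [hc]
            gcongr)
        refine le_trans (le_of_eq ?_)
          (h3.trans (mul_le_mul_of_nonneg_right h4 (bernProb_nonneg h0 h1 _)))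
        congr 1
        funext f
        simp only [and_assoc]
      · have : bernProb p (fun f => Y f = J ∧ P f ∧ E f) = 0 := by
          rw [← bernProb_false (ι := Sym2 (Fin n)) p]
          congr 1
          funext f
          simp only [eq_iff_iff, iff_false]
          rintro ⟨rfl, hP, -⟩
          exact hJm (hm f hP.1 (k₀ + 1) (by simp [hk₀]))
        rw [this]
        exact mul_nonneg hc0 (bernProb_nonneg h0 h1 _)
    calc _ ≤ bernProb p (fun f => P f ∧ E f) := bernProb_mono h0 h1 fun f hf =>
          ⟨⟨hf.1, fun k hk => hf.2 k (Finset.Icc_subset_Icc_right (by omega) hk)⟩,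
            hf.2 (k₀ + 1) (by simp)⟩
      _ ≤ c * (c ^ k₀ * bernProb p H) := hstep.trans (mul_le_mul_of_nonneg_left ih' hc0)
      _ = _ := by ring

end Gadgets

lemma Finset.exists_three_disjoint_subsets {α : Type*} [DecidableEq α] {S : Finset α} {ℓ : ℕ}
    (h : 3 * ℓ ≤ S.card) : ∃ T : Fin 3 → Finset α, (∀ i, T i ⊆ S) ∧ (∀ i, (T i).card = ℓ) ∧
      ∀ i i', i ≠ i' → Disjoint (T i) (T i') := by
  obtain ⟨T₀, h₀, c₀⟩ := Finset.exists_subset_card_eq (s := S) (n := ℓ) (by omega)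
  have d₀ := Finset.card_sdiff_of_subset h₀
  obtain ⟨T₁, h₁, c₁⟩ := Finset.exists_subset_card_eq (s := S \ T₀) (n := ℓ) (by omega)
  have d₁ := Finset.card_sdiff_of_subset h₁
  obtain ⟨T₂, h₂, c₂⟩ := Finset.exists_subset_card_eq (s := (S \ T₀) \ T₁) (n := ℓ) (by omega)
  have e₀₁ : Disjoint T₀ T₁ := Finset.disjoint_of_subset_right h₁ Finset.disjoint_sdiff
  have e₁₂ : Disjoint T₁ T₂ := Finset.disjoint_of_subset_right h₂ Finset.disjoint_sdiff
  have e₀₂ : Disjoint T₀ T₂ := Finset.disjoint_of_subset_right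
    (h₂.trans Finset.sdiff_subset) Finset.disjoint_sdiff
  refine ⟨![T₀, T₁, T₂], fun i => ?_, fun i => ?_, fun i i' hii => ?_⟩
  · fin_cases i
    · exact h₀
    · exact h₁.trans Finset.sdiff_subset
    · exact h₂.trans (Finset.sdiff_subset.trans Finset.sdiff_subset)
  · fin_cases i
    exacts [c₀, c₁, c₂]
  · fin_cases i <;> fin_cases i' <;> first | exact absurd rfl hii | assumption | skip
    exacts [e₀₁.symm, e₀₂.symm, e₁₂.symm]

lemma exists_gadgets {n : ℕ} (G₀ : SimpleGraph (Fin n)) {B X : Finset (Fin n)} {N ℓ : ℕ}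
    (hX : 3 * N ≤ (X \ B).card) (hB : B.card + 3 * N + 18 * ℓ ≤ n) :
    ∃ Γ : Gadgets G₀ (Fin N) B ℓ, ∀ j, Γ.q j false ∈ X := by
  classical
  obtain ⟨Y, hYX, hY⟩ := Finset.exists_subset_card_eq hX
  have hYX' : ∀ y ∈ Y, y ∈ X ∧ y ∉ B := fun y hy => Finset.mem_sdiff.1 (hYX hy)
  have e : Fin N × Fin 3 ≃ Y := finProdFinEquiv.trans
    ((finCongr (by rw [hY, mul_comm])).trans Y.equivFin.symm)
  let c : Fin N → Fin 3 → Fin n := fun j i => (e (j, i)).1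
  have hcY : ∀ j i, c j i ∈ Y := fun j i => (e (j, i)).2
  have hc : ∀ j i j' i', c j i = c j' i' → j = j' ∧ i = i' := fun j i j' i' h => by
    simpa using e.injective (Subtype.ext h)
  let T : Finset (Fin n) := Finset.univ \ (B ∪ Y)
  have hT : 18 * ℓ ≤ T.card := by
    have h1 := Finset.card_union_le B Y
    have h2 := Finset.card_sdiff_of_subset (Finset.subset_univ (B ∪ Y))
    rw [Finset.card_univ, Fintype.card_fin] at h2
    simp only [T]
    omega
  have hTB : ∀ t ∈ T, t ∉ B ∧ t ∉ Y := fun t ht => by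
    simpa [T] using ht
  have hopt : ∀ a : Fin 3 → Bool, ∃ o : Fin 3 × Bool, a (o.1 + 1) = o.2 ∧ a (o.1 + 2) = o.2 := by
    decide
  have hj : ∀ j, ∃ (o : Fin 3 × Bool) (S : Fin 3 → Finset (Fin n)), (∀ i, (S i).card = ℓ) ∧
      (∀ i i', i ≠ i' → Disjoint (S i) (S i')) ∧ ∀ i, ∀ t ∈ S i, t ∈ T ∧
        (G₀.Adj (c j (o.1 + 1)) t ↔ o.2 = true) ∧ (G₀.Adj (c j (o.1 + 2)) t ↔ o.2 = true) := by
    intro j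
    choose o ho using fun t => hopt fun i => decide (G₀.Adj (c j i) t)
    obtain ⟨y, -, hy⟩ := Finset.exists_le_card_fiber_of_mul_le_card_of_maps_to
      (s := T) (t := (Finset.univ : Finset (Fin 3 × Bool))) (f := o) (n := 3 * ℓ)
      (fun t _ => Finset.mem_univ _) ⟨(0, true), Finset.mem_univ _⟩
      (by rw [Finset.card_univ]; simp; omega)
    obtain ⟨S, h1, h2, h3⟩ := Finset.exists_three_disjoint_subsets hy
    refine ⟨y, S, h2, h3, fun i t ht => ?_⟩
    obtain ⟨htT, rfl⟩ := Finset.mem_filter.1 (h1 i ht)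
    have := ho t
    refine ⟨htT, ?_, ?_⟩
    · rw [← this.1, decide_eq_true_iff]
    · rw [← this.2, decide_eq_true_iff]
  choose o S hcard hdisj hS using hj
  let i₀ : Fin N → Bool → Fin 3 := fun j b => if b then (o j).1 + 2 else (o j).1 + 1
  have hi₀ : ∀ j b b', i₀ j b = i₀ j b' → b = b' := by
    intro j b b' h
    have : ∀ k : Fin 3, k + 1 ≠ k + 2 := by decide
    cases b <;> cases b' <;> simp only [i₀, if_true, Bool.false_eq_true, if_false] at h ⊢
    · exact absurd h (this _)
    · exact absurd h.symm (this _)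
  refine ⟨{ q := fun j b => c j (i₀ j b)
            T := S
            sgn := fun j => (o j).2
            q_inj := fun j b j' b' h => ?_
            q_notMem_base := fun j b => (hYX' _ (hcY _ _)).2
            notMem_base := fun j i t ht => (hTB t (hS j i t ht).1).1
            q_notMem := fun j b j' i h => (hTB _ (hS j' i _ h).1).2 (hcY _ _)
            disj := hdisj
            card_T := hcard
            adj_T := fun j b i t ht => ?_ }, fun j => (hYX' _ (hcY _ _)).1⟩
  · obtain ⟨rfl, h2⟩ := hc _ _ _ _ h
    exact ⟨rfl, hi₀ _ _ _ h2⟩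
  · cases b
    · exact (hS j i t ht).2.1
    · exact (hS j i t ht).2.2

namespace Gadgets

variable {n : ℕ} {G₀ : SimpleGraph (Fin n)} {κ : Type} {B : Finset (Fin n)} {ℓ : ℕ}
  (Γ : Gadgets G₀ κ B ℓ)

lemma notMem_of_mem_block {j : κ} {e : Sym2 (Fin n)} (he : e ∈ Γ.block j) : ∀ b ∈ B, b ∉ e := by
  obtain ⟨b, i, t, ht, rfl⟩ := he
  intro a ha hmem
  rcases Sym2.mem_iff.1 hmem with rfl | rfl
  · exact Γ.q_notMem_base j b ha
  · exact Γ.notMem_base j i _ ht ha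

lemma bernProb_forall_balanced_le [Fintype κ] [DecidableEq κ] {p η : ℝ} (h0 : 0 ≤ p)
    (h1 : p ≤ 1) (hη0 : 0 ≤ η) (hη1 : η ≤ 1) (K m : ℕ) (hM : 2 * K + 2 ≤ ℓ)
    (hη : ∀ i ≤ 2 * K + 2, η ≤ ℓ.choose i * p ^ i * (1 - p) ^ (ℓ - i)) (x : Fin n → ℤ)
    (hx : ∀ j, x (Γ.q j false) ≠ 0) {H : (Sym2 (Fin n) → Bool) → Prop}
    (hH : Ignores {e | ∀ b ∈ B, b ∉ e} H) :
    bernProb p (fun f => H f ∧ ∀ M r, DegreeBalanced (flipGraph G₀ f) M r x) ≤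
      (K * (2 ^ m * (1 - η ^ 4 / 2) ^ Fintype.card κ) + (1 / Real.sqrt (m + 1)) ^ K) *
        bernProb p H := by
  classical
  have hHb : ∀ j, Ignores (Γ.block j) H := fun j =>
    hH.mono fun e he => Γ.notMem_of_mem_block he
  have hHs : ∀ ε f, H (f ∘ Γ.swapPairs ε) = H f := fun ε f => hH _ _ fun e he => by
    rw [Function.comp_apply, Γ.swapPairs_of_ne]
    rintro j b t ht rfl
    exact he (Γ.notMem_of_mem_block (j := j) ⟨b, 0, t, ht, rfl⟩)
  let Q : ℕ → (Sym2 (Fin n) → Bool) → Prop := fun k f =>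
    H f ∧ ¬ m ≤ (Γ.typed (2 * K + 2) (2 * k) f).card
  let H' : (Sym2 (Fin n) → Bool) → Prop := fun f =>
    H f ∧ ∀ k ∈ Finset.Icc 1 K, m ≤ (Γ.typed (2 * K + 2) (2 * k) f).card
  have hsplit := bernProb_or_le (p := p) h0 h1
    (P := fun f => H f ∧ ∀ M r, DegreeBalanced (flipGraph G₀ f) M r x)
    (Q := fun f => ∃ k ∈ Finset.Icc 1 K, Q k f)
    (R := fun f => H' f ∧ ∀ k ∈ Finset.Icc 1 K,
      DegreeBalanced (flipGraph G₀ f) (2 * K + 2) (2 * k) x) (by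
      rintro f ⟨hf, hb⟩
      by_cases hQ : ∃ k ∈ Finset.Icc 1 K, Q k f
      · exact Or.inl hQ
      · push Not at hQ
        refine Or.inr ⟨⟨hf, fun k hk => ?_⟩, fun k _ => hb _ _⟩
        by_contra hk'
        exact hQ k hk ⟨hf, hk'⟩)
  have hfirst : bernProb p (fun f => ∃ k ∈ Finset.Icc 1 K, Q k f) ≤
      K * (2 ^ m * (1 - η ^ 4 / 2) ^ Fintype.card κ) * bernProb p H := by
    refine (bernProb_union_le h0 h1 (Finset.Icc 1 K) Q fun f hf => hf).trans ?_
    refine (Finset.sum_le_card_nsmul _ _ (2 ^ m * (1 - η ^ 4 / 2) ^ Fintype.card κ *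
      bernProb p H) fun k hk => ?_).trans_eq (by simp [mul_assoc])
    rw [Finset.mem_Icc] at hk
    exact Γ.bernProb_few_typed_le h0 h1 (pow_le_one₀ hη0 hη1)
      (fun j f => Γ.le_bernProb_hasType h0 h1 hη0 (by omega) hM hη j f) hHb m
  have hsecond := Γ.bernProb_balanced_le h0 h1 (K := K) (m := m) x hx (H := H') (fun ε f => by
    simp only [H', hHs, typed, hasType_swap]) (fun f hf => hf.2) K le_rfl
  have hH' : bernProb p H' ≤ bernProb p H := bernProb_mono h0 h1 fun f hf => hf.1
  have hc : 0 ≤ (1 / Real.sqrt (m + 1)) ^ K := by positivity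
  calc _ ≤ _ := hsplit
    _ ≤ K * (2 ^ m * (1 - η ^ 4 / 2) ^ Fintype.card κ) * bernProb p H +
        (1 / Real.sqrt (m + 1)) ^ K * bernProb p H :=
      add_le_add hfirst (hsecond.trans (mul_le_mul_of_nonneg_left hH' hc))
    _ = _ := by ring

end Gadgets

lemma two_pow_mul_one_sub_pow_add_le {η : ℝ} (hη0 : 0 < η) (hη1 : η ≤ 1) (K N : ℕ)
    (hN : 0 < N) :
    ((2 * K : ℕ) : ℝ) * (2 ^ ⌊η * N / 4⌋₊ * (1 - η / 2) ^ N) +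
      (1 / Real.sqrt ((⌊η * N / 4⌋₊ : ℕ) + 1)) ^ (2 * K) ≤
      (2 * K * K.factorial + 1) * (4 / (η * N)) ^ K := by
  have hN' : (0 : ℝ) < N := by exact_mod_cast hN
  set y : ℝ := η * N / 4 with hy
  have hy0 : 0 < y := by positivity
  have hfl : (⌊y⌋₊ : ℝ) ≤ y := Nat.floor_le hy0.le
  have hfl' : y ≤ ⌊y⌋₊ + 1 := (Nat.lt_floor_add_one y).le
  have e0 : 4 / (η * N) = 1 / y := by rw [hy]; field_simp
  have e1 : (1 / Real.sqrt ((⌊y⌋₊ : ℕ) + 1)) ^ (2 * K) ≤ (1 / y) ^ K := by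
    rw [pow_mul, div_pow, one_pow, Real.sq_sqrt (by positivity)]
    gcongr
  have e2 : (2 : ℝ) ^ ⌊y⌋₊ * (1 - η / 2) ^ N ≤ K.factorial * (1 / y) ^ K := by
    have a1 : (2 : ℝ) ^ ⌊y⌋₊ ≤ Real.exp y := by
      have : (2 : ℝ) ≤ Real.exp 1 := by linarith [Real.add_one_le_exp (1 : ℝ)]
      calc (2 : ℝ) ^ ⌊y⌋₊ ≤ Real.exp 1 ^ ⌊y⌋₊ := pow_le_pow_left₀ (by norm_num) this _
        _ = Real.exp ⌊y⌋₊ := by rw [← Real.exp_nat_mul, mul_one]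
        _ ≤ Real.exp y := Real.exp_le_exp.2 hfl
    have a2 : (1 - η / 2) ^ N ≤ Real.exp (-(2 * y)) := by
      calc (1 - η / 2) ^ N ≤ Real.exp (-(η / 2)) ^ N :=
            pow_le_pow_left₀ (by linarith) (Real.one_sub_le_exp_neg _) _
        _ = Real.exp (-(2 * y)) := by rw [← Real.exp_nat_mul]; congr 1; rw [hy]; ring
    have a3 := Real.pow_div_factorial_le_exp y hy0.le K
    have hK : (0 : ℝ) < K.factorial := by exact_mod_cast K.factorial_pos
    calc (2 : ℝ) ^ ⌊y⌋₊ * (1 - η / 2) ^ N ≤ Real.exp y * Real.exp (-(2 * y)) :=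
          mul_le_mul a1 a2 (pow_nonneg (by linarith) _) (Real.exp_nonneg _)
      _ = (Real.exp y)⁻¹ := by rw [← Real.exp_add, ← Real.exp_neg]; congr 1; ring
      _ ≤ (y ^ K / K.factorial)⁻¹ := by gcongr
      _ = _ := by rw [inv_div, one_div, inv_pow, div_eq_mul_inv]
  rw [e0]
  push_cast
  have e3 := mul_le_mul_of_nonneg_left e2 (by positivity : (0 : ℝ) ≤ 2 * K)
  linarith

/-- If the support of `x` outside `B` is large and only the pairs incident to `B` have been
revealed, then it is unlikely that `x` sums to zero on each set of vertices whose degrees have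
a given residue. -/
theorem exists_bernProb_forall_balanced_le (K : ℕ) : ∃ C : ℝ, 0 < C ∧ ∃ n₀ : ℕ, ∀ n ≥ n₀,
    ∀ p : ℝ, 1 / (4 * n) ≤ p → p ≤ 1 / 2 → ∀ (G₀ : SimpleGraph (Fin n)) (B : Finset (Fin n))
      (x : Fin n → ℤ) (L : ℕ), 0 < L → 4 * B.card ≤ n → 4 * L ≤ n →
      L ≤ (Finset.univ.filter (fun w => x w ≠ 0) \ B).card →
      ∀ H : (Sym2 (Fin n) → Bool) → Prop, Ignores {e | ∀ b ∈ B, b ∉ e} H →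
      bernProb p (fun f => H f ∧ ∀ M r, DegreeBalanced (flipGraph G₀ f) M r x) ≤
        C / L ^ K * bernProb p H := by
  set M : ℕ := 2 * (2 * K) + 2 with hM
  obtain ⟨η, hη0, hη1, hη⟩ := exists_binomial_lower_bound M (c := 1 / 288) (C := 2 * M + 1)
    (by norm_num)
  refine ⟨(2 * K * K.factorial + 1) * (20 / η ^ 4) ^ K, by positivity, 72 * M + 36,
    fun n hn p hp hp2 G₀ B x L hL hB hLn hLx H hH => ?_⟩
  have hn0 : (0 : ℝ) < n := by exact_mod_cast (show 0 < n by omega)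
  have hp0 : 0 < p := lt_of_lt_of_le (by positivity) hp
  have h1 : p ≤ 1 := by linarith
  have hPH := bernProb_nonneg hp0.le h1 H
  have hη4 : 0 < η ^ 4 := by positivity
  have hη4' : η ^ 4 ≤ 1 := pow_le_one₀ hη0.le hη1
  have hL0 : (0 : ℝ) < L := by exact_mod_cast hL
  have hCL : (2 * K * K.factorial + 1) * (20 / η ^ 4) ^ K / (L : ℝ) ^ K =
      (2 * K * K.factorial + 1) * (20 / (η ^ 4 * L)) ^ K := by
    rw [mul_div_assoc, ← div_pow, div_div]
  rw [hCL]
  by_cases hL3 : L < 3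
  · have hL3' : (L : ℝ) ≤ 3 := by exact_mod_cast hL3.le
    have a1 : 1 ≤ 20 / (η ^ 4 * L) := by
      rw [le_div_iff₀ (by positivity)]
      nlinarith
    have a2 : 1 ≤ (20 / (η ^ 4 * L)) ^ K := one_le_pow₀ a1
    have a3 : (1 : ℝ) ≤ 2 * K * K.factorial + 1 := by
      have : (0 : ℝ) ≤ 2 * K * K.factorial := by positivity
      linarith
    refine (bernProb_mono hp0.le h1 fun f hf => hf.1).trans ?_
    exact le_mul_of_one_le_left hPH (one_le_mul_of_one_le_of_one_le a3 a2)
  set N := L / 3 with hN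
  set ℓ := min (n / 36) ⌈2 * M / p⌉₊ with hℓ
  have hℓn : 36 * ℓ ≤ n := by
    have : ℓ ≤ n / 36 := min_le_left _ _
    omega
  obtain ⟨Γ, hΓ⟩ := exists_gadgets G₀ (B := B) (X := Finset.univ.filter (fun w => x w ≠ 0))
    (N := N) (ℓ := ℓ) (by omega) (by omega)
  have hceil : 2 * M / p ≤ ⌈2 * M / p⌉₊ := Nat.le_ceil _
  have hceil' : (⌈2 * M / p⌉₊ : ℝ) < 2 * M / p + 1 := Nat.ceil_lt_add_one (by positivity)
  have hℓM : 2 * M ≤ ℓ := by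
    refine le_min (by omega) ?_
    have : ((2 * M : ℕ) : ℝ) ≤ ⌈2 * M / p⌉₊ := by
      refine le_trans ?_ hceil
      rw [le_div_iff₀ hp0]
      push_cast
      have : (0 : ℝ) ≤ 2 * M := by positivity
      nlinarith
    exact_mod_cast this
  have hup : (ℓ : ℝ) * p ≤ 2 * M + 1 := by
    have : (ℓ : ℝ) ≤ ⌈2 * M / p⌉₊ := Nat.cast_le.2 (min_le_right _ _)
    calc (ℓ : ℝ) * p ≤ (2 * M / p + 1) * p := by gcongr; linarith
      _ = 2 * M + p := by field_simp
      _ ≤ _ := by linarith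
  have hlow : 1 / 288 ≤ (ℓ : ℝ) * p := by
    rcases min_choice (n / 36) ⌈2 * M / p⌉₊ with h | h
    · have h36 : n ≤ 72 * ℓ := by rw [hℓ, h]; omega
      have h36' : (n : ℝ) ≤ 72 * ℓ := by exact_mod_cast h36
      calc (1 : ℝ) / 288 = n / 72 * (1 / (4 * n)) := by field_simp; norm_num
        _ ≤ ℓ * p := by
          apply mul_le_mul _ hp (by positivity) (by positivity)
          linarith
    · rw [hℓ, h]
      have hM1 : (1 : ℝ) ≤ M := by exact_mod_cast (show 1 ≤ M by omega)
      calc (1 : ℝ) / 288 ≤ 2 * M / p * p := by rw [div_mul_cancel₀ _ hp0.ne']; linarith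
        _ ≤ _ := by gcongr
  have hfin := Γ.bernProb_forall_balanced_le hp0.le h1 hη0.le hη1 (2 * K) ⌊η ^ 4 * N / 4⌋₊
    (by omega) (hη ℓ hℓM p hp0.le hp2 hlow hup) x (fun j => (Finset.mem_filter.1 (hΓ j)).2) hH
  rw [Fintype.card_fin] at hfin
  refine hfin.trans (mul_le_mul_of_nonneg_right ?_ hPH)
  refine (two_pow_mul_one_sub_pow_add_le hη4 hη4' K N (by omega)).trans ?_
  have hNL : (L : ℝ) ≤ 5 * N := by exact_mod_cast (show L ≤ 5 * N by omega)
  have hN0 : (0 : ℝ) < N := by exact_mod_cast (show 0 < N by omega)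
  refine mul_le_mul_of_nonneg_left (pow_le_pow_left₀ (by positivity) ?_ K) (by positivity)
  rw [div_le_div_iff₀ (by positivity) (by positivity)]
  nlinarith

section Exploration

variable {n : ℕ} (G₀ : SimpleGraph (Fin n)) (u v : Fin n)

/-- The `i`-th difference vector of `u` and `v` in the perturbed graph. -/
noncomputable def layerVec (i : ℕ) (f : Sym2 (Fin n) → Bool) : Fin n → ℤ :=
  diffVec (flipGraph G₀ f) u v i

/-- The union of the supports of the first `i` difference vectors. -/
noncomputable def explored : ℕ → (Sym2 (Fin n) → Bool) → Finset (Fin n)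
  | 0, _ => ∅
  | i + 1, f => explored i f ∪ Finset.univ.filter fun w => layerVec G₀ u v i f w ≠ 0

/-- The vertices of the support of the `i`-th difference vector which were not explored before. -/
noncomputable def newLayer (i : ℕ) (f : Sym2 (Fin n) → Bool) : Finset (Fin n) :=
  (Finset.univ.filter fun w => layerVec G₀ u v i f w ≠ 0) \ explored G₀ u v i f

variable {G₀ u v}

lemma mem_newLayer {i : ℕ} {f : Sym2 (Fin n) → Bool} {w : Fin n} :
    w ∈ newLayer G₀ u v i f ↔ layerVec G₀ u v i f w ≠ 0 ∧ w ∉ explored G₀ u v i f := by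
  simp [newLayer]

lemma mem_explored_succ {i : ℕ} {f : Sym2 (Fin n) → Bool} {w : Fin n} :
    w ∈ explored G₀ u v (i + 1) f ↔ w ∈ explored G₀ u v i f ∨ layerVec G₀ u v i f w ≠ 0 := by
  simp [explored]

lemma mem_explored_succ_iff_newLayer {i : ℕ} {f : Sym2 (Fin n) → Bool} {w : Fin n} :
    w ∈ explored G₀ u v (i + 1) f ↔ w ∈ explored G₀ u v i f ∨ w ∈ newLayer G₀ u v i f := by
  rw [mem_explored_succ, mem_newLayer]
  tauto

lemma explored_mono {i j : ℕ} (hij : i ≤ j) (f : Sym2 (Fin n) → Bool) :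
    explored G₀ u v i f ⊆ explored G₀ u v j f := by
  induction j, hij using Nat.le_induction with
  | base => exact subset_rfl
  | succ j _ ih => exact ih.trans Finset.subset_union_left

lemma card_explored_succ_le (i : ℕ) (f : Sym2 (Fin n) → Bool) :
    (explored G₀ u v (i + 1) f).card ≤
      (explored G₀ u v i f).card + (newLayer G₀ u v i f).card := by
  refine (Finset.card_le_card fun w hw => ?_).trans (Finset.card_union_le _ _)
  rw [Finset.mem_union]
  exact mem_explored_succ_iff_newLayer.1 hw

lemma layerVec_zero (huv : u ≠ v) (f : Sym2 (Fin n) → Bool) (w : Fin n) :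
    layerVec G₀ u v 0 f w ≠ 0 ↔ w = u ∨ w = v := by
  simp only [layerVec, diffVec]
  by_cases h1 : w = u <;> by_cases h2 : w = v <;> simp_all

lemma mem_newLayer_zero (huv : u ≠ v) {f : Sym2 (Fin n) → Bool} {w : Fin n} :
    w ∈ newLayer G₀ u v 0 f ↔ w = u ∨ w = v := by
  rw [mem_newLayer, layerVec_zero huv]
  simp [explored]

lemma explored_one (huv : u ≠ v) (f : Sym2 (Fin n) → Bool) :
    explored G₀ u v 1 f = {u, v} := by
  ext w
  rw [mem_explored_succ_iff_newLayer, mem_newLayer_zero huv]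
  simp [explored]

open Classical in
lemma layerVec_succ (i : ℕ) (f : Sym2 (Fin n) → Bool) (w : Fin n) :
    layerVec G₀ u v (i + 1) f w =
      ∑ s, if (flipGraph G₀ f).Adj w s then layerVec G₀ u v i f s else 0 := rfl

/-- The exploration of the first `i` steps only depends on pairs incident to explored vertices. -/
lemma explored_layerVec_congr {i : ℕ} {f f' : Sym2 (Fin n) → Bool}
    (h : ∀ a ∈ explored G₀ u v i f, ∀ b, f s(b, a) = f' s(b, a)) :
    explored G₀ u v i f' = explored G₀ u v i f ∧
      layerVec G₀ u v i f' = layerVec G₀ u v i f := by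
  induction i with
  | zero => exact ⟨rfl, rfl⟩
  | succ i ih =>
    obtain ⟨h1, h2⟩ := ih fun a ha b => h a (explored_mono i.le_succ f ha) b
    refine ⟨by rw [explored, explored, h1, h2], ?_⟩
    classical
    funext w
    rw [layerVec_succ, layerVec_succ, h2]
    refine Finset.sum_congr rfl fun s _ => ?_
    by_cases hs : layerVec G₀ u v i f s = 0
    · simp [hs]
    · simp only [flipGraph_adj, h s (mem_explored_succ.2 (Or.inr hs)) w]

lemma ignores_explored_layerVec (i : ℕ) (B : Finset (Fin n)) (x : Fin n → ℤ) :
    Ignores {e | ∀ b ∈ B, b ∉ e} fun f =>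
      (explored G₀ u v i f, layerVec G₀ u v i f) = (B, x) := by
  have key : ∀ f f' : Sym2 (Fin n) → Bool,
      (∀ e, e ∉ {e : Sym2 (Fin n) | ∀ b ∈ B, b ∉ e} → f e = f' e) →
      (explored G₀ u v i f, layerVec G₀ u v i f) = (B, x) →
      (explored G₀ u v i f', layerVec G₀ u v i f') = (B, x) := by
    intro f f' hff hf
    rw [Prod.mk.injEq] at hf ⊢
    obtain ⟨h1, h2⟩ := explored_layerVec_congr (f := f) (f' := f') fun a ha b =>
      hff _ fun h => h a (hf.1 ▸ ha) (Sym2.mem_mk_right b a)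
    exact ⟨h1.trans hf.1, h2.trans hf.2⟩
  intro f f' hff
  exact propext ⟨key f f' hff, key f' f fun e he => (hff e he).symm⟩

end Exploration

lemma bernProb_eq_sum_range {ι : Type*} [Fintype ι] (p : ℝ) {κ : Type*} (Y : (ι → Bool) → κ)
    [Fintype (Set.range Y)] (P : (ι → Bool) → Prop) :
    bernProb p P = ∑ k : Set.range Y, bernProb p (fun f => Y f = k ∧ P f) := by
  rw [bernProb_eq_sum_fiber p (Set.rangeFactorization Y)]
  refine Finset.sum_congr rfl fun k _ => ?_
  congr 1
  funext f
  rw [Subtype.ext_iff, Set.rangeFactorization_coe]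

theorem exists_bernProb_newLayer_le (K : ℕ) : ∃ C : ℝ, 0 < C ∧ ∃ n₀ : ℕ, ∀ n ≥ n₀,
    ∀ p : ℝ, 1 / (4 * n) ≤ p → p ≤ 1 / 2 → ∀ (G₀ : SimpleGraph (Fin n)) (u v : Fin n)
      (i L : ℕ), 0 < L → 4 * L ≤ n →
      bernProb p (fun f => crStableTrivial (flipGraph G₀ f) u v ∧
        4 * (explored G₀ u v i f).card ≤ n ∧ L ≤ (newLayer G₀ u v i f).card) ≤ C / L ^ K := by
  classical
  obtain ⟨C, hC, n₀, h⟩ := exists_bernProb_forall_balanced_le K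
  refine ⟨C, hC, n₀ + 1, fun n hn p hp hp2 G₀ u v i L hL hLn => ?_⟩
  have h0 : 0 ≤ p := le_trans (by positivity) hp
  have h1 : p ≤ 1 := by linarith
  let Y : (Sym2 (Fin n) → Bool) → Finset (Fin n) × (Fin n → ℤ) := fun f =>
    (explored G₀ u v i f, layerVec G₀ u v i f)
  have hCL : 0 ≤ C / (L : ℝ) ^ K := by positivity
  have hY : ∑ k : Set.range Y, bernProb p (fun f => Y f = k) = 1 := by
    rw [← bernProb_true (ι := Sym2 (Fin n)) p, bernProb_eq_sum_range p Y]
    simp only [and_true]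
  rw [bernProb_eq_sum_range p Y, ← mul_one (C / (L : ℝ) ^ K), ← hY, Finset.mul_sum]
  refine Finset.sum_le_sum fun k _ => ?_
  obtain ⟨⟨B, x⟩, hk⟩ := k
  by_cases hB : 4 * B.card ≤ n ∧ L ≤ (Finset.univ.filter (fun w => x w ≠ 0) \ B).card
  · refine le_trans (bernProb_mono h0 h1 ?_) (h n (by omega) p hp hp2 G₀ B x L hL hB.1 hLn hB.2
      (fun f => Y f = (B, x)) (ignores_explored_layerVec i B x))
    rintro f ⟨hf, hst, -⟩
    refine ⟨hf, fun M r => ?_⟩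
    have := sum_diffVec_ncDegree hst i M r
    rw [← (Prod.mk.inj hf).2]
    exact this
  · refine le_trans (le_of_eq ?_) (mul_nonneg hCL (bernProb_nonneg h0 h1 _))
    rw [← bernProb_false (ι := Sym2 (Fin n)) p]
    congr 1
    funext f
    rw [eq_iff_iff, iff_false]
    rintro ⟨hf, -, h2, h3⟩
    obtain ⟨h4, h5⟩ := Prod.mk.inj hf
    exact hB ⟨h4 ▸ h2, by rw [newLayer, h4, h5] at h3; exact h3⟩

section DenseRegime

variable {n : ℕ} {G₀ : SimpleGraph (Fin n)} {u v : Fin n}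

lemma layerVec_one_ne_zero_iff (f : Sym2 (Fin n) → Bool) {w : Fin n} (hu : w ≠ u)
    (hv : w ≠ v) : layerVec G₀ u v 1 f w ≠ 0 ↔
      (f s(w, u) = true ↔ ¬ ((G₀.Adj w u ↔ G₀.Adj w v) ↔ f s(w, v) = true)) := by
  classical
  have h : layerVec G₀ u v 1 f w = (if (flipGraph G₀ f).Adj w u then 1 else 0) -
      if (flipGraph G₀ f).Adj w v then 1 else 0 := by
    rw [layerVec_succ]
    have : ∀ s, (if (flipGraph G₀ f).Adj w s then layerVec G₀ u v 0 f s else 0) =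
        (if s = u then (if (flipGraph G₀ f).Adj w s then 1 else 0) else 0) -
          if s = v then (if (flipGraph G₀ f).Adj w s then 1 else 0) else 0 := by
      intro s
      simp only [layerVec, diffVec]
      split_ifs <;> simp
    rw [Finset.sum_congr rfl fun s _ => this s, Finset.sum_sub_distrib]
    simp
  rw [h]
  simp only [flipGraph_adj, ne_eq, hu, hv, not_false_eq_true, true_and]
  by_cases h1 : G₀.Adj w u <;> by_cases h2 : G₀.Adj w v <;> by_cases h3 : f s(w, u) = true <;>
    by_cases h4 : f s(w, v) = true <;> simp [h1, h2, h3, h4]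

lemma le_bernProb_layerVec_one {p : ℝ} (hp2 : p ≤ 1 / 2) (huv : u ≠ v)
    (f : Sym2 (Fin n) → Bool) {w : Fin n} (hu : w ≠ u) (hv : w ≠ v) :
    p ≤ bernProb p fun g => layerVec G₀ u v 1 (splice {s(w, u)} g f) w ≠ 0 := by
  have hne : s(w, v) ∉ ({s(w, u)} : Set (Sym2 (Fin n))) := by
    rw [Set.mem_singleton_iff, Sym2.congr_right]
    exact huv.symm
  simp only [layerVec_one_ne_zero_iff _ hu hv, splice_mem (Set.mem_singleton s(w, u)),
    splice_notMem hne]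
  by_cases h : ¬ ((G₀.Adj w u ↔ G₀.Adj w v) ↔ f s(w, v) = true)
  · simp only [h, not_false_eq_true, iff_true]
    exact (bernProb_coord p _).ge
  · simp only [h, iff_false]
    rw [bernProb_compl, bernProb_coord]
    linarith

/-- It is unlikely that the first layer is small if the density is large. -/
lemma bernProb_card_newLayer_one_lt_le {p : ℝ} (h0 : 0 ≤ p) (hp2 : p ≤ 1 / 2) (huv : u ≠ v)
    (L : ℕ) : bernProb p (fun f => (newLayer G₀ u v 1 f).card < L) ≤
      2 ^ L * (1 - p / 2) ^ (n - 2) := by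
  classical
  have h1 : p ≤ 1 := by linarith
  set S : Finset (Fin n) := Finset.univ \ {u, v} with hS
  have hSc : S.card = n - 2 := by
    rw [hS, Finset.card_sdiff_of_subset (Finset.subset_univ _), Finset.card_pair huv,
      Finset.card_univ, Fintype.card_fin]
  have hmem : ∀ w ∈ S, w ≠ u ∧ w ≠ v := fun w hw => by simpa [hS] using hw
  have h2 := bernExp_mul_prod_le h0 h1 S (B := fun w => {s(w, u)}) (H := fun _ => 1)
    (φ := fun w f => 1 - (if layerVec G₀ u v 1 f w ≠ 0 then 1 else 0) / 2) (c := 1 - p / 2)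
    (by linarith) (fun f => zero_le_one) (fun j _ f f' hf => rfl)
    (fun j f => by split_ifs <;> norm_num)
    (fun j hj j' hj' hjj f f' hf => by
      have hu := hmem j hj
      have hu' := hmem j' hj'
      have e1 : f s(j', u) = f' s(j', u) := hf _ fun h => hjj (Sym2.congr_left.1 h).symm
      have e2 : f s(j', v) = f' s(j', v) := hf _ fun h => by
        rcases Sym2.eq_iff.1 h with ⟨-, h⟩ | ⟨h, -⟩
        · exact huv h.symm
        · exact hu'.1 h
      simp only [layerVec_one_ne_zero_iff _ hu'.1 hu'.2, e1, e2])
    (fun j hj f => by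
      have h3 := le_bernProb_layerVec_one (G₀ := G₀) hp2 huv f (hmem j hj).1 (hmem j hj).2
      rw [bernProb_eq] at h3
      have h4 : bernExp p (fun g => 1 - (if layerVec G₀ u v 1 (splice {s(j, u)} g f) j ≠ 0
          then (1 : ℝ) else 0) / 2) = bernExp p (fun _ : Sym2 (Fin n) → Bool => (1 : ℝ)) - 1 / 2 *
          bernExp p (fun g => if layerVec G₀ u v 1 (splice {s(j, u)} g f) j ≠ 0
            then (1 : ℝ) else 0) := by
        rw [← bernExp_const_mul]
        simp only [bernExp_def, ← Finset.sum_sub_distrib]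
        exact Finset.sum_congr rfl fun g _ => by ring
      rw [h4, bernExp_one]
      linarith)
  rw [hSc, bernExp_one, mul_one] at h2
  refine le_trans ?_ (mul_le_mul_of_nonneg_left h2 (by positivity))
  rw [← bernExp_const_mul, bernProb_eq]
  refine bernExp_mono h0 h1 fun f => ?_
  have hnew : newLayer G₀ u v 1 f = S.filter fun w => layerVec G₀ u v 1 f w ≠ 0 := by
    ext w
    rw [mem_newLayer, explored_one huv]
    simp [hS, and_comm]
  have hprod : ∏ w ∈ S, (1 - (if layerVec G₀ u v 1 f w ≠ 0 then (1 : ℝ) else 0) / 2) =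
      (1 / 2) ^ (newLayer G₀ u v 1 f).card := by
    rw [hnew, ← Finset.prod_const, Finset.prod_filter]
    exact Finset.prod_congr rfl fun j _ => by split_ifs <;> norm_num
  rw [hprod]
  split_ifs with hf
  · rw [one_mul, one_div, inv_pow, ← div_eq_mul_inv, le_div_iff₀ (by positivity), one_mul]
    exact pow_le_pow_right₀ (by norm_num) hf.le
  · positivity

end DenseRegime

section Degrees

variable {n : ℕ}

/-- Exponential tail bound for the number of marked pairs at a vertex. -/
lemma bernProb_markCount_ge_le {p : ℝ} (h0 : 0 ≤ p) (h1 : p ≤ 1) (a : Fin n)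
    (S : Finset (Fin n)) (m : ℕ) :
    bernProb p (fun f => m ≤ markCount f a S) ≤ (1 + p) ^ S.card / 2 ^ m := by
  classical
  have h2 := bernExp_mul_prod_le h0 h1 S (B := fun t => {s(a, t)}) (H := fun _ => 1)
    (φ := fun t f => 1 + (if f s(a, t) = true then 1 else 0)) (c := 1 + p)
    (by linarith) (fun f => zero_le_one) (fun j _ f f' hf => rfl)
    (fun j f => by split_ifs <;> norm_num)
    (fun j _ j' _ hjj f f' hf => by
      simp only [hf s(a, j') fun h => hjj (Sym2.congr_right.1 h).symm])
    (fun j _ f => by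
      simp only [splice_mem (Set.mem_singleton s(a, j))]
      have h3 := bernProb_coord p s(a, j)
      rw [bernProb_eq] at h3
      have h4 : bernExp p (fun g => 1 + (if g s(a, j) = true then (1 : ℝ) else 0)) =
          bernExp p (fun _ : Sym2 (Fin n) → Bool => (1 : ℝ)) +
            bernExp p (fun g => if g s(a, j) = true then (1 : ℝ) else 0) := by
        simp only [bernExp_def, ← Finset.sum_add_distrib]
        exact Finset.sum_congr rfl fun g _ => by ring
      rw [h4, bernExp_one, h3])
  rw [bernExp_one, mul_one] at h2
  rw [le_div_iff₀ (by positivity), mul_comm]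
  refine le_trans ?_ h2
  rw [bernProb_eq, ← bernExp_const_mul]
  refine bernExp_mono h0 h1 fun f => ?_
  have hprod : ∏ t ∈ S, (1 + (if f s(a, t) = true then (1 : ℝ) else 0)) =
      2 ^ markCount f a S := by
    rw [markCount, ← Finset.prod_const, Finset.prod_filter]
    exact Finset.prod_congr rfl fun j _ => by split_ifs <;> norm_num
  rw [hprod, one_mul]
  split_ifs with hf
  · rw [mul_one]
    exact pow_le_pow_right₀ (by norm_num) hf
  · rw [mul_zero]
    positivity

end Degrees

section Hits

variable {ι κ : Type*} [Fintype ι] [Fintype κ]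

lemma sum_bernProb_and_coord_le {p N : ℝ} (h0 : 0 ≤ p) (h1 : p ≤ 1) (cand : κ → (ι → Bool) → Prop)
    [∀ f, DecidablePred fun k => cand k f] (e : κ → ι)
    (hN : ∀ f, ((Finset.univ.filter fun k => cand k f).card : ℝ) ≤ N)
    {Q : κ → (ι → Bool) → Prop} {Q' : (ι → Bool) → Prop} (hQ : ∀ k f, Q k f → Q' f)
    (hI : ∀ k, Ignores {e k} fun f => Q k f ∧ cand k f) :
    ∑ k, bernProb p (fun f => (Q k f ∧ cand k f) ∧ f (e k) = true) ≤ p * N * bernProb p Q' := by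
  classical
  have h2 : ∑ k, bernProb p (fun f => Q' f ∧ cand k f) ≤ N * bernProb p Q' := by
    rw [bernProb_eq p Q', ← bernExp_const_mul]
    simp only [bernProb_eq]
    rw [← bernExp_sum]
    refine bernExp_mono h0 h1 fun f => ?_
    by_cases hf : Q' f
    · simpa [hf] using hN f
    · simp [hf]
  calc ∑ k, bernProb p (fun f => (Q k f ∧ cand k f) ∧ f (e k) = true)
      ≤ ∑ k, p * bernProb p (fun f => Q' f ∧ cand k f) :=
        Finset.sum_le_sum fun k _ => (bernProb_and_coord_le h0 h1 (hI k)).trans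
          (mul_le_mul_of_nonneg_left (bernProb_mono h0 h1 fun f hf => ⟨hQ k f hf.1, hf.2⟩) h0)
    _ = p * ∑ k, bernProb p (fun f => Q' f ∧ cand k f) := by rw [Finset.mul_sum]
    _ ≤ p * (N * bernProb p Q') := mul_le_mul_of_nonneg_left h2 h0
    _ = _ := by ring

/-- If candidates are chosen adaptively and each coordinate is queried at most once, it is
unlikely that three of the queried coordinates are `true`. -/
lemma bernProb_three_le_card_hits_le {ο : Type*} [LinearOrder ο] {p N : ℝ} (h0 : 0 ≤ p)
    (h1 : p ≤ 1) (ρ : κ → ο) (hρ : Function.Injective ρ) (cand : κ → (ι → Bool) → Prop)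
    [∀ f, DecidablePred fun k => cand k f] (e : κ → ι)
    (hN : ∀ f, ((Finset.univ.filter fun k => cand k f).card : ℝ) ≤ N) (hN0 : 0 ≤ N)
    (hcand : ∀ k f f', (∀ i, i ≠ e k → f i = f' i) → cand k f → cand k f' ∧
      ∀ k', ρ k' < ρ k → cand k' f ∧ f (e k') = true → cand k' f' ∧ f' (e k') = true) :
    bernProb p (fun f => 3 ≤ (Finset.univ.filter fun k => cand k f ∧ f (e k) = true).card) ≤
      (p * N) ^ 3 := by
  classical
  let hit : κ → (ι → Bool) → Prop := fun k f => cand k f ∧ f (e k) = true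
  have hpN : 0 ≤ p * N := mul_nonneg h0 hN0
  have hIgn : ∀ (k : κ) (Q : (ι → Bool) → Prop),
      (∀ f f', (∀ i, i ≠ e k → f i = f' i) → cand k f → Q f → Q f') →
      Ignores {e k} fun f => Q f ∧ cand k f := by
    intro k Q hQ f f' hff
    have hff' : ∀ i, i ≠ e k → f i = f' i := fun i hi => hff i hi
    refine propext ⟨fun h => ⟨hQ f f' hff' h.2 h.1, (hcand k f f' hff' h.2).1⟩,
      fun h => ⟨hQ f' f (fun i hi => (hff' i hi).symm) h.2 h.1,
        (hcand k f' f (fun i hi => (hff' i hi).symm) h.2).1⟩⟩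
  have s1 : ∑ k, bernProb p (hit k) ≤ p * N := by
    have := sum_bernProb_and_coord_le h0 h1 cand e hN (Q := fun _ _ => True)
      (Q' := fun _ => True) (fun _ _ h => h) fun k => hIgn k _ fun _ _ _ _ h => h
    simpa only [true_and, bernProb_true, mul_one] using this
  have s2 : ∀ k₁, ∑ k₂, bernProb p (fun f => ((ρ k₁ < ρ k₂ ∧ hit k₁ f) ∧ cand k₂ f) ∧
      f (e k₂) = true) ≤ p * N * bernProb p (hit k₁) := fun k₁ =>
    sum_bernProb_and_coord_le h0 h1 cand e hN (fun k f h => h.2) fun k => hIgn k _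
      fun f f' hff hc h => ⟨h.1, (hcand k f f' hff hc).2 k₁ h.1 h.2⟩
  have s3 : ∀ k₁ k₂, ∑ k₃, bernProb p (fun f => ((ρ k₂ < ρ k₃ ∧ ((ρ k₁ < ρ k₂ ∧ hit k₁ f) ∧
      cand k₂ f) ∧ f (e k₂) = true) ∧ cand k₃ f) ∧ f (e k₃) = true) ≤
      p * N * bernProb p (fun f => ((ρ k₁ < ρ k₂ ∧ hit k₁ f) ∧ cand k₂ f) ∧ f (e k₂) = true) :=
    fun k₁ k₂ => sum_bernProb_and_coord_le h0 h1 cand e hN (fun k f h => h.2) fun k => hIgn k _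
      fun f f' hff hc h => by
        obtain ⟨h23, ⟨⟨h12, hh1⟩, hc2⟩, hf2⟩ := h
        have a1 := (hcand k f f' hff hc).2 k₁ (h12.trans h23) hh1
        have a2 := (hcand k f f' hff hc).2 k₂ h23 ⟨hc2, hf2⟩
        exact ⟨h23, ⟨⟨h12, a1⟩, a2.1⟩, a2.2⟩
  calc bernProb p (fun f => 3 ≤ (Finset.univ.filter fun k => cand k f ∧ f (e k) = true).card)
      ≤ ∑ k₁, ∑ k₂, ∑ k₃, bernProb p (fun f => ((ρ k₂ < ρ k₃ ∧ ((ρ k₁ < ρ k₂ ∧ hit k₁ f) ∧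
      cand k₂ f) ∧ f (e k₂) = true) ∧ cand k₃ f) ∧ f (e k₃) = true) := by
        simp only [← Fintype.sum_prod_type']
        refine bernProb_union_le h0 h1 Finset.univ (fun (x : κ × κ × κ) f =>
          ((ρ x.2.1 < ρ x.2.2 ∧ ((ρ x.1 < ρ x.2.1 ∧ hit x.1 f) ∧
            cand x.2.1 f) ∧ f (e x.2.1) = true) ∧ cand x.2.2 f) ∧ f (e x.2.2) = true) fun f hf => ?_
        set S := Finset.univ.filter fun k => cand k f ∧ f (e k) = true with hS
        obtain ⟨S', hS', hc⟩ := Finset.exists_subset_card_eq hf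
        have hc' : (S'.image ρ).card = 3 := by rw [Finset.card_image_of_injective _ hρ, hc]
        have hk : ∀ i, ∃ k, hit k f ∧ ρ k = (S'.image ρ).orderEmbOfFin hc' i := fun i => by
          obtain ⟨k, hk, hk'⟩ := Finset.mem_image.1 (Finset.orderEmbOfFin_mem (S'.image ρ) hc' i)
          exact ⟨k, (Finset.mem_filter.1 (hS' hk)).2, hk'⟩
        choose k hk hk' using hk
        have hlt : ∀ i j, i < j → ρ (k i) < ρ (k j) := fun i j hij => by
          rw [hk', hk']
          exact ((S'.image ρ).orderEmbOfFin hc').strictMono hij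
        exact ⟨(k 0, k 1, k 2), Finset.mem_univ _, ⟨⟨hlt 1 2 (by decide),
          ⟨⟨hlt 0 1 (by decide), hk 0⟩, (hk 1).1⟩, (hk 1).2⟩, (hk 2).1⟩, (hk 2).2⟩
    _ ≤ ∑ k₁, ∑ k₂, p * N * bernProb p (fun f => ((ρ k₁ < ρ k₂ ∧ hit k₁ f) ∧ cand k₂ f) ∧
        f (e k₂) = true) :=
        Finset.sum_le_sum fun k₁ _ => Finset.sum_le_sum fun k₂ _ => s3 k₁ k₂
    _ ≤ ∑ k₁, p * N * (p * N * bernProb p (hit k₁)) := by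
        refine Finset.sum_le_sum fun k₁ _ => ?_
        rw [← Finset.mul_sum]
        exact mul_le_mul_of_nonneg_left (s2 k₁) hpN
    _ = (p * N) * ((p * N) * ∑ k₁, bernProb p (hit k₁)) := by simp only [Finset.mul_sum]
    _ ≤ (p * N) * ((p * N) * (p * N)) := by gcongr
    _ = _ := by ring

end Hits

section Coincidences

variable {n : ℕ} (G₀ : SimpleGraph (Fin n)) (u v : Fin n)

/-- The vertices whose pairs have been revealed when the pairs of `s` are queried in step `i`. -/
noncomputable def revealed (i : ℕ) (s : Fin n) (f : Sym2 (Fin n) → Bool) : Finset (Fin n) :=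
  explored G₀ u v i f ∪ (newLayer G₀ u v i f).filter fun s' => s' < s

open Classical in
/-- The prediction of the next difference vector from the unperturbed graph. -/
noncomputable def predicted (i : ℕ) (f : Sym2 (Fin n) → Bool) (z : Fin n) : ℤ :=
  ∑ s, if G₀.Adj z s then layerVec G₀ u v i f s else 0

/-- The vertices whose adjacency to `s` would be a coincidence in step `i`. -/
noncomputable def suspects (i : ℕ) (s : Fin n) (f : Sym2 (Fin n) → Bool) : Finset (Fin n) :=
  Finset.univ.filter fun z => (z ∉ revealed G₀ u v i s f ∧ z ≠ s) ∧
    (z ∈ newLayer G₀ u v i f ∨ predicted G₀ u v i f z ≠ 0 ∨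
      ∃ a ∈ revealed G₀ u v i s f, f s(z, a) = true)

variable {G₀ u v}

lemma mem_revealed {i : ℕ} {s w : Fin n} {f : Sym2 (Fin n) → Bool} :
    w ∈ revealed G₀ u v i s f ↔
      w ∈ explored G₀ u v i f ∨ w ∈ newLayer G₀ u v i f ∧ w < s := by
  simp [revealed]

lemma mem_suspects {i : ℕ} {s z : Fin n} {f : Sym2 (Fin n) → Bool} :
    z ∈ suspects G₀ u v i s f ↔ (z ∉ revealed G₀ u v i s f ∧ z ≠ s) ∧
      (z ∈ newLayer G₀ u v i f ∨ predicted G₀ u v i f z ≠ 0 ∨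
        ∃ a ∈ revealed G₀ u v i s f, f s(z, a) = true) := by
  simp [suspects]

lemma revealed_congr {i : ℕ} {s : Fin n} {f f' : Sym2 (Fin n) → Bool}
    (h : ∀ a ∈ revealed G₀ u v i s f, ∀ b, f s(b, a) = f' s(b, a)) :
    newLayer G₀ u v i f' = newLayer G₀ u v i f ∧
      revealed G₀ u v i s f' = revealed G₀ u v i s f ∧
      suspects G₀ u v i s f' = suspects G₀ u v i s f := by
  obtain ⟨h1, h2⟩ := explored_layerVec_congr (f := f) (f' := f') fun a ha b =>
    h a (mem_revealed.2 (Or.inl ha)) b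
  have h3 : newLayer G₀ u v i f' = newLayer G₀ u v i f := by rw [newLayer, newLayer, h1, h2]
  have h4 : revealed G₀ u v i s f' = revealed G₀ u v i s f := by rw [revealed, revealed, h1, h3]
  refine ⟨h3, h4, ?_⟩
  ext z
  rw [mem_suspects, mem_suspects, h3, h4, predicted, predicted, h2]
  refine and_congr_right fun _ => or_congr_right (or_congr_right (exists_congr fun a => ?_))
  exact and_congr_right fun ha => by rw [h a ha z]

lemma revealed_subset_of_lt {i j : ℕ} (hij : i < j) (s t : Fin n) (f : Sym2 (Fin n) → Bool) :
    revealed G₀ u v i s f ⊆ revealed G₀ u v j t f := by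
  intro w hw
  refine mem_revealed.2 (Or.inl (explored_mono hij f ?_))
  exact mem_explored_succ_iff_newLayer.2 ((mem_revealed.1 hw).imp id And.left)

lemma revealed_subset_of_le (i : ℕ) {s t : Fin n} (hst : s ≤ t) (f : Sym2 (Fin n) → Bool) :
    revealed G₀ u v i s f ⊆ revealed G₀ u v i t f := fun _ hw =>
  mem_revealed.2 ((mem_revealed.1 hw).imp id fun h => ⟨h.1, h.2.trans_le hst⟩)

variable (G₀ u v)

/-- The pair `s, z` is a potential coincidence in step `i`, and neither the layer nor the set
of suspects is too large. -/
def Candidate (m m' : ℕ) (k : ℕ × Fin n × Fin n) (f : Sym2 (Fin n) → Bool) : Prop :=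
  k.2.1 ∈ newLayer G₀ u v k.1 f ∧ (newLayer G₀ u v k.1 f).card ≤ m ∧
    (suspects G₀ u v k.1 k.2.1 f).card ≤ m' ∧ k.2.2 ∈ suspects G₀ u v k.1 k.2.1 f

variable {G₀ u v}

lemma Candidate.congr {m m' : ℕ} {k : ℕ × Fin n × Fin n} {f f' : Sym2 (Fin n) → Bool}
    (h : ∀ a ∈ revealed G₀ u v k.1 k.2.1 f, ∀ b, f s(b, a) = f' s(b, a))
    (hc : Candidate G₀ u v m m' k f) : Candidate G₀ u v m m' k f' := by
  obtain ⟨h1, -, h3⟩ := revealed_congr h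
  unfold Candidate at hc ⊢
  rwa [h1, h3]

lemma Candidate.agree {m m' : ℕ} {k : ℕ × Fin n × Fin n} {f f' : Sym2 (Fin n) → Bool}
    (hc : Candidate G₀ u v m m' k f) (hff : ∀ e, e ≠ s(k.2.1, k.2.2) → f e = f' e) :
    ∀ a ∈ revealed G₀ u v k.1 k.2.1 f, ∀ b, f s(b, a) = f' s(b, a) := by
  intro a ha b
  refine hff _ fun h => ?_
  rcases Sym2.eq_iff.1 h with ⟨-, h⟩ | ⟨-, h⟩
  · exact (mem_suspects.1 hc.2.2.2).1.1 (h ▸ ha)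
  · rcases mem_revealed.1 (h ▸ ha) with h' | h'
    · exact (mem_newLayer.1 hc.1).2 h'
    · exact lt_irrefl _ h'.2

open Classical in
lemma card_candidate_le (I m m' : ℕ) (f : Sym2 (Fin n) → Bool) :
    (Finset.univ.filter fun k : Fin I × Fin n × Fin n =>
      Candidate G₀ u v m m' (k.1, k.2) f).card ≤ I * (m * m') := by
  have h1 : ∀ i : Fin I, (Finset.univ.filter fun x : Fin n × Fin n =>
      Candidate G₀ u v m m' (i, x) f).card ≤ m * m' := by
    intro i
    by_cases hm : (newLayer G₀ u v i f).card ≤ m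
    · refine le_trans ?_ (Nat.mul_le_mul_right m' hm)
      refine Finset.card_le_mul_card_image_of_maps_to
        (s := Finset.univ.filter fun x : Fin n × Fin n => Candidate G₀ u v m m' (i, x) f)
        (f := Prod.fst) (t := newLayer G₀ u v i f) (n := m')
        (fun x hx => (Finset.mem_filter.1 hx).2.1) (fun s _ => ?_) |>.trans_eq (mul_comm _ _)
      by_cases hs : (suspects G₀ u v i s f).card ≤ m'
      · refine le_trans (Finset.card_le_card_of_injOn Prod.snd ?_ ?_) hs
        · intro x hx
          obtain ⟨hx1, rfl⟩ := Finset.mem_filter.1 hx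
          exact (Finset.mem_filter.1 hx1).2.2.2.2
        · intro x hx y hy hxy
          exact Prod.ext ((Finset.mem_filter.1 hx).2.trans (Finset.mem_filter.1 hy).2.symm) hxy
      · rw [Finset.card_eq_zero.2]
        · exact Nat.zero_le _
        · refine Finset.filter_eq_empty_iff.2 fun x hx hxs => hs ?_
          rw [← hxs]
          exact (Finset.mem_filter.1 hx).2.2.2.1
    · rw [Finset.card_eq_zero.2]
      · exact Nat.zero_le _
      · exact Finset.filter_eq_empty_iff.2 fun x _ hx => hm hx.2.1
  rw [← Finset.univ_product_univ, Finset.card_filter, Finset.sum_product]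
  simp only [← Finset.card_filter]
  refine (Finset.sum_le_card_nsmul _ _ _ fun i _ => h1 i).trans_eq ?_
  simp

open Classical in
lemma bernProb_three_le_card_coincidences_le {p : ℝ} (h0 : 0 ≤ p) (h1 : p ≤ 1) (I m m' : ℕ) :
    bernProb p (fun f => 3 ≤ (Finset.univ.filter fun k : Fin I × Fin n × Fin n =>
      Candidate G₀ u v m m' (k.1, k.2) f ∧ f s(k.2.1, k.2.2) = true).card) ≤
      (p * (I * (m * m') : ℕ)) ^ 3 := by
  refine bernProb_three_le_card_hits_le h0 h1
    (fun k : Fin I × Fin n × Fin n => toLex (k.1, toLex k.2)) (fun k k' h => ?_)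
    (fun k f => Candidate G₀ u v m m' (k.1, k.2) f) (fun k => s(k.2.1, k.2.2))
    (fun f => by exact_mod_cast card_candidate_le I m m' f) (by positivity) ?_
  · obtain ⟨h2, h3⟩ := Prod.mk.inj (toLex.injective h)
    exact Prod.ext h2 (toLex.injective h3)
  · rintro ⟨i, s, z⟩ f f' hff hc
    have hag := hc.agree hff
    refine ⟨hc.congr hag, ?_⟩
    rintro ⟨i', s', z'⟩ hlt ⟨hc', hf'⟩
    simp only [Prod.Lex.toLex_lt_toLex] at hlt hc' hf' hag ⊢
    have hsub : revealed G₀ u v i' s' f ⊆ revealed G₀ u v i s f := by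
      rcases hlt with hlt | ⟨rfl, hlt | ⟨rfl, -⟩⟩
      · exact revealed_subset_of_lt hlt _ _ f
      · exact revealed_subset_of_le _ hlt.le f
      · exact subset_rfl
    refine ⟨hc'.congr fun a ha b => hag a (hsub ha) b, ?_⟩
    rw [← hf']
    symm
    rcases hlt with hlt | ⟨rfl, hlt | ⟨rfl, hlt⟩⟩
    · rw [Sym2.eq_swap]
      refine hag s' ?_ z'
      refine mem_revealed.2 (Or.inl (explored_mono (Nat.succ_le_of_lt hlt) f ?_))
      exact mem_explored_succ_iff_newLayer.2 (Or.inr hc'.1)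
    · rw [Sym2.eq_swap]
      exact hag s' (mem_revealed.2 (Or.inr ⟨hc'.1, hlt⟩)) z'
    · exact hff _ fun h => hlt.ne (Sym2.congr_right.1 h)

end Coincidences

section Growth

variable {n : ℕ} (G₀ : SimpleGraph (Fin n)) (u v : Fin n)

/-- The marked pairs in step `i` which are coincidences. -/
noncomputable def coincidences (i : ℕ) (f : Sym2 (Fin n) → Bool) : Finset (Fin n × Fin n) :=
  Finset.univ.filter fun x => (x.1 ∈ newLayer G₀ u v i f ∧ x.2 ∈ suspects G₀ u v i x.1 f) ∧
    f s(x.1, x.2) = true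

/-- The vertices of `S` in the `i`-th layer with at most one marked pair towards the past. -/
noncomputable def goodSet (S : Finset (Fin n)) (i : ℕ) (f : Sym2 (Fin n) → Bool) :
    Finset (Fin n) :=
  (newLayer G₀ u v i f ∩ S).filter fun s => markCount f s (explored G₀ u v i f) ≤ 1

variable {G₀ u v}

lemma mem_coincidences {i : ℕ} {f : Sym2 (Fin n) → Bool} {s z : Fin n} :
    (s, z) ∈ coincidences G₀ u v i f ↔
      (s ∈ newLayer G₀ u v i f ∧ z ∈ suspects G₀ u v i s f) ∧ f s(s, z) = true := by
  simp [coincidences]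

lemma revealed_subset_explored_succ (i : ℕ) (s : Fin n) (f : Sym2 (Fin n) → Bool) :
    revealed G₀ u v i s f ⊆ explored G₀ u v (i + 1) f := fun _ hw =>
  mem_explored_succ_iff_newLayer.2 ((mem_revealed.1 hw).imp id And.left)

/-- A marked pair leaving the `i`-th layer causes a coincidence or finds a new vertex of the next
layer. -/
lemma coincidence_or_mem_newLayer {i : ℕ} {f : Sym2 (Fin n) → Bool} {s z : Fin n}
    (hs : s ∈ newLayer G₀ u v i f) (hzs : z ≠ s) (hz : z ∉ explored G₀ u v i f)
    (hf : f s(s, z) = true) :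
    (s, z) ∈ coincidences G₀ u v i f ∨
    (z ∈ newLayer G₀ u v i f ∧ (z, s) ∈ coincidences G₀ u v i f) ∨
    (z ∉ newLayer G₀ u v i f ∧ (∃ a, (a, z) ∈ coincidences G₀ u v i f) ∧
      ∀ b ∈ revealed G₀ u v i s f, f s(z, b) ≠ true) ∨
    (z ∈ newLayer G₀ u v (i + 1) f ∧
      ∀ b ∈ explored G₀ u v (i + 1) f, f s(z, b) = true ↔ b = s) := by
  classical
  have hsz : f s(z, s) = true := by rwa [Sym2.eq_swap]
  have hsE : s ∈ explored G₀ u v (i + 1) f := mem_explored_succ_iff_newLayer.2 (Or.inr hs)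
  by_cases hzn : z ∈ newLayer G₀ u v i f
  · rcases lt_or_gt_of_ne hzs with hlt | hlt
    · refine Or.inr (Or.inl ⟨hzn, mem_coincidences.2 ⟨⟨hzn, mem_suspects.2
        ⟨⟨fun h => ?_, hzs.symm⟩, Or.inl hs⟩⟩, hsz⟩⟩)
      exact (mem_revealed.1 h).elim (mem_newLayer.1 hs).2 fun h => lt_asymm h.2 hlt
    · refine Or.inl (mem_coincidences.2 ⟨⟨hs, mem_suspects.2
        ⟨⟨fun h => ?_, hzs⟩, Or.inl hzn⟩⟩, hf⟩)
      exact (mem_revealed.1 h).elim hz fun h => lt_asymm h.2 hlt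
  have hzE : z ∉ explored G₀ u v (i + 1) f := fun h =>
    (mem_explored_succ_iff_newLayer.1 h).elim hz hzn
  have hzr : ∀ a, z ∉ revealed G₀ u v i a f := fun a h =>
    hzE (revealed_subset_explored_succ i a f h)
  by_cases hy : predicted G₀ u v i f z = 0
  swap
  · exact Or.inl (mem_coincidences.2 ⟨⟨hs, mem_suspects.2
      ⟨⟨hzr s, hzs⟩, Or.inr (Or.inl hy)⟩⟩, hf⟩)
  by_cases hr : ∃ b ∈ revealed G₀ u v i s f, f s(z, b) = true
  · exact Or.inl (mem_coincidences.2 ⟨⟨hs, mem_suspects.2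
      ⟨⟨hzr s, hzs⟩, Or.inr (Or.inr hr)⟩⟩, hf⟩)
  push Not at hr
  by_cases ha : ∃ a ∈ explored G₀ u v (i + 1) f, f s(z, a) = true ∧ a ≠ s
  · obtain ⟨a, haE, haz, has⟩ := ha
    refine Or.inr (Or.inr (Or.inl ⟨hzn, ⟨a, ?_⟩, hr⟩))
    have han : a ∈ newLayer G₀ u v i f := by
      refine (mem_explored_succ_iff_newLayer.1 haE).resolve_left fun h => ?_
      exact hr a (mem_revealed.2 (Or.inl h)) haz
    have hsa : s < a := by
      refine (lt_or_gt_of_ne has).resolve_left fun h => ?_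
      exact hr a (mem_revealed.2 (Or.inr ⟨han, h⟩)) haz
    exact mem_coincidences.2 ⟨⟨han, mem_suspects.2 ⟨⟨hzr a, fun h => hzn (h ▸ han)⟩,
      Or.inr (Or.inr ⟨s, mem_revealed.2 (Or.inr ⟨hs, hsa⟩), hsz⟩)⟩⟩, by rwa [Sym2.eq_swap]⟩
  push Not at ha
  refine Or.inr (Or.inr (Or.inr ⟨mem_newLayer.2 ⟨?_, hzE⟩,
    fun b hb => ⟨ha b hb, fun h => h ▸ hsz⟩⟩))
  have hxs : layerVec G₀ u v i f s ≠ 0 := (mem_newLayer.1 hs).1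
  have key : layerVec G₀ u v (i + 1) f z - predicted G₀ u v i f z =
      ((if (flipGraph G₀ f).Adj z s then 1 else 0) - (if G₀.Adj z s then 1 else 0)) *
        layerVec G₀ u v i f s := by
    rw [layerVec_succ, predicted, ← Finset.sum_sub_distrib, Finset.sum_eq_single s]
    · split_ifs <;> simp
    · intro b _ hbs
      by_cases hxb : layerVec G₀ u v i f b = 0
      · simp [hxb]
      have hbE : b ∈ explored G₀ u v (i + 1) f := mem_explored_succ.2 (Or.inr hxb)
      have hzb : z ≠ b := fun h => hzE (h ▸ hbE)
      have hfb : ¬ f s(z, b) = true := fun h => hbs (ha b hbE h)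
      have : (flipGraph G₀ f).Adj z b ↔ G₀.Adj z b := by
        rw [flipGraph_adj]
        tauto
      simp [this]
    · simp
  rw [hy, sub_zero] at key
  rw [key]
  refine mul_ne_zero ?_ hxs
  have : (flipGraph G₀ f).Adj z s ↔ ¬ G₀.Adj z s := by
    rw [flipGraph_adj]
    tauto
  by_cases h : G₀.Adj z s <;> simp [this, h]

/-- The marked pairs leaving `D` inside `S` and outside the explored region. -/
noncomputable def slots (G₀ : SimpleGraph (Fin n)) (u v : Fin n) (S D : Finset (Fin n)) (i : ℕ)
    (f : Sym2 (Fin n) → Bool) : Finset (Fin n × Fin n) :=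
  (D ×ˢ (S \ explored G₀ u v i f)).filter fun x => x.2 ≠ x.1 ∧ f s(x.1, x.2) = true

lemma mem_slots {S D : Finset (Fin n)} {i : ℕ} {f : Sym2 (Fin n) → Bool} {s z : Fin n} :
    (s, z) ∈ slots G₀ u v S D i f ↔
      (s ∈ D ∧ z ∈ S ∧ z ∉ explored G₀ u v i f) ∧ z ≠ s ∧ f s(s, z) = true := by
  simp [slots]

lemma mul_card_le_card_slots {S D : Finset (Fin n)} {i k m : ℕ} {f : Sym2 (Fin n) → Bool}
    (hS : ∀ w ∈ S, m + k ≤ (S.filter fun z => z ≠ w ∧ f s(w, z) = true).card) (hDS : D ⊆ S)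
    (hD : ∀ s ∈ D, markCount f s (explored G₀ u v i f) ≤ m) :
    D.card * k ≤ (slots G₀ u v S D i f).card := by
  classical
  rw [mul_comm]
  refine Finset.mul_card_image_le_card_of_maps_to (s := slots G₀ u v S D i f) (t := D)
    (f := Prod.fst) (fun x hx => (mem_slots.1 hx).1.1) k fun s hs => ?_
  have h1 := hS s (hDS hs)
  have h2 := hD s hs
  have h3 : S.filter (fun z => z ≠ s ∧ f s(s, z) = true) ⊆
      (explored G₀ u v i f).filter (fun z => f s(s, z) = true) ∪
      ((slots G₀ u v S D i f).filter fun x => x.1 = s).image Prod.snd := by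
    intro z hz
    obtain ⟨hzS, hzs, hz⟩ := Finset.mem_filter.1 hz
    rw [Finset.mem_union, Finset.mem_filter]
    by_cases hE : z ∈ explored G₀ u v i f
    · exact Or.inl ⟨hE, hz⟩
    · exact Or.inr (Finset.mem_image.2 ⟨(s, z), Finset.mem_filter.2
        ⟨mem_slots.2 ⟨⟨hs, hzS, hE⟩, hzs, hz⟩, rfl⟩, rfl⟩)
  have h4 := (Finset.card_le_card h3).trans (Finset.card_union_le _ _)
  have h5 := Finset.card_image_le (s := (slots G₀ u v S D i f).filter fun x => x.1 = s)
    (f := Prod.snd)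
  unfold markCount at h2
  omega

open Classical in
/-- The slots that do not lead to a good vertex of the next layer. -/
noncomputable def badSlots (G₀ : SimpleGraph (Fin n)) (u v : Fin n) (S D : Finset (Fin n)) (i : ℕ)
    (f : Sym2 (Fin n) → Bool) : Finset (Fin n × Fin n) :=
  (slots G₀ u v S D i f).filter fun x => ¬ (x.2 ∈ newLayer G₀ u v (i + 1) f ∧
    ∀ b ∈ explored G₀ u v (i + 1) f, f s(x.2, b) = true ↔ b = x.1)

lemma card_slots_le {S D : Finset (Fin n)} {i : ℕ} {f : Sym2 (Fin n) → Bool}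
    (hD : D ⊆ newLayer G₀ u v i f) :
    (slots G₀ u v S D i f).card ≤ (goodSet G₀ u v S (i + 1) f).card +
      (badSlots G₀ u v S D i f).card := by
  classical
  rw [← Finset.card_filter_add_card_filter_not (s := slots G₀ u v S D i f)
    (fun x => x.2 ∈ newLayer G₀ u v (i + 1) f ∧
        ∀ b ∈ explored G₀ u v (i + 1) f, f s(x.2, b) = true ↔ b = x.1)]
  refine Nat.add_le_add ?_ (le_of_eq (by unfold badSlots; congr!))
  refine Finset.card_le_card_of_injOn Prod.snd ?_ ?_
  · rintro ⟨s, z⟩ hx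
    obtain ⟨hx1, hx2, hx3⟩ := Finset.mem_filter.1 hx
    refine Finset.mem_filter.2 ⟨Finset.mem_inter.2 ⟨hx2, (mem_slots.1 hx1).1.2.1⟩, ?_⟩
    refine Finset.card_le_one.2 fun a ha b hb => ?_
    rw [Finset.mem_filter] at ha hb
    exact ((hx3 a ha.1).1 ha.2).trans ((hx3 b hb.1).1 hb.2).symm
  · rintro ⟨s, z⟩ hx ⟨s', z'⟩ hx' (rfl : z = z')
    obtain ⟨hx1, hx2, hx3⟩ := Finset.mem_filter.1 hx
    have hx1' := mem_slots.1 (Finset.mem_filter.1 hx').1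
    refine Prod.ext ((hx3 s' ?_).1 ?_).symm rfl
    · exact mem_explored_succ_iff_newLayer.2 (Or.inr (hD hx1'.1.1))
    · rw [Sym2.eq_swap]
      exact hx1'.2.2

lemma coincidence_of_mem_badSlots {S D : Finset (Fin n)} {i : ℕ} {f : Sym2 (Fin n) → Bool}
    (hD : D ⊆ newLayer G₀ u v i f) {s z : Fin n} (hx : (s, z) ∈ badSlots G₀ u v S D i f) :
    (s, z) ∈ coincidences G₀ u v i f ∨
    (z ∈ newLayer G₀ u v i f ∧ (z, s) ∈ coincidences G₀ u v i f) ∨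
    (z ∉ newLayer G₀ u v i f ∧ (∃ a, (a, z) ∈ coincidences G₀ u v i f) ∧
      ∀ b ∈ revealed G₀ u v i s f, f s(z, b) ≠ true) := by
  obtain ⟨hx1, hx2⟩ := Finset.mem_filter.1 hx
  obtain ⟨⟨hsD, -, hzE⟩, hzs, hf⟩ := mem_slots.1 hx1
  rcases coincidence_or_mem_newLayer (hD hsD) hzs hzE hf with h | h | h | h
  · exact Or.inl h
  · exact Or.inr (Or.inl h)
  · exact Or.inr (Or.inr h)
  · exact absurd h hx2

lemma card_badSlots_le {S D : Finset (Fin n)} {i : ℕ} {f : Sym2 (Fin n) → Bool}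
    (hD : D ⊆ newLayer G₀ u v i f) :
    (badSlots G₀ u v S D i f).card ≤ 2 * (coincidences G₀ u v i f).card := by
  classical
  rw [mul_comm, ← Fintype.card_bool, ← Finset.card_univ, ← Finset.card_product]
  refine Finset.card_le_card_of_forall_subsingleton
    (fun (x : Fin n × Fin n) (y : (Fin n × Fin n) × Bool) =>
      (y.2 = false ∧ y.1 = x) ∨ (y.2 = true ∧
        ((x.2 ∈ newLayer G₀ u v i f ∧ y.1 = (x.2, x.1)) ∨ (x.2 ∉ newLayer G₀ u v i f ∧
          y.1.2 = x.2 ∧ ∀ b ∈ revealed G₀ u v i x.1 f, f s(x.2, b) ≠ true)))) ?_ ?_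
  · rintro ⟨s, z⟩ hx
    rcases coincidence_of_mem_badSlots hD hx with h | ⟨h1, h2⟩ | ⟨h1, ⟨a, h2⟩, h3⟩
    · exact ⟨((s, z), false), by simpa using h, by simp⟩
    · exact ⟨((z, s), true), by simpa using h2, by simp [h1]⟩
    · exact ⟨((a, z), true), by simpa using h2, Or.inr ⟨rfl, Or.inr ⟨h1, rfl, h3⟩⟩⟩
  · rintro ⟨⟨a, b⟩, c⟩ - ⟨s, z⟩ ⟨hx, hr⟩ ⟨s', z'⟩ ⟨hx', hr'⟩
    have hS := mem_slots.1 (Finset.mem_filter.1 hx).1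
    have hS' := mem_slots.1 (Finset.mem_filter.1 hx').1
    simp only [Prod.mk.injEq] at hr hr'
    have key : ∀ {t t' : Fin n}, t ∈ newLayer G₀ u v i f → f s(t, z) = true →
        (∀ b ∈ revealed G₀ u v i t' f, f s(z, b) ≠ true) → ¬ t < t' := by
      intro t t' ht hf h hlt
      exact h t (mem_revealed.2 (Or.inr ⟨ht, hlt⟩)) (by rwa [Sym2.eq_swap])
    rcases hr with ⟨hc, h1, h2⟩ | ⟨hc, ⟨h0, h1, h2⟩ | ⟨h0, h1, h2⟩⟩ <;>
      rcases hr' with ⟨hc', h1', h2'⟩ | ⟨hc', ⟨h0', h1', h2'⟩ | ⟨h0', h1', h2'⟩⟩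
    · exact Prod.ext (h1.symm.trans h1') (h2.symm.trans h2')
    · simp [hc] at hc'
    · simp [hc] at hc'
    · simp [hc] at hc'
    · exact Prod.ext (h2.symm.trans h2') (h1.symm.trans h1')
    · exact absurd (hD hS.1.1) (by rw [← h2, h1']; exact h0')
    · simp [hc] at hc'
    · exact absurd (hD hS'.1.1) (by rw [← h2', h1]; exact h0)
    · obtain rfl : z = z' := h1.symm.trans h1'
      exact Prod.ext (le_antisymm (not_lt.1 (key (hD hS'.1.1) hS'.2.2 h2))
        (not_lt.1 (key (hD hS.1.1) hS.2.2 h2'))) rfl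

lemma card_badSlots_singleton_le {S : Finset (Fin n)} {i : ℕ} {f : Sym2 (Fin n) → Bool}
    (hu : u ∈ newLayer G₀ u v i f) :
    (badSlots G₀ u v S {u} i f).card ≤ (coincidences G₀ u v i f).card := by
  have hD : {u} ⊆ newLayer G₀ u v i f := Finset.singleton_subset_iff.2 hu
  refine Finset.card_le_card_of_forall_subsingleton
    (fun (x y : Fin n × Fin n) => y.2 = x.2 ∨ y = (x.2, u)) ?_ ?_
  · rintro ⟨s, z⟩ hx
    obtain rfl := Finset.mem_singleton.1 (mem_slots.1 (Finset.mem_filter.1 hx).1).1.1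
    rcases coincidence_of_mem_badSlots hD hx with h | ⟨h1, h2⟩ | ⟨h1, ⟨a, h2⟩, h3⟩
    · exact ⟨_, h, Or.inl rfl⟩
    · exact ⟨_, h2, Or.inr rfl⟩
    · exact ⟨_, h2, Or.inl rfl⟩
  · rintro ⟨a, b⟩ - ⟨s, z⟩ ⟨hx, hr⟩ ⟨s', z'⟩ ⟨hx', hr'⟩
    have hS := mem_slots.1 (Finset.mem_filter.1 hx).1
    have hS' := mem_slots.1 (Finset.mem_filter.1 hx').1
    obtain rfl := Finset.mem_singleton.1 hS.1.1
    obtain rfl := Finset.mem_singleton.1 hS'.1.1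
    simp only [Prod.mk.injEq] at hr hr'
    rcases hr with h | ⟨h, h2⟩ <;> rcases hr' with hk | ⟨hk, h2'⟩
    · exact Prod.ext rfl (h.symm.trans hk)
    · exact absurd (h.symm.trans h2') hS.2.1
    · exact absurd (hk.symm.trans h2) hS'.2.1
    · exact Prod.ext rfl (h.symm.trans hk)

/-- With at most two coincidences, the layers grow exponentially. -/
lemma two_pow_le_card_newLayer (huv : u ≠ v) {S : Finset (Fin n)} {f : Sym2 (Fin n) → Bool}
    (hu : u ∈ S) (hS : ∀ w ∈ S, 3 ≤ (S.filter fun z => z ≠ w ∧ f s(w, z) = true).card) (I : ℕ)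
    (hI : ∑ i ∈ Finset.range (I + 1), (coincidences G₀ u v i f).card ≤ 2) :
    2 ^ I ≤ (newLayer G₀ u v (I + 1) f).card := by
  have key : 3 * 2 ^ I ≤ (goodSet G₀ u v S (I + 1) f).card +
      2 ^ I * ∑ i ∈ Finset.range (I + 1), (coincidences G₀ u v i f).card := by
    clear hI
    induction I with
    | zero =>
      have hu0 : u ∈ newLayer G₀ u v 0 f := (mem_newLayer_zero huv).2 (Or.inl rfl)
      have h1 := mul_card_le_card_slots (G₀ := G₀) (u := u) (v := v) (D := {u}) (i := 0)
        (k := 3) (m := 0) (f := f) (by simpa using hS) (by simpa using hu)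
        (by simp [explored, markCount])
      have h2 := card_slots_le (S := S) (Finset.singleton_subset_iff.2 hu0)
      have h3 := card_badSlots_singleton_le (S := S) hu0
      simp only [Finset.card_singleton] at h1
      simp only [Finset.sum_range_one, zero_add, pow_zero] at h2 ⊢
      omega
    | succ I ih =>
      have hD : goodSet G₀ u v S (I + 1) f ⊆ newLayer G₀ u v (I + 1) f := fun x hx =>
        (Finset.mem_inter.1 (Finset.mem_filter.1 hx).1).1
      have h1 := mul_card_le_card_slots (G₀ := G₀) (u := u) (v := v)
        (D := goodSet G₀ u v S (I + 1) f) (i := I + 1) (k := 2) (m := 1) (f := f) hS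
        (fun x hx => (Finset.mem_inter.1 (Finset.mem_filter.1 hx).1).2)
        (fun x hx => (Finset.mem_filter.1 hx).2)
      have h2 := card_slots_le (S := S) hD
      have h3 := card_badSlots_le (S := S) hD
      rw [Finset.sum_range_succ]
      have h4 : 2 ≤ 2 ^ (I + 1) := by
        rw [pow_succ]
        exact Nat.le_mul_of_pos_left 2 (by positivity)
      have h5 := Nat.mul_le_mul_right (coincidences G₀ u v (I + 1) f).card h4
      rw [mul_add, pow_succ] at *
      linarith
  have h6 := Nat.mul_le_mul_left (2 ^ I) hI
  have h7 : (goodSet G₀ u v S (I + 1) f).card ≤ (newLayer G₀ u v (I + 1) f).card :=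
    Finset.card_le_card fun x hx => (Finset.mem_inter.1 (Finset.mem_filter.1 hx).1).1
  linarith

end Growth

section PairBound

variable {n : ℕ} {G₀ : SimpleGraph (Fin n)} {u v : Fin n}

lemma exists_finset_of_mem_kCore {k : ℕ} {f : Sym2 (Fin n) → Bool}
    (hu : u ∈ kCore (graphOfFlip f) k) : ∃ S : Finset (Fin n), u ∈ S ∧
      ∀ w ∈ S, k ≤ (S.filter fun z => z ≠ w ∧ f s(w, z) = true).card := by
  classical
  obtain ⟨S, hS, huS⟩ := hu
  refine ⟨S.toFinset, Set.mem_toFinset.2 huS, fun w hw => (hS w (Set.mem_toFinset.1 hw)).trans_eq ?_⟩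
  rw [Nat.card_eq_fintype_card, Fintype.card_subtype]
  congr 1
  ext z
  simp only [Finset.mem_filter, Finset.mem_univ, true_and, Set.mem_toFinset, graphOfFlip_adj,
    ne_comm (a := w)]

lemma card_explored_le {L I : ℕ} {f : Sym2 (Fin n) → Bool}
    (h : ∀ i < I, (newLayer G₀ u v i f).card ≤ L) : (explored G₀ u v I f).card ≤ I * L := by
  induction I with
  | zero => simp [explored]
  | succ I ih =>
    have h1 := ih fun i hi => h i (hi.trans I.lt_succ_self)
    have h2 := h I I.lt_succ_self
    have h3 := card_explored_succ_le (G₀ := G₀) (u := u) (v := v) I f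
    rw [add_mul]
    omega

lemma card_suspects_le {i Δ : ℕ} {s : Fin n} {f : Sym2 (Fin n) → Bool}
    (hΔ : ∀ a, markCount f a Finset.univ ≤ Δ) :
    (suspects G₀ u v i s f).card ≤ (newLayer G₀ u v i f).card +
      (newLayer G₀ u v (i + 1) f).card + (explored G₀ u v (i + 1) f).card * Δ := by
  classical
  have h1 : suspects G₀ u v i s f ⊆ (newLayer G₀ u v i f ∪ newLayer G₀ u v (i + 1) f) ∪
      (explored G₀ u v (i + 1) f).biUnion fun a => Finset.univ.filter fun z => f s(a, z) = true := by
    intro z hz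
    obtain ⟨⟨hzr, -⟩, hz⟩ := mem_suspects.1 hz
    simp only [Finset.mem_union, Finset.mem_biUnion, Finset.mem_filter, Finset.mem_univ, true_and]
    by_contra hcon
    push Not at hcon
    obtain ⟨⟨h1, h2⟩, h3⟩ := hcon
    have hzE : z ∉ explored G₀ u v (i + 1) f := fun h =>
      (mem_explored_succ_iff_newLayer.1 h).elim (fun h => hzr (mem_revealed.2 (Or.inl h))) h1
    rcases hz with hz | hz | ⟨a, ha, hz⟩
    · exact h1 hz
    · refine h2 (mem_newLayer.2 ⟨?_, hzE⟩)
      convert hz using 1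
      rw [layerVec_succ, predicted]
      refine Finset.sum_congr rfl fun b _ => ?_
      by_cases hxb : layerVec G₀ u v i f b = 0
      · simp [hxb]
      have hbE : b ∈ explored G₀ u v (i + 1) f := mem_explored_succ.2 (Or.inr hxb)
      have hzb : z ≠ b := fun h => hzE (h ▸ hbE)
      have hfb := h3 b hbE
      have : (flipGraph G₀ f).Adj z b ↔ G₀.Adj z b := by
        rw [flipGraph_adj, Sym2.eq_swap]
        tauto
      simp [this]
    · exact h3 a (revealed_subset_explored_succ i s f ha) (by rwa [Sym2.eq_swap])
  refine (Finset.card_le_card h1).trans ((Finset.card_union_le _ _).trans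
    (add_le_add (Finset.card_union_le _ _) ?_))
  exact Finset.card_biUnion_le_card_mul _ _ _ fun a _ => hΔ a

open Classical in
lemma exists_layer_or_markCount_or_coincidences (huv : u ≠ v) {L Δ : ℕ}
    (hLn : 4 * ((L + 1) * L) ≤ n) {f : Sym2 (Fin n) → Bool}
    (hu : u ∈ kCore (graphOfFlip f) 3) :
    ((∃ i ∈ Finset.range (L + 2), 4 * (explored G₀ u v i f).card ≤ n ∧
      L ≤ (newLayer G₀ u v i f).card) ∨ ∃ a ∈ Finset.univ, Δ + 1 ≤ markCount f a Finset.univ) ∨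
    3 ≤ (Finset.univ.filter fun k : Fin (L + 1) × Fin n × Fin n =>
      Candidate G₀ u v L (2 * L + (L + 1) * L * Δ) (k.1, k.2) f ∧
        f s(k.2.1, k.2.2) = true).card := by
  by_contra hcon
  push Not at hcon
  obtain ⟨⟨h1, h2⟩, h3⟩ := hcon
  have hΔ : ∀ a, markCount f a Finset.univ ≤ Δ := fun a =>
    Nat.lt_succ_iff.1 (h2 a (Finset.mem_univ a))
  have hlayer : ∀ i < L + 2, (newLayer G₀ u v i f).card ≤ L := by
    intro i
    induction i using Nat.strong_induction_on with
    | _ i ih =>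
      intro hi
      have hE := card_explored_le (G₀ := G₀) (u := u) (v := v) (L := L) (I := i) (f := f)
        fun j hj => ih j hj (hj.trans hi)
      refine (h1 i (Finset.mem_range.2 hi) ?_).le
      have := Nat.mul_le_mul_right L (Nat.lt_succ_iff.1 hi)
      omega
  have hE : ∀ i < L + 2, 4 * (explored G₀ u v i f).card ≤ n := by
    intro i hi
    have hE := card_explored_le (G₀ := G₀) (u := u) (v := v) (L := L) (I := i) (f := f)
        fun j hj => hlayer j (hj.trans hi)
    have := Nat.mul_le_mul_right L (Nat.lt_succ_iff.1 hi)
    omega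
  have hc : ∑ i ∈ Finset.range (L + 1), (coincidences G₀ u v i f).card ≤ 2 := by
    refine le_trans (le_of_eq ?_) (Nat.lt_succ_iff.1 h3)
    rw [Finset.sum_range, ← Finset.univ_product_univ, Finset.card_filter, Finset.sum_product]
    refine Finset.sum_congr rfl fun i _ => ?_
    rw [← Finset.card_filter]
    congr 1
    ext ⟨s, z⟩
    rw [mem_coincidences, Finset.mem_filter]
    simp only [Finset.mem_univ, true_and, Candidate]
    refine and_congr_left fun _ => ⟨fun h => ⟨h.1, hlayer i (by omega), ?_, h.2⟩,
      fun h => ⟨h.1, h.2.2.2⟩⟩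
    have a1 := hlayer i (by omega)
    have a2 := hlayer (i + 1) (by omega)
    have a3 := card_explored_le (G₀ := G₀) (u := u) (v := v) (L := L) (I := i + 1) (f := f)
      fun j hj => hlayer j (by omega)
    have a4 := card_suspects_le (G₀ := G₀) (u := u) (v := v) (i := i) (s := s) hΔ
    have a5 : (i + 1 : ℕ) * L ≤ (L + 1) * L := Nat.mul_le_mul_right L (by omega)
    have a6 := Nat.mul_le_mul_right Δ (a3.trans a5)
    omega
  obtain ⟨S, huS, hS⟩ := exists_finset_of_mem_kCore hu
  have := two_pow_le_card_newLayer (G₀ := G₀) huv huS hS L hc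
  have h4 := h1 (L + 1) (by simp) (hE (L + 1) (by omega))
  have h5 := Nat.lt_two_pow_self (n := L)
  omega

variable (G₀ u v)

lemma bernProb_crStable_kCore_le_sparse (huv : u ≠ v) {p b : ℝ} (h0 : 0 ≤ p) (h1 : p ≤ 1)
    {L Δ : ℕ} (hLn : 4 * ((L + 1) * L) ≤ n)
    (hb : ∀ i, bernProb p (fun f => crStableTrivial (flipGraph G₀ f) u v ∧
        4 * (explored G₀ u v i f).card ≤ n ∧ L ≤ (newLayer G₀ u v i f).card) ≤ b) :
    bernProb p (fun f => crStableTrivial (flipGraph G₀ f) u v ∧ u ∈ kCore (graphOfFlip f) 3) ≤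
      (L + 2) * b + n * ((1 + p) ^ n / 2 ^ (Δ + 1)) +
        (p * ((L + 1) * (L * (2 * L + (L + 1) * L * Δ)))) ^ 3 := by
  classical
  refine (bernProb_or_le h0 h1 (Q := fun f => (∃ i ∈ Finset.range (L + 2),
      crStableTrivial (flipGraph G₀ f) u v ∧ 4 * (explored G₀ u v i f).card ≤ n ∧
      L ≤ (newLayer G₀ u v i f).card) ∨ ∃ a ∈ Finset.univ, Δ + 1 ≤ markCount f a Finset.univ)
    (R := fun f => 3 ≤ (Finset.univ.filter fun k : Fin (L + 1) × Fin n × Fin n =>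
      Candidate G₀ u v L (2 * L + (L + 1) * L * Δ) (k.1, k.2) f ∧
        f s(k.2.1, k.2.2) = true).card) fun f hf => ?_).trans (add_le_add ?_ ?_)
  · refine (exists_layer_or_markCount_or_coincidences huv hLn hf.2).imp_left
      fun h => h.imp_left ?_
    rintro ⟨i, hi, h⟩
    exact ⟨i, hi, hf.1, h⟩
  · refine (bernProb_or_le h0 h1 fun f hf => hf).trans (add_le_add ?_ ?_)
    · refine (bernProb_union_le h0 h1 _ _ fun f hf => hf).trans
        ((Finset.sum_le_card_nsmul _ _ b fun i _ => hb i).trans_eq ?_)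
      simp
    · refine (bernProb_union_le h0 h1 _ _ fun f hf => hf).trans
        ((Finset.sum_le_card_nsmul _ _ _ fun a _ =>
          bernProb_markCount_ge_le h0 h1 a Finset.univ (Δ + 1)).trans_eq ?_)
      simp
  · refine (bernProb_three_le_card_coincidences_le h0 h1 (L + 1) L _).trans_eq ?_
    push_cast
    rfl

lemma bernProb_crStable_le_dense (huv : u ≠ v) {p b : ℝ} (h0 : 0 ≤ p) (hp : p ≤ 1 / 2)
    {L : ℕ} (hn : 8 ≤ n)
    (hb : ∀ i, bernProb p (fun f => crStableTrivial (flipGraph G₀ f) u v ∧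
        4 * (explored G₀ u v i f).card ≤ n ∧ L ≤ (newLayer G₀ u v i f).card) ≤ b) :
    bernProb p (fun f => crStableTrivial (flipGraph G₀ f) u v) ≤
      b + 2 ^ L * (1 - p / 2) ^ (n - 2) := by
  have h1 : p ≤ 1 := by linarith
  refine (bernProb_or_le h0 h1 (fun f hf => ?_)).trans (add_le_add (hb 1)
    (bernProb_card_newLayer_one_lt_le (G₀ := G₀) h0 hp huv L))
  rcases lt_or_ge (newLayer G₀ u v 1 f).card L with h | h
  · exact Or.inr h
  · refine Or.inl ⟨hf, ?_, h⟩
    rw [explored_one huv, Finset.card_pair huv]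
    omega

end PairBound

lemma exists_pow_le_lt_succ_pow {k : ℕ} (hk : 0 < k) (L₀ : ℕ) :
    ∃ n₀ : ℕ, ∀ n ≥ n₀, ∃ L ≥ L₀, L ^ k ≤ n ∧ n < (L + 1) ^ k := by
  classical
  refine ⟨(L₀ + 1) ^ k, fun n hn => ?_⟩
  have hex : ∃ m : ℕ, n < (m + 1) ^ k :=
    ⟨n, (Nat.lt_succ_self n).trans_le (Nat.le_self_pow hk.ne' _)⟩
  refine ⟨Nat.find hex, ?_, ?_, Nat.find_spec hex⟩
  · have := lt_of_pow_lt_pow_left₀ k (Nat.zero_le _) (hn.trans_lt (Nat.find_spec hex))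
    omega
  · rcases h : Nat.find hex with _ | m
    · simp [hk.ne']
    · exact not_lt.1 (Nat.find_min hex (m := m) (by omega))

lemma sparse_error_le {L n p C : ℝ} (hL : 1 ≤ L) (hC : 0 ≤ C) (hn : L ^ 40 ≤ n)
    (hn' : n ≤ 2 ^ 40 * L ^ 40) (hp0 : 0 ≤ p) (hp : p * n ≤ L ^ 2) {E : ℝ} (hE0 : 0 ≤ E)
    (hE : E ≤ 1 / 2 ^ L) :
    n ^ 2 * ((L + 2) * (C / L ^ 82) + n * E +
        (p * ((L + 1) * (L * (2 * L + (L + 1) * L * (3 * L ^ 2))))) ^ 3) ≤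
      3 * 2 ^ 80 * C / L + 2 ^ 120 * (L ^ 120 / 2 ^ L) + 2 ^ 12 / L := by
  have hL0 : 0 < L := by linarith
  have hLp : 0 < L ^ 40 := by positivity
  have hn0 : 0 < n := by linarith
  have e1 : n ^ 2 * ((L + 2) * (C / L ^ 82)) ≤ 3 * 2 ^ 80 * C / L := by
    calc n ^ 2 * ((L + 2) * (C / L ^ 82)) ≤ (2 ^ 40 * L ^ 40) ^ 2 * ((3 * L) * (C / L ^ 82)) := by
          gcongr
          linarith
      _ = _ := by field_simp
  have e2 : n ^ 2 * (n * E) ≤ 2 ^ 120 * (L ^ 120 / 2 ^ L) := by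
    calc n ^ 2 * (n * E) = n ^ 3 * E := by ring
      _ ≤ (2 ^ 40 * L ^ 40) ^ 3 * (1 / 2 ^ L) := by gcongr
      _ = _ := by ring
  have e3 : n ^ 2 * (p * ((L + 1) * (L * (2 * L + (L + 1) * L * (3 * L ^ 2))))) ^ 3 ≤
      2 ^ 12 / L := by
    have h1 : (L + 1) * (L * (2 * L + (L + 1) * L * (3 * L ^ 2))) ≤ 16 * L ^ 6 := by
      have h2 : L ≤ L ^ 4 := le_self_pow₀ hL (by norm_num)
      calc (L + 1) * (L * (2 * L + (L + 1) * L * (3 * L ^ 2)))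
          ≤ (L + L) * (L * (2 * L ^ 4 + (L + L) * L * (3 * L ^ 2))) := by gcongr
        _ = 16 * L ^ 6 := by ring
    have h2 : p ≤ L ^ 2 / n := by rwa [le_div_iff₀ hn0]
    calc n ^ 2 * (p * ((L + 1) * (L * (2 * L + (L + 1) * L * (3 * L ^ 2))))) ^ 3
        ≤ n ^ 2 * (L ^ 2 / n * (16 * L ^ 6)) ^ 3 := by gcongr
      _ = 2 ^ 12 * L ^ 24 / n := by
          field_simp
          norm_num
      _ ≤ 2 ^ 12 * L ^ 24 / L ^ 40 := by gcongr
      _ = 2 ^ 12 / L ^ 16 := by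
          field_simp
      _ ≤ 2 ^ 12 / L := by
          gcongr
          exact le_self_pow₀ hL (by norm_num)
  rw [mul_add, mul_add]
  exact add_le_add (add_le_add e1 e2) e3

lemma one_add_pow_div_le {p : ℝ} {n L : ℕ} (hp0 : 0 ≤ p) (hp : p * n ≤ (L : ℝ) ^ 2) :
    (1 + p) ^ n / 2 ^ (3 * L ^ 2 + 1) ≤ 1 / (2 : ℝ) ^ L := by
  have h1 : (1 + p) ^ n ≤ (4 : ℝ) ^ (L ^ 2) := by
    calc (1 + p) ^ n ≤ (Real.exp p) ^ n := by
          gcongr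
          linarith [Real.add_one_le_exp p]
      _ = Real.exp (p * n) := by rw [← Real.exp_nat_mul, mul_comm]
      _ ≤ Real.exp ((L ^ 2 : ℕ) * 1) := by
          refine Real.exp_le_exp.2 ?_
          simpa using hp
      _ = Real.exp 1 ^ (L ^ 2) := by rw [Real.exp_nat_mul]
      _ ≤ 4 ^ (L ^ 2) := by
          gcongr
          linarith [Real.exp_one_lt_d9]
  rw [div_le_div_iff₀ (by positivity) (by positivity), one_mul]
  calc (1 + p) ^ n * 2 ^ L ≤ (4 : ℝ) ^ (L ^ 2) * 2 ^ (L ^ 2) := by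
        gcongr
        · norm_num
        · exact Nat.le_self_pow (by norm_num) L
    _ = 2 ^ (3 * L ^ 2) := by
        rw [← mul_pow, pow_mul]
        norm_num
    _ ≤ 2 ^ (3 * L ^ 2 + 1) := by
        gcongr
        · norm_num
        · omega

lemma two_pow_mul_one_sub_pow_le {p : ℝ} {n L : ℕ} (hp2 : p ≤ 1 / 2)
    (hp : (L : ℝ) ^ 2 ≤ p * n) (hn : 2 ≤ n) (hL : 4 ≤ L) :
    2 ^ L * (1 - p / 2) ^ (n - 2) ≤ 2 * (1 / (2 : ℝ) ^ L) := by
  have hL' : (4 : ℝ) ≤ L := by exact_mod_cast hL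
  have hn' : ((n - 2 : ℕ) : ℝ) = n - 2 := by push_cast [hn]; ring
  have h1 : (1 - p / 2) ^ (n - 2) ≤ Real.exp (1 / 2 - 2 * L) := by
    calc (1 - p / 2) ^ (n - 2) ≤ (Real.exp (-(p / 2))) ^ (n - 2) := by
          gcongr
          · linarith
          · linarith [Real.add_one_le_exp (-(p / 2))]
      _ = Real.exp ((n - 2) * (-(p / 2))) := by rw [← Real.exp_nat_mul, hn']
      _ ≤ Real.exp (1 / 2 - 2 * L) := by
          gcongr
          nlinarith
  have h2 : (2 : ℝ) ^ L * 2 ^ L ≤ Real.exp (2 * L) := by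
    calc (2 : ℝ) ^ L * 2 ^ L ≤ Real.exp 1 ^ L * Real.exp 1 ^ L := by
          gcongr <;> linarith [Real.exp_one_gt_d9]
      _ = Real.exp (2 * L) := by
          rw [← Real.exp_nat_mul, ← Real.exp_add]
          ring_nf
  have h3 : Real.exp (1 / 2) ≤ 2 := by
    have : Real.exp (1 / 2) * Real.exp (1 / 2) = Real.exp 1 := by
      rw [← Real.exp_add]
      norm_num
    nlinarith [Real.exp_one_lt_d9, Real.exp_pos (1 / 2)]
  rw [mul_one_div, le_div_iff₀ (by positivity)]
  calc 2 ^ L * (1 - p / 2) ^ (n - 2) * 2 ^ L ≤ 2 ^ L * Real.exp (1 / 2 - 2 * L) * 2 ^ L := by gcongr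
    _ = Real.exp (1 / 2) * ((2 ^ L * 2 ^ L) / Real.exp (2 * L)) := by
        rw [Real.exp_sub]
        ring
    _ ≤ 2 * 1 := by
        gcongr
        exact div_le_one_of_le₀ h2 (Real.exp_pos _).le
    _ = 2 := mul_one 2

lemma tendsto_pairError (C : ℝ) : Tendsto (fun L : ℕ => 3 * 2 ^ 80 * C / (L : ℝ) +
    2 ^ 120 * ((L : ℝ) ^ 120 / 2 ^ L) + 2 ^ 12 / (L : ℝ)) atTop (nhds 0) := by
  have h1 := tendsto_pow_const_div_const_pow_of_one_lt 120 (one_lt_two (α := ℝ))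
  have h2 := (tendsto_const_div_atTop_nhds_zero_nat (3 * 2 ^ 80 * C)).add (h1.const_mul (2 ^ 120))
  simpa using h2.add (tendsto_const_div_atTop_nhds_zero_nat ((2 : ℝ) ^ 12))

theorem exists_sq_mul_bernProb_crStable_kCore_le {ε : ℝ} (hε : 0 < ε) : ∃ n₀ : ℕ, ∀ n ≥ n₀,
    ∀ p : ℝ, 1 / (4 * n) ≤ p → p ≤ 1 / 2 → ∀ (G₀ : SimpleGraph (Fin n)) (u v : Fin n), u ≠ v →
      (n : ℝ) ^ 2 * bernProb p (fun f => crStableTrivial (flipGraph G₀ f) u v ∧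
        u ∈ kCore (graphOfFlip f) 3) ≤ ε := by
  obtain ⟨C, hC, n₁, hmain⟩ := exists_bernProb_newLayer_le 82
  obtain ⟨L₀, hL₀⟩ := eventually_atTop.1 ((tendsto_pairError C).eventually_le_const hε)
  obtain ⟨n₂, hn₂⟩ := exists_pow_le_lt_succ_pow (k := 40) (by norm_num) (L₀ + 4)
  refine ⟨n₁ + n₂, fun n hn p hp hp2 G₀ u v huv => ?_⟩
  have h0 : 0 ≤ p := le_trans (by positivity) hp
  have h1 : p ≤ 1 := by linarith
  obtain ⟨L, hL, hLn, hLR, hnR, hnR'⟩ : ∃ L ≥ L₀ + 4, L ^ 4 ≤ n ∧ (1 : ℝ) ≤ L ∧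
      (L : ℝ) ^ 40 ≤ n ∧ (n : ℝ) ≤ 2 ^ 40 * (L : ℝ) ^ 40 := by
    obtain ⟨L, hL, hL1, hL2⟩ := hn₂ n (by omega)
    have hLR : (1 : ℝ) ≤ L := Nat.one_le_cast.2 (by omega)
    refine ⟨L, hL, (Nat.pow_le_pow_right (by omega) (by norm_num)).trans hL1, hLR,
      by exact_mod_cast hL1, ?_⟩
    rw [← mul_pow]
    calc (n : ℝ) ≤ ((L : ℝ) + 1) ^ 40 := by exact_mod_cast hL2.le
      _ ≤ _ := pow_le_pow_left₀ (by linarith) (by linarith) 40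
  have h4n : 4 * ((L + 1) * L) ≤ n := by
    refine le_trans ?_ hLn
    have : 4 * 4 ≤ L * L := Nat.mul_le_mul (by omega) (by omega)
    nlinarith
  have h4 : 4 * L ≤ n := le_trans (Nat.mul_le_mul_left 4 (Nat.le_mul_of_pos_left L L.succ_pos)) h4n
  have hb := fun i => hmain n (by omega) p hp hp2 G₀ u v i L (by omega) h4
  have hη := hL₀ L (by omega)
  refine le_trans ?_ hη
  rcases le_total (p * n) ((L : ℝ) ^ 2) with hpn | hpn
  · have h2 := bernProb_crStable_kCore_le_sparse G₀ u v huv h0 h1 (Δ := 3 * L ^ 2) h4n hb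
    push_cast at h2
    exact (mul_le_mul_of_nonneg_left h2 (by positivity)).trans
      (by
        have h3 := one_add_pow_div_le h0 hpn
        rw [← Real.rpow_natCast 2 L] at h3 ⊢
        exact sparse_error_le hLR hC.le hnR hnR' h0 hpn (by positivity) h3)
  · have h2 := bernProb_crStable_le_dense G₀ u v huv h0 hp2 (by omega) hb
    have h3 := two_pow_mul_one_sub_pow_le hp2 hpn (by omega) (by omega)
    have h5 : bernProb p (fun f => crStableTrivial (flipGraph G₀ f) u v ∧
        u ∈ kCore (graphOfFlip f) 3) ≤ C / L ^ 82 + 2 * (1 / (2 : ℝ) ^ L) :=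
      ((bernProb_mono h0 h1 fun f hf => hf.1).trans h2).trans (by gcongr)
    have hL0 : (0 : ℝ) < L := by linarith
    calc (n : ℝ) ^ 2 * bernProb p (fun f => crStableTrivial (flipGraph G₀ f) u v ∧
        u ∈ kCore (graphOfFlip f) 3)
        ≤ (2 ^ 40 * (L : ℝ) ^ 40) ^ 2 * (C / L ^ 82 + 2 * (1 / (2 : ℝ) ^ L)) := by
          gcongr
          exact bernProb_nonneg h0 h1 _
      _ = 2 ^ 80 * C / (L : ℝ) ^ 2 + 2 ^ 81 * ((L : ℝ) ^ 80 / 2 ^ L) := by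
          field_simp
      _ ≤ 3 * 2 ^ 80 * C / (L : ℝ) + 2 ^ 120 * ((L : ℝ) ^ 120 / 2 ^ L) := by
          gcongr ?_ * C / ?_ + ?_ * (?_ / _)
          · norm_num
          · exact le_self_pow₀ hLR (by norm_num)
          · norm_num
          · exact pow_le_pow_right₀ hLR (by norm_num)
      _ ≤ _ := le_add_of_nonneg_right (by positivity)

section LongestPath

variable {n : ℕ}

/-- The edges of a path on `0, …, l` together with two further pairs at `0`. -/
def pathEdges (l : ℕ) (a b : Fin (l + 1)) : Finset (Sym2 (Fin (l + 1))) :=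
  insert s(0, a) (insert s(0, b) (Finset.univ.image fun i : Fin l => s(i.castSucc, i.succ)))

lemma card_pathEdges {l : ℕ} {a b : Fin (l + 1)} (hab : a ≠ b) (ha : 2 ≤ (a : ℕ))
    (hb : 2 ≤ (b : ℕ)) : (pathEdges l a b).card = l + 2 := by
  have key : ∀ c : Fin (l + 1), 2 ≤ (c : ℕ) →
      s(0, c) ∉ Finset.univ.image fun i : Fin l => s(i.castSucc, i.succ) := by
    intro c hc h
    obtain ⟨i, -, hi⟩ := Finset.mem_image.1 h
    rcases Sym2.eq_iff.1 hi with ⟨h1, h2⟩ | ⟨h1, h2⟩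
    · have := congrArg Fin.val h1
      have := congrArg Fin.val h2
      simp at *
      omega
    · have := congrArg Fin.val h2
      simp at this
  rw [pathEdges, Finset.card_insert_of_notMem, Finset.card_insert_of_notMem (key b hb),
    Finset.card_image_of_injective, Finset.card_univ, Fintype.card_fin]
  · intro i j hij
    rcases Sym2.eq_iff.1 hij with ⟨h1, -⟩ | ⟨h1, h2⟩
    · exact Fin.castSucc_injective _ h1
    · have := congrArg Fin.val h1
      have := congrArg Fin.val h2
      simp at *
      omega
  · rw [Finset.mem_insert, not_or]
    exact ⟨fun h => hab (Sym2.congr_right.1 h), key a ha⟩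

/-- A nonempty vertex set of minimum degree three contains a path whose first vertex has two
further neighbours on the path. -/
lemma exists_path_of_minDegree {f : Sym2 (Fin n) → Bool} {S : Finset (Fin n)} (hne : S.Nonempty)
    (hS : ∀ w ∈ S, 3 ≤ (S.filter fun z => z ≠ w ∧ f s(w, z) = true).card) :
    ∃ l < n, ∃ g : Fin (l + 1) → Fin n, Function.Injective g ∧ ∃ a b : Fin (l + 1),
      (a ≠ b ∧ 2 ≤ (a : ℕ) ∧ 2 ≤ (b : ℕ)) ∧ ∀ e ∈ pathEdges l a b, f (e.map g) = true := by
  classical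
  let P : ℕ → Prop := fun l => ∃ g : Fin (l + 1) → Fin n, Function.Injective g ∧ (∀ i, g i ∈ S) ∧
    ∀ i : Fin l, f s(g i.castSucc, g i.succ) = true
  have hPn : ∀ l, P l → l < n := by
    rintro l ⟨g, hg, -⟩
    simpa [Nat.succ_le_iff] using Fintype.card_le_of_injective g hg
  obtain ⟨l, hl, hl'⟩ : ∃ l, P l ∧ ¬ P (l + 1) := by
    by_contra hcon
    push Not at hcon
    obtain ⟨w, hw⟩ := hne
    have hall : ∀ l, P l := fun l => by
      induction l with
      | zero => exact ⟨fun _ => w, fun i j _ => Subsingleton.elim (α := Fin 1) i j, fun _ => hw,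
          fun i => i.elim0⟩
      | succ l ih => exact hcon l ih
    exact lt_irrefl _ (hPn n (hall n))
  obtain ⟨g, hg, hgS, hgf⟩ := hl
  refine ⟨l, hPn l ⟨g, hg, hgS, hgf⟩, g, hg, ?_⟩
  have hrange : ∀ z ∈ S, f s(g 0, z) = true → ∃ j, g j = z := by
    intro z hz hfz
    by_contra hcon
    push Not at hcon
    refine hl' ⟨Fin.cons z g, Fin.cons_injective_iff.2 ⟨fun ⟨j, hj⟩ => hcon j hj, hg⟩,
      fun i => Fin.cases hz hgS i, fun i => ?_⟩
    refine Fin.cases ?_ (fun i => ?_) i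
    · simpa [Sym2.eq_swap] using hfz
    · simpa using hgf i
  have hJ : 3 ≤ (Finset.univ.filter fun j => j ≠ 0 ∧ f s(g 0, g j) = true).card := by
    refine (hS _ (hgS 0)).trans ((Finset.card_le_card fun z hz => ?_).trans
      (Finset.card_image_le (f := g)))
    obtain ⟨hzS, hz0, hfz⟩ := Finset.mem_filter.1 hz
    obtain ⟨j, rfl⟩ := hrange z hzS hfz
    exact Finset.mem_image.2 ⟨j, Finset.mem_filter.2
      ⟨Finset.mem_univ _, fun h => hz0 (h ▸ rfl), hfz⟩, rfl⟩
  have hJ' : 1 < ((Finset.univ.filter fun j => j ≠ 0 ∧ f s(g 0, g j) = true).erase 1).card := by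
    have := Finset.pred_card_le_card_erase
      (s := Finset.univ.filter fun j => j ≠ 0 ∧ f s(g 0, g j) = true) (a := 1)
    omega
  obtain ⟨a, ha, b, hb, hab⟩ := Finset.one_lt_card.1 hJ'
  have htwo : ∀ c : Fin (l + 1), c ≠ 1 → c ≠ 0 → 2 ≤ (c : ℕ) := by
    intro c h1 h0
    have hc := c.isLt
    have h0' : (c : ℕ) ≠ 0 := fun h => h0 (Fin.ext h)
    have h1' : (c : ℕ) ≠ 1 := fun h => h1 (Fin.ext (by
      rw [Fin.val_one', Nat.mod_eq_of_lt (by omega), h]))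
    omega
  simp only [Finset.mem_erase, Finset.mem_filter, Finset.mem_univ, true_and] at ha hb
  refine ⟨a, b, ⟨hab, htwo a ha.1 ha.2.1, htwo b hb.1 hb.2.1⟩, fun e he => ?_⟩
  simp only [pathEdges, Finset.mem_insert, Finset.mem_image, Finset.mem_univ, true_and] at he
  rcases he with rfl | rfl | ⟨i, rfl⟩
  · exact ha.2.2
  · exact hb.2.2
  · exact hgf i

lemma bernProb_pathEdges_le {p : ℝ} {l : ℕ} {g : Fin (l + 1) → Fin n} (h0 : 0 ≤ p)
    {a b : Fin (l + 1)} :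
    bernProb p (fun f => Function.Injective g ∧ (a ≠ b ∧ 2 ≤ (a : ℕ) ∧ 2 ≤ (b : ℕ)) ∧
      ∀ e ∈ pathEdges l a b, f (e.map g) = true) ≤ p ^ (l + 2) := by
  by_cases h : Function.Injective g ∧ (a ≠ b ∧ 2 ≤ (a : ℕ) ∧ 2 ≤ (b : ℕ))
  · rw [← card_pathEdges h.2.1 h.2.2.1 h.2.2.2,
      ← Finset.card_image_of_injective _ (Sym2.map.injective h.1), ← bernProb_forall_true]
    refine le_of_eq ?_
    congr 1
    funext f
    simp [h]
  · refine le_trans (le_of_eq ?_) (pow_nonneg h0 (l + 2))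
    rw [← bernProb_false (ι := Sym2 (Fin n)) p]
    congr 1
    funext f
    rw [eq_iff_iff, iff_false]
    exact fun h' => h ⟨h'.1, h'.2.1⟩

lemma sq_le_two_pow_succ (m : ℕ) : m ^ 2 ≤ 2 ^ (m + 1) := by
  rcases lt_or_ge m 3 with h | h
  · interval_cases m <;> norm_num
  · induction m, h using Nat.le_induction with
    | base => norm_num
    | succ m hm ih =>
      rw [pow_succ 2]
      nlinarith

/-- Very sparse random graphs have an empty 3-core. -/
lemma bernProb_exists_mem_kCore_le {p : ℝ} (h0 : 0 ≤ p) (h1 : p ≤ 1) (hp : p * n ≤ 1 / 4) :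
    bernProb p (fun f : Sym2 (Fin n) → Bool => ∃ u, u ∈ kCore (graphOfFlip f) 3) ≤ 2 * p := by
  classical
  have hterm : ∀ l : ℕ, bernProb p (fun f : Sym2 (Fin n) → Bool =>
      ∃ x ∈ (Finset.univ : Finset ((Fin (l + 1) → Fin n) × Fin (l + 1) × Fin (l + 1))),
      Function.Injective x.1 ∧ (x.2.1 ≠ x.2.2 ∧ 2 ≤ (x.2.1 : ℕ) ∧ 2 ≤ (x.2.2 : ℕ)) ∧
      ∀ e ∈ pathEdges l x.2.1 x.2.2, f (e.map x.1) = true) ≤ p * (1 / 2) ^ l := by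
    intro l
    refine (bernProb_union_le h0 h1 _ _ fun f hf => hf).trans
      ((Finset.sum_le_card_nsmul _ _ _ fun x _ => bernProb_pathEdges_le h0).trans ?_)
    have h2 : ((l + 1 : ℕ) : ℝ) ^ 2 ≤ 2 ^ (l + 2) := by exact_mod_cast sq_le_two_pow_succ (l + 1)
    simp only [Finset.card_univ, Fintype.card_prod, Fintype.card_fun, Fintype.card_fin,
      nsmul_eq_mul, Nat.cast_mul, Nat.cast_pow]
    calc ((n : ℝ) ^ (l + 1) * (((l + 1 : ℕ) : ℝ) * ((l + 1 : ℕ) : ℝ))) * p ^ (l + 2)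
        = p * (p * n) ^ (l + 1) * ((l + 1 : ℕ) : ℝ) ^ 2 := by
          rw [mul_pow]
          ring
      _ ≤ p * (1 / 4) ^ (l + 1) * 2 ^ (l + 2) := by gcongr
      _ = p * (1 / 2) ^ l := by
          rw [show (1 / 4 : ℝ) = 1 / 2 * (1 / 2) by norm_num, mul_pow]
          have : (1 / 2 : ℝ) ^ (l + 1) * 2 ^ (l + 1) = 1 := by
            rw [← mul_pow]
            norm_num
          rw [pow_succ (2 : ℝ) (l + 1)]
          linear_combination (2 * p * (1 / 2) ^ (l + 1)) * this
  refine (bernProb_union_le h0 h1 (Finset.range n) (fun l f => ∃ x ∈ (Finset.univ :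
      Finset ((Fin (l + 1) → Fin n) × Fin (l + 1) × Fin (l + 1))), Function.Injective x.1 ∧
      (x.2.1 ≠ x.2.2 ∧ 2 ≤ (x.2.1 : ℕ) ∧ 2 ≤ (x.2.2 : ℕ)) ∧
      ∀ e ∈ pathEdges l x.2.1 x.2.2, f (e.map x.1) = true) ?_).trans
    ((Finset.sum_le_sum fun l _ => hterm l).trans ?_)
  · rintro f ⟨u, hu⟩
    obtain ⟨S, huS, hS⟩ := exists_finset_of_mem_kCore hu
    obtain ⟨l, hl, g, hg, a, b, h⟩ := exists_path_of_minDegree ⟨u, huS⟩ hS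
    exact ⟨l, Finset.mem_range.2 hl, (g, a, b), Finset.mem_univ _, hg, h⟩
  · rw [← Finset.mul_sum, mul_comm 2 p]
    exact mul_le_mul_of_nonneg_left (sum_geometric_two_le n) h0

end LongestPath

/-- Uniformly in the unperturbed graph, bad pairs are unlikely. -/
theorem exists_bernProb_exists_crStable_le {ε : ℝ} (hε : 0 < ε) : ∃ n₀ : ℕ, ∀ n ≥ n₀,
    ∀ p : ℝ, 0 ≤ p → p ≤ 1 / 2 → ∀ G₀ : SimpleGraph (Fin n),
      bernProb p (fun f => ∃ u v : Fin n, u ≠ v ∧ u ∈ kCore (graphOfFlip f) 3 ∧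
        crStableTrivial (flipGraph G₀ f) u v) ≤ ε := by
  obtain ⟨n₀, h⟩ := exists_sq_mul_bernProb_crStable_kCore_le hε
  obtain ⟨m, hm⟩ := exists_nat_gt (1 / (2 * ε))
  refine ⟨n₀ + m + 1, fun n hn p h0 hp2 G₀ => ?_⟩
  have h1 : p ≤ 1 := by linarith
  have hnR : (0 : ℝ) < n := by exact_mod_cast (by omega : 0 < n)
  rcases le_total (1 / (4 * (n : ℝ))) p with hp | hp
  · refine (bernProb_union_le h0 h1 (Finset.univ : Finset (Fin n × Fin n)) (fun x f => x.1 ≠ x.2 ∧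
      crStableTrivial (flipGraph G₀ f) x.1 x.2 ∧ x.1 ∈ kCore (graphOfFlip f) 3) ?_).trans
      ((Finset.sum_le_card_nsmul _ _ (ε / n ^ 2) fun x _ => ?_).trans_eq ?_)
    · rintro f ⟨u, v, huv, hu, hst⟩
      exact ⟨(u, v), Finset.mem_univ _, huv, hst, hu⟩
    · by_cases hx : x.1 = x.2
      · simp only [hx, ne_eq, not_true_eq_false, false_and, bernProb_false]
        positivity
      · simp only [ne_eq, hx, not_false_eq_true, true_and]
        rw [le_div_iff₀ (by positivity), mul_comm]
        exact h n (by omega) p hp hp2 G₀ x.1 x.2 hx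
    · simp only [Finset.card_univ, Fintype.card_prod, Fintype.card_fin, nsmul_eq_mul,
        Nat.cast_mul]
      field_simp
  · have hpn : p * n ≤ 1 / 4 := by
      calc p * n ≤ 1 / (4 * n) * n := by gcongr
        _ = 1 / 4 := by field_simp
    refine (bernProb_mono h0 h1 ?_).trans ((bernProb_exists_mem_kCore_le h0 h1 hpn).trans ?_)
    · rintro f ⟨u, -, -, hu, -⟩
      exact ⟨u, hu⟩
    · have hmn : (m : ℝ) ≤ n := by exact_mod_cast (by omega : m ≤ n)
      have h3 : 1 / (2 * ε) < n := hm.trans_le hmn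
      rw [div_lt_iff₀ (by positivity)] at h3
      refine le_of_mul_le_mul_right ?_ hnR
      nlinarith

/-- Proposition 4.4.
For any `p = p_n ∈ [0,1/2]` and sequence `G₀`, whp `G = G₀ △ G_rand` has the property that
`u,v` get distinct colours in `R*σ` for every pair of distinct vertices with `u` in the 3-core
of `G_rand`. -/
theorem stmt7 (p : ℕ → ℝ) (hp0 : ∀ n, 0 ≤ p n) (hp1 : ∀ n, p n ≤ 1 / 2)
    (G₀ : (n : ℕ) → SimpleGraph (Fin n)) :
    Tendsto (fun n : ℕ =>
      erdosRenyiMeasure n (p n)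
        {f | ∀ u v : Fin n, u ≠ v → u ∈ kCore (graphOfFlip f) 3 →
          ¬ crStableTrivial (symmDiffG (G₀ n) (graphOfFlip f)) u v})
      atTop (nhds 1) := by
  have h1 : ∀ n, p n ≤ 1 := fun n => (hp1 n).trans (by norm_num)
  have hbad : Tendsto (fun n : ℕ => bernProb (p n) (fun f => ∃ u v : Fin n, u ≠ v ∧
      u ∈ kCore (graphOfFlip f) 3 ∧ crStableTrivial (flipGraph (G₀ n) f) u v))
      atTop (nhds 0) := by
    refine tendsto_order.2 ⟨fun a ha => Eventually.of_forall fun n =>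
      ha.trans_le (bernProb_nonneg (hp0 n) (h1 n) _), fun a ha => ?_⟩
    obtain ⟨n₀, h⟩ := exists_bernProb_exists_crStable_le (half_pos ha)
    exact eventually_atTop.2 ⟨n₀, fun n hn =>
      (h n hn (p n) (hp0 n) (hp1 n) (G₀ n)).trans_lt (half_lt_self ha)⟩
  have hgood := ENNReal.tendsto_ofReal (hbad.const_sub 1)
  rw [sub_zero, ENNReal.ofReal_one] at hgood
  refine hgood.congr fun n => ?_
  rw [erdosRenyiMeasure_eq_bernProb (hp0 n) (h1 n), ← bernProb_compl]
  congr 2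
  funext f
  simp only [Set.mem_ofPred_eq, flipGraph]
  push Not
  rfl
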